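/- Let K be an imaginary quadratic field with class number h, and let C be an ideal class of K. Then the number of prime ideals 𝔭 ∈ C with norm N(𝔭) ≤ x and N(𝔭) a rational prime that splits in K is (1/h) · x/log x + o(x/log x) as x → ∞. -/

import Mathlib

open MeasureTheory Set Filter Topology

namespace PIT

/-! ### Part 1: a Tauberian theorem -/

/-- The Fejer kernel. -/
noncomputable def fej (v : ℝ) : ℝ := 2 * (1 - Real.cos v) / v ^ 2

lemma fej_nonneg (v : ℝ) : 0 ≤ fej v := by
  have := Real.cos_le_one v
  unfold fej
  exact div_nonneg (by linarith) (sq_nonneg _)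

lemma fej_le (v : ℝ) : fej v ≤ 5 * (1 + v ^ 2)⁻¹ := by
  unfold fej
  rcases eq_or_ne v 0 with rfl | hv
  · simp
  have h1 := Real.one_sub_sq_div_two_le_cos (x := v)
  have h2 := Real.neg_one_le_cos v
  have hv2 : 0 < v ^ 2 := by positivity
  rw [← div_eq_mul_inv, div_le_div_iff₀ hv2 (by positivity)]
  nlinarith

lemma fej_measurable : Measurable fej := by
  unfold fej
  fun_prop

lemma fej_integrable : Integrable fej := by
  refine Integrable.mono' (integrable_inv_one_add_sq.const_mul 5) fej_measurable.aestronglyMeasurable ?_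
  refine Eventually.of_forall fun v => ?_
  rw [Real.norm_of_nonneg (fej_nonneg v)]
  exact fej_le v

lemma fej_integral_pos : 0 < ∫ v, fej v := by
  rw [integral_pos_iff_support_of_nonneg fej_nonneg fej_integrable]
  refine lt_of_lt_of_le ?_ (measure_mono (s := Ioo 0 1) ?_)
  · simp
  · intro v hv
    have hv' : 0 < v ^ 2 := by have := hv.1; positivity
    have : Real.cos v < 1 := by
      have := Real.cos_lt_cos_of_nonneg_of_le_pi (x := 0) (y := v) le_rfl
        (by linarith [hv.2, Real.pi_gt_three]) hv.1
      simpa using this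
    have : 0 < fej v := by unfold fej; exact div_pos (by linarith) hv'
    exact this.ne'

/-- The triangle function. -/
noncomputable def tri (y : ℝ) : ℝ := max 0 (1 - |y|)

lemma tri_continuous : Continuous tri := by unfold tri; fun_prop

lemma tri_nonneg (y : ℝ) : 0 ≤ tri y := le_max_left _ _

lemma tri_le_one (y : ℝ) : tri y ≤ 1 := by
  unfold tri; exact max_le zero_le_one (by linarith [abs_nonneg y])

lemma tri_eq_zero {y : ℝ} (hy : y ∉ Icc (-1 : ℝ) 1) : tri y = 0 := by
  unfold tri
  apply max_eq_left
  by_contra! h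
  exact hy (abs_le.mp (by linarith))

lemma tri_compact : HasCompactSupport tri :=
  HasCompactSupport.intro (isCompact_Icc (a := (-1 : ℝ)) (b := 1)) fun _ hy => tri_eq_zero hy

lemma tri_integrable : Integrable tri := tri_continuous.integrable_of_hasCompactSupport tri_compact

lemma tri_fourier {v : ℝ} (hv : v ≠ 0) :
    ∫ y, (tri y : ℂ) * Complex.exp (Complex.I * v * y) = (fej v : ℂ) := by
  have h1 : ∫ y, (tri y : ℂ) * Complex.exp (Complex.I * v * y) =
      ∫ y in (-1 : ℝ)..1, (tri y : ℂ) * Complex.exp (Complex.I * v * y) := by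
    rw [intervalIntegral.integral_of_le (by norm_num), ← integral_Icc_eq_integral_Ioc,
      setIntegral_eq_integral_of_forall_compl_eq_zero]
    intro y hy
    rw [tri_eq_zero hy]; simp
  have hI : Complex.I * v ≠ 0 := by simp [hv]
  have hv' : (v : ℂ) ≠ 0 := by exact_mod_cast hv
  have h2 : ∫ y in (-1 : ℝ)..0, (tri y : ℂ) * Complex.exp (Complex.I * v * y) =
      1 / (Complex.I * v) - 1 / (Complex.I * v) ^ 2 + Complex.exp (-(Complex.I * v)) / (Complex.I * v) ^ 2 := by
    have : ∫ y in (-1 : ℝ)..0, (tri y : ℂ) * Complex.exp (Complex.I * v * y) =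
        ∫ y in (-1 : ℝ)..0, (1 + y : ℂ) * Complex.exp (Complex.I * v * y) := by
      apply intervalIntegral.integral_congr
      intro y hy
      rw [uIcc_of_le (by norm_num)] at hy
      have : tri y = 1 + y := by
        unfold tri; rw [abs_of_nonpos hy.2, max_eq_right] <;> linarith [hy.1]
      simp [this]
    rw [this, intervalIntegral.integral_eq_sub_of_hasDerivAt
      (f := fun y : ℝ => (1 + y : ℂ) * Complex.exp (Complex.I * v * y) / (Complex.I * v)
        - Complex.exp (Complex.I * v * y) / (Complex.I * v) ^ 2)]
    · simp
    · intro y _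
      have he : HasDerivAt (fun y : ℝ => Complex.exp (Complex.I * v * y))
          (Complex.exp (Complex.I * v * y) * (Complex.I * v * 1)) y :=
        ((Complex.ofRealCLM.hasDerivAt (x := y)).const_mul (Complex.I * v)).cexp
      have hl : HasDerivAt (fun y : ℝ => (1 + y : ℂ)) 1 y :=
        (Complex.ofRealCLM.hasDerivAt (x := y)).const_add 1
      convert! ((hl.mul he).div_const (Complex.I * v)).sub (he.div_const ((Complex.I * v) ^ 2)) using 1
      field_simp
      ring
    · apply Continuous.intervalIntegrable; fun_prop
  have h3 : ∫ y in (0 : ℝ)..1, (tri y : ℂ) * Complex.exp (Complex.I * v * y) =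
      - 1 / (Complex.I * v) - 1 / (Complex.I * v) ^ 2 + Complex.exp (Complex.I * v) / (Complex.I * v) ^ 2 := by
    have : ∫ y in (0 : ℝ)..1, (tri y : ℂ) * Complex.exp (Complex.I * v * y) =
        ∫ y in (0 : ℝ)..1, (1 - y : ℂ) * Complex.exp (Complex.I * v * y) := by
      apply intervalIntegral.integral_congr
      intro y hy
      rw [uIcc_of_le (by norm_num)] at hy
      have : tri y = 1 - y := by
        unfold tri; rw [abs_of_nonneg hy.1, max_eq_right]; linarith [hy.2]
      simp [this]
    rw [this, intervalIntegral.integral_eq_sub_of_hasDerivAt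
      (f := fun y : ℝ => (1 - y : ℂ) * Complex.exp (Complex.I * v * y) / (Complex.I * v)
        + Complex.exp (Complex.I * v * y) / (Complex.I * v) ^ 2)]
    · simp only [Complex.ofReal_one, Complex.ofReal_zero, mul_one, mul_zero, Complex.exp_zero]
      ring
    · intro y _
      have he : HasDerivAt (fun y : ℝ => Complex.exp (Complex.I * v * y))
          (Complex.exp (Complex.I * v * y) * (Complex.I * v * 1)) y :=
        ((Complex.ofRealCLM.hasDerivAt (x := y)).const_mul (Complex.I * v)).cexp
      have hl : HasDerivAt (fun y : ℝ => (1 - y : ℂ)) (-1) y :=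
        (Complex.ofRealCLM.hasDerivAt (x := y)).const_sub 1
      convert! ((hl.mul he).div_const (Complex.I * v)).add (he.div_const ((Complex.I * v) ^ 2)) using 1
      field_simp
      ring
    · apply Continuous.intervalIntegrable; fun_prop
  have hc : Continuous fun y : ℝ => (tri y : ℂ) * Complex.exp (Complex.I * v * y) := by
    have := tri_continuous
    fun_prop
  rw [h1, ← intervalIntegral.integral_add_adjacent_intervals (hc.intervalIntegrable _ 0)
    (hc.intervalIntegrable 0 _), h2, h3]
  unfold fej
  have hcos : (2 : ℂ) * Complex.cos v = Complex.exp (Complex.I * v) + Complex.exp (-(Complex.I * v)) := by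
    rw [Complex.cos]; ring_nf
  push_cast
  rw [mul_sub, hcos, mul_pow, Complex.I_sq]
  field_simp
  ring

/-- The basic identity, with damping. -/
lemma fejer_identity (f : ℝ → ℝ) (M : ℝ) (hf : Measurable f) (hM : ∀ u, |f u| ≤ M)
    {R ε : ℝ} (hR : 0 < R) (hε : 0 < ε) (x : ℝ) :
    ∫ y, (tri y : ℂ) * Complex.exp (Complex.I * (R * x) * y) *
        (∫ u in Ioi (0 : ℝ), (f u : ℂ) * Complex.exp (-(ε + Complex.I * (R * y)) * u)) =
      ∫ u in Ioi (0 : ℝ), (f u : ℂ) * (Real.exp (-ε * u) : ℂ) * (fej (R * (x - u)) : ℂ) := by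
  have hM0 : 0 ≤ M := (abs_nonneg _).trans (hM 0)
  have step : ∀ y : ℝ, (tri y : ℂ) * Complex.exp (Complex.I * (R * x) * y) *
        (∫ u in Ioi (0 : ℝ), (f u : ℂ) * Complex.exp (-(ε + Complex.I * (R * y)) * u)) =
      ∫ u in Ioi (0 : ℝ), (tri y : ℂ) * Complex.exp (Complex.I * (R * x) * y) *
        ((f u : ℂ) * Complex.exp (-(ε + Complex.I * (R * y)) * u)) := fun y => by
    rw [← integral_const_mul]
  simp_rw [step]
  rw [integral_integral_swap]
  · refine setIntegral_congr_ae measurableSet_Ioi ?_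
    have : ∀ᵐ u : ℝ, u ≠ x := by simp [ae_iff]
    filter_upwards [this] with u hu _
    have hv : R * (x - u) ≠ 0 := mul_ne_zero hR.ne' (sub_ne_zero.mpr hu.symm)
    rw [← tri_fourier hv, ← integral_const_mul]
    congr 1
    ext y
    have : Complex.exp (Complex.I * (R * x) * y) * Complex.exp (-(ε + Complex.I * (R * y)) * u)
        = (Real.exp (-ε * u) : ℂ) * Complex.exp (Complex.I * (R * (x - u) : ℝ) * y) := by
      push_cast
      rw [← Complex.exp_add, ← Complex.exp_add]
      congr 1; ring
    calc _ = (tri y : ℂ) * (f u : ℂ) * (Complex.exp (Complex.I * (R * x) * y) *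
        Complex.exp (-(ε + Complex.I * (R * y)) * u)) := by ring
      _ = _ := by rw [this]; ring
  · have hIntg : Integrable (fun p : ℝ × ℝ => tri p.1 * (M * Real.exp (-ε * p.2)))
        (volume.prod (volume.restrict (Ioi 0))) := by
      have h2 : Integrable (fun u : ℝ => M * Real.exp (-ε * u)) (volume.restrict (Ioi 0)) :=
        (integrableOn_exp_mul_Ioi (by linarith) 0).const_mul M
      exact Integrable.mul_prod tri_integrable h2
    refine hIntg.mono' ?_ ?_
    · apply Measurable.aestronglyMeasurable
      have := tri_continuous.measurable
      unfold Function.uncurry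
      fun_prop
    · refine Eventually.of_forall fun p => ?_
      simp only [Function.uncurry, norm_mul, Complex.norm_real, Complex.norm_exp]
      have e1 : (Complex.I * (↑R * ↑x) * (p.1 : ℂ)).re = 0 := by simp
      have e2 : (-(↑ε + Complex.I * (↑R * (p.1 : ℂ))) * (p.2 : ℂ)).re = -ε * p.2 := by simp
      rw [e1, e2, Real.exp_zero, mul_one, Real.norm_of_nonneg (tri_nonneg _)]
      gcongr
      · exact tri_nonneg _
      · exact hM _

end PIT


open MeasureTheory Set Filter Topology

namespace PIT

lemma fej_comp_integrable {R : ℝ} (hR : 0 < R) (x : ℝ) :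
    Integrable (fun u => fej (R * (x - u))) := by
  have h1 : Integrable (fun u => fej (R * u)) := fej_integrable.comp_mul_left' hR.ne'
  exact h1.comp_sub_left x

/-- The basic identity, without damping. -/
lemma fejer_identity_zero (f : ℝ → ℝ) (M : ℝ) (hf : Measurable f) (hM : ∀ u, |f u| ≤ M)
    (G : ℂ → ℂ) (hG : ContinuousOn G {z | 0 ≤ z.re})
    (hGeq : ∀ z : ℂ, 0 < z.re → ∫ u in Ioi (0 : ℝ), (f u : ℂ) * Complex.exp (-z * u) = G z)
    {R : ℝ} (hR : 0 < R) (x : ℝ) :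
    ∫ y, (tri y : ℂ) * Complex.exp (Complex.I * (R * x) * y) * G (Complex.I * (R * y)) =
      ∫ u in Ioi (0 : ℝ), (f u : ℂ) * (fej (R * (x - u)) : ℂ) := by
  have hM0 : 0 ≤ M := (abs_nonneg _).trans (hM 0)
  have hlim1 : Tendsto (fun ε : ℝ => ∫ u in Ioi (0 : ℝ),
      (f u : ℂ) * (Real.exp (-ε * u) : ℂ) * (fej (R * (x - u)) : ℂ)) (𝓝[>] 0)
      (𝓝 (∫ u in Ioi (0 : ℝ), (f u : ℂ) * (fej (R * (x - u)) : ℂ))) := by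
    apply tendsto_integral_filter_of_dominated_convergence (fun u => M * fej (R * (x - u)))
    · refine Eventually.of_forall fun ε => Measurable.aestronglyMeasurable ?_
      have := fej_measurable
      fun_prop
    · filter_upwards [self_mem_nhdsWithin] with ε hε
      filter_upwards [ae_restrict_mem measurableSet_Ioi] with u hu
      have hε' : 0 < ε := hε
      have hu' : 0 < u := hu
      simp only [norm_mul, Complex.norm_real, Real.norm_eq_abs, abs_of_nonneg (fej_nonneg _),
        Real.abs_exp]
      have h1 : Real.exp (-ε * u) ≤ 1 := by
        rw [Real.exp_le_one_iff]; nlinarith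
      have := fej_nonneg (R * (x - u))
      have h2 : |f u| * Real.exp (-ε * u) ≤ M * 1 := by
        gcongr
        exact hM u
      rw [mul_one] at h2
      gcongr
    · exact ((fej_comp_integrable hR x).const_mul M).integrableOn
    · refine Eventually.of_forall fun u => ?_
      have : Tendsto (fun ε : ℝ => (f u : ℂ) * (Real.exp (-ε * u) : ℂ) * (fej (R * (x - u)) : ℂ)) (𝓝 0)
          (𝓝 ((f u : ℂ) * (Real.exp (-0 * u) : ℂ) * (fej (R * (x - u)) : ℂ))) := by
        apply Continuous.tendsto (f := fun ε : ℝ =>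
          (f u : ℂ) * (Real.exp (-ε * u) : ℂ) * (fej (R * (x - u)) : ℂ))
        fun_prop
      simpa using this.mono_left nhdsWithin_le_nhds
  have hcomp : IsCompact ((fun p : ℝ × ℝ => ((p.1 : ℂ) + Complex.I * (R * p.2))) '' (Icc 0 1 ×ˢ Icc (-1) 1)) :=
    (isCompact_Icc.prod isCompact_Icc).image (by fun_prop)
  obtain ⟨D, hD⟩ := hcomp.exists_bound_of_continuousOn (hG.mono (by
    rintro _ ⟨p, hp, rfl⟩
    simpa using hp.1.1))
  have hDb : ∀ ε ∈ Icc (0 : ℝ) 1, ∀ y : ℝ, ‖(tri y : ℂ) * Complex.exp (Complex.I * (R * x) * y) *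
      G (ε + Complex.I * (R * y))‖ ≤ tri y * D := by
    intro ε hε y
    by_cases hy : y ∈ Icc (-1 : ℝ) 1
    · simp only [norm_mul, Complex.norm_real, Complex.norm_exp]
      have e1 : (Complex.I * (↑R * ↑x) * (y : ℂ)).re = 0 := by simp
      rw [e1, Real.exp_zero, mul_one, Real.norm_of_nonneg (tri_nonneg _)]
      exact mul_le_mul_of_nonneg_left (hD _ ⟨(ε, y), ⟨hε, hy⟩, rfl⟩) (tri_nonneg _)
    · simp [tri_eq_zero hy]
  have hcontG : ∀ ε : ℝ, 0 ≤ ε → Continuous fun y : ℝ => G (ε + Complex.I * (R * y)) := by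
    intro ε hε
    exact hG.comp_continuous (by fun_prop) (fun y => by simpa using hε)
  have hlim2 : Tendsto (fun ε : ℝ => ∫ y, (tri y : ℂ) * Complex.exp (Complex.I * (R * x) * y) *
      G (ε + Complex.I * (R * y))) (𝓝[>] 0)
      (𝓝 (∫ y, (tri y : ℂ) * Complex.exp (Complex.I * (R * x) * y) * G (Complex.I * (R * y)))) := by
    have hIoo : Ioo (0 : ℝ) 1 ∈ 𝓝[>] (0 : ℝ) := Ioo_mem_nhdsGT (by norm_num)
    apply tendsto_integral_filter_of_dominated_convergence (fun y => tri y * D)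
    · filter_upwards [hIoo] with ε hε
      have h1 := hcontG ε hε.1.le
      have h2 := tri_continuous
      exact (((Complex.continuous_ofReal.comp h2).mul (by fun_prop)).mul h1).aestronglyMeasurable
    · filter_upwards [hIoo] with ε hε
      exact Eventually.of_forall fun y => hDb ε ⟨hε.1.le, hε.2.le⟩ y
    · exact tri_integrable.mul_const D
    · refine Eventually.of_forall fun y => ?_
      apply Tendsto.const_mul
      have h1 : Tendsto (fun ε : ℝ => (ε + Complex.I * (R * y) : ℂ)) (𝓝[>] 0)
          (𝓝[{z : ℂ | 0 ≤ z.re}] (Complex.I * (R * y))) := by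
        apply tendsto_nhdsWithin_of_tendsto_nhds_of_eventually_within
        · have : Tendsto (fun ε : ℝ => (ε + Complex.I * (R * y) : ℂ)) (𝓝 0)
              (𝓝 (((0 : ℝ) : ℂ) + Complex.I * (R * y))) := by
            apply Continuous.tendsto (f := fun ε : ℝ => (ε + Complex.I * (R * y) : ℂ))
            fun_prop
          simpa using this.mono_left nhdsWithin_le_nhds
        · filter_upwards [hIoo] with ε hε
          simpa using hε.1.le
      exact (hG (Complex.I * (R * y)) (by simp)).tendsto.comp h1
  refine tendsto_nhds_unique (hlim2.congr' ?_) hlim1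
  filter_upwards [self_mem_nhdsWithin] with ε hε
  rw [← fejer_identity f M hf hM hR hε x]
  congr 1
  ext y
  rw [hGeq _ (by simpa using hε)]

lemma fejer_tendsto (f : ℝ → ℝ) (M : ℝ) (hf : Measurable f) (hM : ∀ u, |f u| ≤ M)
    (G : ℂ → ℂ) (hG : ContinuousOn G {z | 0 ≤ z.re})
    (hGeq : ∀ z : ℂ, 0 < z.re → ∫ u in Ioi (0 : ℝ), (f u : ℂ) * Complex.exp (-z * u) = G z)
    {R : ℝ} (hR : 0 < R) :
    Tendsto (fun x => ∫ u in Ioi (0 : ℝ), f u * fej (R * (x - u))) atTop (𝓝 0) := by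
  have h1 := Real.tendsto_integral_exp_smul_cocompact
    (fun y : ℝ => (tri y : ℂ) * G (Complex.I * (R * y)))
  have h2 : Tendsto (fun x : ℝ => -(R * x / (2 * Real.pi))) atTop (cocompact ℝ) := by
    refine Tendsto.mono_right ?_ atBot_le_cocompact
    apply tendsto_neg_atTop_atBot.comp
    exact (tendsto_id.const_mul_atTop hR).atTop_div_const (by positivity)
  have h3 := (h1.comp h2).norm
  rw [norm_zero] at h3
  rw [tendsto_zero_iff_norm_tendsto_zero]
  refine h3.congr fun x => ?_
  have h4 := fejer_identity_zero f M hf hM G hG hGeq hR x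
  have h5 : ((∫ u in Ioi (0 : ℝ), f u * fej (R * (x - u)) : ℝ) : ℂ) =
      ∫ u in Ioi (0 : ℝ), (f u : ℂ) * (fej (R * (x - u)) : ℂ) := by
    rw [← integral_complex_ofReal]
    simp
  rw [← Complex.norm_real, h5, ← h4]
  simp only [Function.comp]
  congr 2
  ext y
  rw [Circle.smul_def, Real.fourierChar_apply, smul_eq_mul]
  have : (2 * Real.pi * -(y * -(R * x / (2 * Real.pi))) : ℝ) = R * x * y := by
    field_simp
  rw [this]
  push_cast
  rw [show (R * x * y * Complex.I : ℂ) = Complex.I * (R * x) * y by ring]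
  ring

lemma fejer_tendsto' (B : ℝ → ℝ) (A M : ℝ) (hB : Measurable B) (h0 : ∀ u, 0 ≤ B u) (hM : ∀ u, B u ≤ M)
    (hneg : ∀ u < 0, B u = 0)
    (G : ℂ → ℂ) (hG : ContinuousOn G {z | 0 ≤ z.re})
    (hGeq : ∀ z : ℂ, 0 < z.re → ∫ u in Ioi (0 : ℝ), ((B u - A : ℝ) : ℂ) * Complex.exp (-z * u) = G z)
    {R : ℝ} (hR : 0 < R) :
    Tendsto (fun x => ∫ w, B (x - w / R) * fej w) atTop (𝓝 (A * ∫ w, fej w)) := by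
  have h1 := fejer_tendsto (fun u => B u - A) (M + |A|) (by fun_prop) (fun u => by
    have := abs_sub (B u) A
    rw [abs_of_nonneg (h0 u)] at this
    linarith [hM u]) G hG hGeq hR
  have hBM : ∀ u, ‖B u‖ ≤ M := fun u => by rw [Real.norm_of_nonneg (h0 u)]; exact hM u
  have key : ∀ x : ℝ, R * ∫ u in Ioi (0 : ℝ), (B u - A) * fej (R * (x - u)) =
      (∫ w, B (x - w / R) * fej w) - A * ∫ w in Iio (R * x), fej w := by
    intro x
    have hi := fej_comp_integrable hR x
    have hBi : Integrable (fun u => B u * fej (R * (x - u))) :=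
      hi.bdd_mul hB.aestronglyMeasurable (Eventually.of_forall hBM)
    have hs : ∀ F : ℝ → ℝ, R * ∫ u, F (R * (x - u)) = ∫ w, F w := by
      intro F
      rw [integral_sub_left_eq_self (fun u => F (R * u)) volume x, Measure.integral_comp_mul_left,
        abs_of_pos (inv_pos.mpr hR), smul_eq_mul, mul_inv_cancel_left₀ hR.ne']
    simp_rw [sub_mul]
    rw [integral_sub hBi.integrableOn (hi.const_mul A).integrableOn, mul_sub]
    congr 1
    · rw [setIntegral_eq_integral_of_ae_compl_eq_zero, ← hs (fun w => B (x - w / R) * fej w)]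
      · refine congrArg (R * ·) (integral_congr_ae (Eventually.of_forall fun u => ?_))
        change B u * fej (R * (x - u)) = B (x - R * (x - u) / R) * fej (R * (x - u))
        congr 2
        field_simp
        ring
      · have : ∀ᵐ u : ℝ, u ≠ 0 := by simp [ae_iff]
        filter_upwards [this] with u hu hu'
        rw [hneg u (lt_of_le_of_ne (not_lt.mp hu') hu), zero_mul]
    · rw [integral_const_mul, mul_left_comm]
      congr 1
      rw [← integral_indicator measurableSet_Iio, ← integral_indicator measurableSet_Ioi,
        ← hs ((Iio (R * x)).indicator fej)]
      refine congrArg (R * ·) (integral_congr_ae (Eventually.of_forall fun u => ?_))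
      simp only
      by_cases hu : 0 < u
      · rw [indicator_of_mem (show u ∈ Ioi 0 from hu), indicator_of_mem]
        change R * (x - u) < R * x
        nlinarith
      · rw [indicator_of_notMem (show u ∉ Ioi 0 from hu), indicator_of_notMem]
        change ¬ (R * (x - u) < R * x)
        nlinarith
  have h2 : Tendsto (fun x : ℝ => ∫ w in Iio (R * x), fej w) atTop (𝓝 (∫ w, fej w)) := by
    have h3 : Tendsto (fun x : ℝ => R * x) atTop atTop := tendsto_id.const_mul_atTop hR
    have h4 := (aecover_Iio (μ := volume) (tendsto_id (α := ℝ) (x := atTop))).integral_tendsto_of_countably_generated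
      fej_integrable
    exact h4.comp h3
  have h5 := (h1.const_mul R).add (h2.const_mul A)
  rw [mul_zero, zero_add] at h5
  refine h5.congr fun x => ?_
  rw [key]; ring

theorem tauberian (B : ℝ → ℝ) (A M : ℝ) (h0 : ∀ u, 0 ≤ B u) (hM : ∀ u, B u ≤ M)
    (hneg : ∀ u < 0, B u = 0) (hmono : Monotone fun u => B u * Real.exp u)
    (G : ℂ → ℂ) (hG : ContinuousOn G {z | 0 ≤ z.re})
    (hGeq : ∀ z : ℂ, 0 < z.re → ∫ u in Ioi (0 : ℝ), ((B u - A : ℝ) : ℂ) * Complex.exp (-z * u) = G z) :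
    Tendsto B atTop (𝓝 A) := by
  have hB : Measurable B := by
    have : B = fun u => (B u * Real.exp u) * Real.exp (-u) := by
      ext u; rw [mul_assoc, ← Real.exp_add]; simp
    rw [this]
    exact hmono.measurable.mul (by fun_prop)
  have hM0 : 0 ≤ M := (h0 0).trans (hM 0)
  set κ := ∫ w, fej w with hκ
  have hκ0 : 0 < κ := fej_integral_pos
  set I : ℕ → ℝ := fun n => ∫ w in Icc (-(n : ℝ)) n, fej w with hIdef
  have hI : Tendsto I atTop (𝓝 κ) := by
    have h4 := (aecover_Icc (μ := volume) (l := atTop (α := ℕ)) (a := fun n : ℕ => -(n : ℝ))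
      (b := fun n : ℕ => (n : ℝ))
      (tendsto_neg_atTop_atBot.comp tendsto_natCast_atTop_atTop)
      tendsto_natCast_atTop_atTop).integral_tendsto_of_countably_generated fej_integrable
    exact h4
  have hBM : ∀ u, ‖B u‖ ≤ M := fun u => by rw [Real.norm_of_nonneg (h0 u)]; exact hM u
  have hIntg : ∀ (x R : ℝ), Integrable fun w => B (x - w / R) * fej w := fun x R =>
    fej_integrable.bdd_mul (by fun_prop : Measurable fun w => B (x - w / R)).aestronglyMeasurable
      (Eventually.of_forall fun w => hBM _)
  have hinv : Tendsto (fun n : ℕ => 2 * (n : ℝ)⁻¹) atTop (𝓝 0) := by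
    simpa using (tendsto_inv_atTop_zero.comp tendsto_natCast_atTop_atTop).const_mul (2 : ℝ)
  have hcmp : ∀ u h : ℝ, 0 ≤ h → B u ≤ B (u + h) * Real.exp h := by
    intro u h hh
    have h1 := hmono (show u ≤ u + h by linarith)
    simp only [Real.exp_add] at h1
    have : 0 < Real.exp u := Real.exp_pos u
    by_contra! hlt
    nlinarith
  have hmem : ∀ (n : ℕ), 0 < n → ∀ w ∈ Icc (-(n : ℝ)) n, |w / (n : ℝ) ^ 2| ≤ (n : ℝ)⁻¹ := by
    intro n hn w hw
    have hn' : (0 : ℝ) < n := by exact_mod_cast hn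
    rw [abs_div, abs_of_pos (by positivity : (0 : ℝ) < (n : ℝ) ^ 2), div_le_iff₀ (by positivity)]
    have := abs_le.mpr hw
    calc |w| ≤ n := this
      _ = _ := by field_simp
  rw [tendsto_order]
  constructor
  · intro a ha
    have hL : Tendsto (fun n : ℕ => Real.exp (-(2 * (n : ℝ)⁻¹)) * ((A * κ - M * (κ - I n)) / κ)) atTop (𝓝 A) := by
      have := (Real.continuous_exp.tendsto (-0)).comp hinv.neg
      have h2 := this.mul ((((tendsto_const_nhds (x := A * κ)).sub
        (((tendsto_const_nhds (x := κ)).sub hI).const_mul M))).div_const κ)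
      simpa [hκ0.ne'] using h2
    obtain ⟨n, hn, hn0⟩ := ((hL.eventually (lt_mem_nhds ha)).and (eventually_gt_atTop 0)).exists
    have hn' : (0 : ℝ) < n := by exact_mod_cast hn0
    have hT := (fejer_tendsto' B A M hB h0 hM hneg G hG hGeq (R := (n : ℝ) ^ 2) (by positivity)).comp
      (tendsto_atTop_add_const_right atTop (-(n : ℝ)⁻¹) tendsto_id)
    have hE : 0 < Real.exp (2 * (n : ℝ)⁻¹) := Real.exp_pos _
    have hlt : Real.exp (2 * (n : ℝ)⁻¹) * a * κ + M * (κ - I n) < A * κ := by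
      rw [Real.exp_neg, inv_mul_eq_div, lt_div_iff₀ hE, lt_div_iff₀ hκ0] at hn
      linarith
    filter_upwards [hT.eventually (lt_mem_nhds hlt)] with x hx
    simp only [Function.comp, id] at hx
    have hub : ∫ w, B (x + -(n : ℝ)⁻¹ - w / (n : ℝ) ^ 2) * fej w ≤
        Real.exp (2 * (n : ℝ)⁻¹) * B x * κ + M * (κ - I n) := by
      have hsplit := integral_add_compl (measurableSet_Icc (a := -(n : ℝ)) (b := n))
        (hIntg (x + -(n : ℝ)⁻¹) ((n : ℝ) ^ 2))
      have hsplit2 := integral_add_compl (measurableSet_Icc (a := -(n : ℝ)) (b := n)) fej_integrable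
      rw [← hsplit]
      apply add_le_add
      · calc ∫ w in Icc (-(n : ℝ)) n, B (x + -(n : ℝ)⁻¹ - w / (n : ℝ) ^ 2) * fej w
            ≤ ∫ w in Icc (-(n : ℝ)) n, Real.exp (2 * (n : ℝ)⁻¹) * B x * fej w := by
              apply setIntegral_mono_on (hIntg _ _).integrableOn (fej_integrable.const_mul _).integrableOn
                measurableSet_Icc
              intro w hw
              apply mul_le_mul_of_nonneg_right _ (fej_nonneg w)
              have hw' := abs_le.mp (hmem n hn0 w hw)
              have h1 := hcmp (x + -(n : ℝ)⁻¹ - w / (n : ℝ) ^ 2) ((n : ℝ)⁻¹ + w / (n : ℝ) ^ 2) (by linarith)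
              rw [show x + -(n : ℝ)⁻¹ - w / (n : ℝ) ^ 2 + ((n : ℝ)⁻¹ + w / (n : ℝ) ^ 2) = x by ring] at h1
              refine h1.trans ?_
              rw [mul_comm]
              apply mul_le_mul_of_nonneg_right _ (h0 x)
              exact Real.exp_le_exp.mpr (by linarith)
          _ = Real.exp (2 * (n : ℝ)⁻¹) * B x * I n := by rw [integral_const_mul]
          _ ≤ _ := by
              apply mul_le_mul_of_nonneg_left _ (mul_nonneg hE.le (h0 x))
              exact setIntegral_le_integral fej_integrable (Eventually.of_forall fej_nonneg)
      · have : κ - I n = ∫ w in (Icc (-(n : ℝ)) n)ᶜ, fej w := by rw [hκ, ← hsplit2]; ring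
        rw [this, ← integral_const_mul]
        apply integral_mono (hIntg _ _).integrableOn (fej_integrable.const_mul _).integrableOn
        intro w
        exact mul_le_mul_of_nonneg_right (hM _) (fej_nonneg w)
    have h6 : Real.exp (2 * (n : ℝ)⁻¹) * a * κ < Real.exp (2 * (n : ℝ)⁻¹) * B x * κ := by linarith
    have h7 := lt_of_mul_lt_mul_right h6 hκ0.le
    exact lt_of_mul_lt_mul_left h7 hE.le
  · intro a ha
    have hU : Tendsto (fun n : ℕ => Real.exp (2 * (n : ℝ)⁻¹) * (A * κ / I n)) atTop (𝓝 A) := by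
      have := (Real.continuous_exp.tendsto 0).comp hinv
      have h2 := this.mul ((tendsto_const_nhds (x := A * κ)).div hI hκ0.ne')
      simpa [hκ0.ne'] using h2
    obtain ⟨n, ⟨hn, hIn⟩, hn0⟩ := (((hU.eventually (gt_mem_nhds ha)).and
      (hI.eventually (lt_mem_nhds hκ0))).and (eventually_gt_atTop 0)).exists
    have hn' : (0 : ℝ) < n := by exact_mod_cast hn0
    have hT := (fejer_tendsto' B A M hB h0 hM hneg G hG hGeq (R := (n : ℝ) ^ 2) (by positivity)).comp
      (tendsto_atTop_add_const_right atTop ((n : ℝ)⁻¹) tendsto_id)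
    have hE : 0 < Real.exp (2 * (n : ℝ)⁻¹) := Real.exp_pos _
    have hlt : A * κ < Real.exp (-(2 * (n : ℝ)⁻¹)) * a * I n := by
      rw [Real.exp_neg, mul_assoc, inv_mul_eq_div, lt_div_iff₀ hE]
      rw [← mul_div_assoc, div_lt_iff₀ hIn] at hn
      linarith
    filter_upwards [hT.eventually (gt_mem_nhds hlt)] with x hx
    simp only [Function.comp, id] at hx
    have hlb : Real.exp (-(2 * (n : ℝ)⁻¹)) * B x * I n ≤
        ∫ w, B (x + (n : ℝ)⁻¹ - w / (n : ℝ) ^ 2) * fej w := by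
      calc Real.exp (-(2 * (n : ℝ)⁻¹)) * B x * I n
          = ∫ w in Icc (-(n : ℝ)) n, Real.exp (-(2 * (n : ℝ)⁻¹)) * B x * fej w := by
            rw [integral_const_mul]
        _ ≤ ∫ w in Icc (-(n : ℝ)) n, B (x + (n : ℝ)⁻¹ - w / (n : ℝ) ^ 2) * fej w := by
              apply setIntegral_mono_on (fej_integrable.const_mul _).integrableOn (hIntg _ _).integrableOn
                measurableSet_Icc
              intro w hw
              apply mul_le_mul_of_nonneg_right _ (fej_nonneg w)
              have hw' := abs_le.mp (hmem n hn0 w hw)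
              have h1 := hcmp x ((n : ℝ)⁻¹ - w / (n : ℝ) ^ 2) (by linarith)
              rw [← add_sub_assoc] at h1
              have h2 : Real.exp ((n : ℝ)⁻¹ - w / (n : ℝ) ^ 2) ≤ Real.exp (2 * (n : ℝ)⁻¹) :=
                Real.exp_le_exp.mpr (by linarith)
              rw [Real.exp_neg, inv_mul_eq_div, div_le_iff₀ hE]
              exact h1.trans (mul_le_mul_of_nonneg_left h2 (h0 _))
        _ ≤ _ := setIntegral_le_integral (hIntg _ _) (Eventually.of_forall fun w =>
              mul_nonneg (h0 _) (fej_nonneg w))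
    have h6 := hlb.trans_lt hx
    have h7 := lt_of_mul_lt_mul_right h6 hIn.le
    exact lt_of_mul_lt_mul_left h7 (Real.exp_pos _).le

end PIT

namespace PIT
open MeasureTheory Set Filter Topology
open scoped Pointwise

theorem lat_hasSum (b : Module.Basis (Fin 2) ℝ ℂ) (f : ℂ → ℝ) (hf : Integrable f) :
    HasSum (fun l : (Submodule.span ℤ (Set.range b)).toAddSubgroup =>
      ∫ u in ZSpan.fundamentalDomain b, f (l + u)) (∫ z, f z) := by
  have h := ZSpan.isAddFundamentalDomain' b (volume : Measure ℂ)
  have : Countable (Submodule.span ℤ (Set.range b)).toAddSubgroup :=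
    inferInstanceAs (Countable (Submodule.span ℤ (Set.range b)))
  have hs := h.sum_restrict
  have h2 := MeasureTheory.hasSum_integral_measure (f := f)
    (μ := fun g : (Submodule.span ℤ (Set.range b)).toAddSubgroup =>
      (volume : Measure ℂ).restrict (g +ᵥ ZSpan.fundamentalDomain b)) (by rw [hs]; exact hf)
  rw [hs] at h2
  refine h2.congr_fun fun g => ?_
  exact ((measurePreserving_vadd g (volume : Measure ℂ)).setIntegral_image_emb
    (measurableEmbedding_const_vadd _) f (ZSpan.fundamentalDomain b)).symm

/-- the truncated paraboloid -/
noncomputable def par (x : ℝ) (z : ℂ) : ℝ := max 0 (x - ‖z‖ ^ 2)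

theorem par_cont (x : ℝ) : Continuous (par x) := by unfold par; fun_prop

theorem par_zero {x : ℝ} (hx : 0 ≤ x) {z : ℂ} (hz : √x ≤ ‖z‖) : par x z = 0 := by
  unfold par
  apply max_eq_left
  have := Real.sq_sqrt hx
  nlinarith [Real.sqrt_nonneg x]

theorem par_eq {x : ℝ} (hx : 0 ≤ x) {z : ℂ} (hz : ‖z‖ ≤ √x) : par x z = x - ‖z‖ ^ 2 := by
  unfold par
  apply max_eq_right
  have := Real.sq_sqrt hx
  nlinarith [norm_nonneg z]

theorem par_integrable {x : ℝ} (hx : 0 ≤ x) : Integrable (par x) := by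
  apply (par_cont x).integrable_of_hasCompactSupport
  apply HasCompactSupport.intro (isCompact_closedBall (0 : ℂ) (√x))
  intro z hz
  apply par_zero hx
  simp at hz
  exact hz.le

theorem par_integral {x : ℝ} (hx : 0 < x) : ∫ z, par x z = (∫ z, par 1 z) * x ^ 2 := by
  have h := Measure.integral_comp_smul (volume : Measure ℂ) (par x) (√x)
  have h2 : ∀ z : ℂ, par x (√x • z) = x * par 1 z := by
    intro z
    unfold par
    rw [norm_smul, Real.norm_of_nonneg (Real.sqrt_nonneg _), mul_pow, Real.sq_sqrt hx.le,
      mul_max_of_nonneg _ _ hx.le]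
    ring_nf
  simp_rw [h2] at h
  rw [integral_const_mul, Complex.finrank_real_complex, Real.sq_sqrt hx.le, smul_eq_mul,
    abs_of_pos (inv_pos.mpr hx)] at h
  field_simp at h
  linarith

theorem par_lip (x : ℝ) (z w : ℂ) : |par x z - par x w| ≤ |‖z‖ ^ 2 - ‖w‖ ^ 2| := by
  unfold par
  have := abs_max_sub_max_le_abs (x - ‖z‖ ^ 2) (x - ‖w‖ ^ 2) 0
  rw [max_comm 0, max_comm 0]
  refine this.trans_eq ?_
  rw [abs_sub_comm]
  congr 1
  ring

/-- majorant of the second difference -/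
noncomputable def maj (x d : ℝ) (z : ℂ) : ℝ :=
  2 * d ^ 2 * (Metric.closedBall (0 : ℂ) (√x + 2 * d)).indicator 1 z +
    2 * d * (2 * √x + 3 * d) * ((Metric.closedBall (0 : ℂ) (√x + 2 * d)).indicator 1 z -
      (Metric.ball (0 : ℂ) (max 0 (√x - 2 * d))).indicator 1 z)

theorem maj_bound {x d : ℝ} (hx : 0 ≤ x) (hd : 0 ≤ d) (l u : ℂ) (hu : ‖u‖ ≤ d) :
    |par x (l + u) + par x (l - u) - 2 * par x l| ≤ maj x d (l + u) := by
  have hsx := Real.sqrt_nonneg x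
  have t1 : ‖l + u‖ ≤ ‖l‖ + ‖u‖ := norm_add_le _ _
  have t2 : ‖l - u‖ ≤ ‖l‖ + ‖u‖ := norm_sub_le _ _
  have t3 : ‖l‖ - ‖u‖ ≤ ‖l + u‖ := by simpa using norm_sub_norm_le l (-u)
  have t4 : ‖l‖ - ‖u‖ ≤ ‖l - u‖ := norm_sub_norm_le l u
  have hl := norm_nonneg l
  have hi : ∀ z : ℂ, (Metric.ball (0 : ℂ) (max 0 (√x - 2 * d))).indicator (1 : ℂ → ℝ) z ≤
      (Metric.closedBall (0 : ℂ) (√x + 2 * d)).indicator 1 z := by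
    intro z
    apply indicator_le_indicator_of_subset _ (fun _ => zero_le_one)
    refine Metric.ball_subset_closedBall.trans (Metric.closedBall_subset_closedBall ?_)
    apply max_le <;> linarith
  have hc : 0 ≤ 2 * d * (2 * √x + 3 * d) := by positivity
  rcases le_or_gt (‖l‖ + d) (√x) with h | h
  · rw [par_eq hx (by linarith), par_eq hx (by linarith), par_eq hx (by linarith)]
    have hp := parallelogram_law_with_norm ℝ l u
    have : x - ‖l + u‖ ^ 2 + (x - ‖l - u‖ ^ 2) - 2 * (x - ‖l‖ ^ 2) = - (2 * ‖u‖ ^ 2) := by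
      nlinarith
    rw [this, abs_neg, abs_of_nonneg (by positivity)]
    unfold maj
    have h1 := hi (l + u)
    have h2 : (Metric.closedBall (0 : ℂ) (√x + 2 * d)).indicator (1 : ℂ → ℝ) (l + u) = 1 := by
      rw [indicator_of_mem]
      · rfl
      · simp; linarith
    rw [h2] at h1 ⊢
    have h3 := mul_nonneg hc (sub_nonneg.mpr h1)
    have : ‖u‖ ^ 2 ≤ d ^ 2 := by gcongr
    linarith
  · rcases le_or_gt (√x) (‖l‖ - d) with h' | h'
    · rw [par_zero hx (by linarith), par_zero hx (by linarith), par_zero hx (by linarith)]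
      unfold maj
      have h1 := hi (l + u)
      have h3 := mul_nonneg hc (sub_nonneg.mpr h1)
      have h4 : 0 ≤ (Metric.closedBall (0 : ℂ) (√x + 2 * d)).indicator (1 : ℂ → ℝ) (l + u) :=
        indicator_nonneg (fun _ _ => zero_le_one) _
      have : 0 ≤ 2 * d ^ 2 * (Metric.closedBall (0 : ℂ) (√x + 2 * d)).indicator (1 : ℂ → ℝ) (l + u) := by
        positivity
      simpa using add_nonneg this h3
    · have h2 : (Metric.closedBall (0 : ℂ) (√x + 2 * d)).indicator (1 : ℂ → ℝ) (l + u) = 1 := by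
        rw [indicator_of_mem]
        · rfl
        · simp; linarith
      have h3 : (Metric.ball (0 : ℂ) (max 0 (√x - 2 * d))).indicator (1 : ℂ → ℝ) (l + u) = 0 := by
        rw [indicator_of_notMem]
        simp only [Metric.mem_ball, dist_zero_right, not_lt]
        apply max_le (norm_nonneg _)
        linarith
      unfold maj
      rw [h2, h3]
      have e1 : |par x (l + u) - par x l| ≤ d * (2 * √x + 3 * d) := by
        refine (par_lip _ _ _).trans ?_
        rw [abs_le]
        constructor <;> nlinarith [norm_nonneg u, norm_nonneg (l + u)]
      have e2 : |par x (l - u) - par x l| ≤ d * (2 * √x + 3 * d) := by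
        refine (par_lip _ _ _).trans ?_
        rw [abs_le]
        constructor <;> nlinarith [norm_nonneg u, norm_nonneg (l - u)]
      have : |par x (l + u) + par x (l - u) - 2 * par x l| ≤
          |par x (l + u) - par x l| + |par x (l - u) - par x l| := by
        refine le_trans (le_of_eq ?_) (abs_add_le _ _)
        congr 1; ring
      nlinarith [sq_nonneg d]

theorem maj_integrable (x d : ℝ) : Integrable (maj x d) := by
  have h1 : Integrable ((Metric.closedBall (0 : ℂ) (√x + 2 * d)).indicator (1 : ℂ → ℝ)) := by
    rw [integrable_indicator_iff measurableSet_closedBall]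
    exact integrableOn_const (measure_closedBall_lt_top).ne
  have h2 : Integrable ((Metric.ball (0 : ℂ) (max 0 (√x - 2 * d))).indicator (1 : ℂ → ℝ)) := by
    rw [integrable_indicator_iff measurableSet_ball]
    exact integrableOn_const (measure_ball_lt_top).ne
  exact (h1.const_mul _).add ((h1.sub h2).const_mul _)

theorem maj_integral {d : ℝ} (hd : 0 ≤ d) : ∃ D, ∀ x : ℝ, 1 ≤ x → ∫ z, maj x d z ≤ D * x := by
  refine ⟨Real.pi * (2 * d ^ 2 * (1 + 2 * d) ^ 2 + 2 * d * (2 + 3 * d) * (4 * d * (2 + 4 * d))), ?_⟩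
  intro x hx
  have h1 : Integrable ((Metric.closedBall (0 : ℂ) (√x + 2 * d)).indicator (1 : ℂ → ℝ)) := by
    rw [integrable_indicator_iff measurableSet_closedBall]
    exact integrableOn_const (measure_closedBall_lt_top).ne
  have h2 : Integrable ((Metric.ball (0 : ℂ) (max 0 (√x - 2 * d))).indicator (1 : ℂ → ℝ)) := by
    rw [integrable_indicator_iff measurableSet_ball]
    exact integrableOn_const (measure_ball_lt_top).ne
  have h12 : Integrable (fun z => (Metric.closedBall (0 : ℂ) (√x + 2 * d)).indicator (1 : ℂ → ℝ) z -
      (Metric.ball (0 : ℂ) (max 0 (√x - 2 * d))).indicator (1 : ℂ → ℝ) z) := h1.sub h2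
  unfold maj
  rw [integral_add (h1.const_mul _) (h12.const_mul _), integral_const_mul,
    integral_const_mul, integral_sub h1 h2, integral_indicator_one measurableSet_closedBall,
    integral_indicator_one measurableSet_ball]
  have hx1 : 1 ≤ √x := Real.one_le_sqrt.mpr hx
  have v1 : (volume : Measure ℂ).real (Metric.closedBall (0 : ℂ) (√x + 2 * d)) =
      Real.pi * (√x + 2 * d) ^ 2 := by
    rw [Measure.real, Complex.volume_closedBall, ENNReal.toReal_mul, ENNReal.toReal_pow,
      ENNReal.toReal_ofReal (by positivity)]
    simp [mul_comm]
  have v2 : (volume : Measure ℂ).real (Metric.ball (0 : ℂ) (max 0 (√x - 2 * d))) =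
      Real.pi * (max 0 (√x - 2 * d)) ^ 2 := by
    rw [Measure.real, Complex.volume_ball, ENNReal.toReal_mul, ENNReal.toReal_pow,
      ENNReal.toReal_ofReal (by positivity)]
    simp [mul_comm]
  rw [v1, v2]
  set s := √x with hs
  have hsx : s ^ 2 = x := Real.sq_sqrt (by linarith)
  have b1 : (s + 2 * d) ^ 2 ≤ (1 + 2 * d) ^ 2 * x := by
    rw [← hsx, ← mul_pow]
    gcongr
    nlinarith
  set m := max 0 (s - 2 * d) with hm
  have hm0 : 0 ≤ m := le_max_left _ _
  have hm1 : s - 2 * d ≤ m := le_max_right _ _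
  have hm2 : m ≤ s := max_le (by linarith) (by linarith)
  have b2 : (s + 2 * d) ^ 2 - m ^ 2 ≤ 4 * d * (2 + 4 * d) * s := by
    have : (s + 2 * d) ^ 2 - m ^ 2 = (s + 2 * d - m) * (s + 2 * d + m) := by ring
    rw [this]
    calc (s + 2 * d - m) * (s + 2 * d + m) ≤ (4 * d) * ((2 + 4 * d) * s) := by
          gcongr
          · linarith
          · nlinarith
      _ = _ := by ring
  have b3 : 2 * d * (2 * s + 3 * d) ≤ 2 * d * (2 + 3 * d) * s := by
    have : 2 * s + 3 * d ≤ (2 + 3 * d) * s := by nlinarith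
    calc _ ≤ 2 * d * ((2 + 3 * d) * s) := by gcongr
      _ = _ := by ring
  have hpi := Real.pi_pos
  have b4 : 0 ≤ (s + 2 * d) ^ 2 - m ^ 2 := by nlinarith
  calc _ = Real.pi * (2 * d ^ 2 * (s + 2 * d) ^ 2 +
        2 * d * (2 * s + 3 * d) * ((s + 2 * d) ^ 2 - m ^ 2)) := by ring
    _ ≤ Real.pi * (2 * d ^ 2 * ((1 + 2 * d) ^ 2 * x) +
        (2 * d * (2 + 3 * d) * s) * (4 * d * (2 + 4 * d) * s)) := by gcongr
    _ = _ := by rw [← hsx]; ring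

theorem lattice_sum (b : Module.Basis (Fin 2) ℝ ℂ) : ∃ c D : ℝ, ∀ x : ℝ, 1 ≤ x →
    |∑' l : (Submodule.span ℤ (Set.range b)).toAddSubgroup, par x l - c * x ^ 2| ≤ D * x := by
  obtain ⟨d, hd⟩ := (ZSpan.fundamentalDomain_isBounded b).exists_norm_le
  have hd0 : 0 ≤ d := (norm_nonneg (ZSpan.fract b 0)).trans (hd _ (ZSpan.fract_mem_fundamentalDomain b 0))
  obtain ⟨D, hD⟩ := maj_integral hd0
  set L := (Submodule.span ℤ (Set.range b)).toAddSubgroup with hL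
  set F := ZSpan.fundamentalDomain b with hF
  have hFm : MeasurableSet F := ZSpan.fundamentalDomain_measurableSet b
  have hFfin : volume F < ⊤ := (ZSpan.fundamentalDomain_isBounded b).measure_lt_top
  have hV0 : 0 < (volume : Measure ℂ).real F :=
    ENNReal.toReal_pos (ZSpan.measure_fundamentalDomain_ne_zero b) hFfin.ne
  set V := (volume : Measure ℂ).real F with hV
  refine ⟨(∫ z, par 1 z) / V, D / (2 * V), fun x hx => ?_⟩
  have hx0 : 0 ≤ x := by linarith
  have s1 := lat_hasSum b (par x) (par_integrable hx0)
  have s2 : HasSum (fun l : L => ∫ u in F, par x (l - u)) (∫ z, par x z) := by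
    have := (Equiv.neg L).hasSum_iff.mpr s1
    refine this.congr_fun fun l => ?_
    simp only [Function.comp, Equiv.neg_apply]
    refine integral_congr_ae (Eventually.of_forall fun u => ?_)
    simp only [par, NegMemClass.coe_neg]
    rw [← norm_neg]
    congr 4
    ring
  have hfin : (Function.support fun l : L => par x l).Finite := by
    have := ZSpan.setFinite_inter b (Metric.isBounded_closedBall (x := (0 : ℂ)) (r := √x))
    refine (this.preimage (f := fun l : L => (l : ℂ)) Subtype.val_injective.injOn).subset ?_
    intro l hl
    refine ⟨?_, l.2⟩
    by_contra hh
    simp only [Metric.mem_closedBall, dist_zero_right, not_le] at hh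
    exact hl (par_zero hx0 hh.le)
  have s3 : HasSum (fun l : L => par x l) (∑' l : L, par x l) :=
    (summable_of_hasFiniteSupport hfin).hasSum
  have s4 := (s1.add s2).sub (s3.mul_left (2 * V))
  have s5 := lat_hasSum b (maj x d) (maj_integrable x d)
  have hIntg : ∀ {f : ℂ → ℝ}, Continuous f → IntegrableOn f F := fun hf =>
    (hf.continuousOn.integrableOn_compact (isCompact_closedBall (0 : ℂ) d)).mono_set
      (fun u hu => by simpa using hd u hu)
  have hc := par_cont x
  have hb : ∀ l : L, ‖(∫ u in F, par x (l + u)) + (∫ u in F, par x (l - u)) - 2 * V * par x l‖ ≤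
      ∫ u in F, maj x d (l + u) := by
    intro l
    have i1 : IntegrableOn (fun u => par x (l + u)) F := hIntg (by fun_prop)
    have i2 : IntegrableOn (fun u => par x (l - u)) F := hIntg (by fun_prop)
    have i3 : IntegrableOn (fun u : ℂ => 2 * par x l) F := hIntg (by fun_prop)
    have e : (∫ u in F, par x (l + u)) + (∫ u in F, par x (l - u)) - 2 * V * par x l =
        ∫ u in F, (par x (l + u) + par x (l - u) - 2 * par x l) := by
      have : (∫ u in F, (2 * par x l)) = 2 * V * par x l := by
        rw [setIntegral_const, smul_eq_mul]; ring
      have i12 : IntegrableOn (fun u => par x (l + u) + par x (l - u)) F := i1.add i2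
      rw [← this, integral_sub i12 i3, integral_add i1 i2]
    rw [e]
    apply norm_integral_le_of_norm_le
    · exact ((maj_integrable x d).comp_add_left (l : ℂ)).integrableOn
    · filter_upwards [ae_restrict_mem hFm] with u hu
      exact maj_bound hx0 hd0 l u (hd u hu)
  have h6 := tsum_of_norm_bounded s5 hb
  rw [s4.tsum_eq, par_integral (by linarith)] at h6
  have h7 := h6.trans (hD x hx)
  rw [Real.norm_eq_abs] at h7
  have h8 : ∑' l : L, par x l - (∫ z, par 1 z) / V * x ^ 2 = - ((∫ z, par 1 z) * x ^ 2 +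
    (∫ z, par 1 z) * x ^ 2 - 2 * V * ∑' l : L, par x l) / (2 * V) := by
    field_simp; ring
  rw [h8, abs_div, abs_neg, abs_of_pos (by positivity : 0 < 2 * V), div_mul_eq_mul_div]
  gcongr

end PIT

namespace PIT
open MeasureTheory Set Filter Topology NumberField
open scoped nonZeroDivisors

variable {K : Type*} [Field K] [NumberField K]

theorem place_unique (hdeg : Module.finrank ℚ K = 2) (himag : ∀ v : InfinitePlace K, v.IsComplex)
    (v w : InfinitePlace K) : v = w := by
  classical
  have h := InfinitePlace.card_add_two_mul_card_eq_rank K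
  rw [hdeg] at h
  have h2 : InfinitePlace.nrComplexPlaces K ≤ 1 := by omega
  unfold InfinitePlace.nrComplexPlaces at h2
  rw [Fintype.card_le_one_iff] at h2
  exact congrArg Subtype.val (h2 ⟨v, himag v⟩ ⟨w, himag w⟩)

theorem norm_sq_embedding (hdeg : Module.finrank ℚ K = 2)
    (himag : ∀ v : InfinitePlace K, v.IsComplex) (v : InfinitePlace K) (a : 𝓞 K) :
    ‖v.embedding (a : K)‖ ^ 2 = (Ideal.absNorm (Ideal.span {a}) : ℝ) := by
  have h := InfinitePlace.prod_eq_abs_norm (a : K)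
  have hu : (Finset.univ : Finset (InfinitePlace K)) = {v} := by
    ext w; simp [place_unique hdeg himag w v]
  rw [hu, Finset.prod_singleton, (himag v).mult_eq_two] at h
  rw [InfinitePlace.norm_embedding_eq, h, Ideal.absNorm_span_singleton, ← Algebra.coe_norm_int]
  push_cast
  rw [Nat.cast_natAbs]
  push_cast
  rfl

theorem finite_units (hdeg : Module.finrank ℚ K = 2)
    (himag : ∀ v : InfinitePlace K, v.IsComplex) : Finite (𝓞 K)ˣ := by
  have h : (Units.torsion K : Set (𝓞 K)ˣ) = Set.univ := by
    ext u
    simp only [SetLike.mem_coe, mem_univ, iff_true]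
    rw [Units.mem_torsion]
    intro v
    have h1 := norm_sq_embedding hdeg himag v (u : 𝓞 K)
    rw [Ideal.span_singleton_eq_top.mpr u.isUnit, Ideal.absNorm_top, InfinitePlace.norm_embedding_eq] at h1
    have : 0 ≤ v (u : 𝓞 K) := apply_nonneg _ _
    norm_num at h1
    rcases h1 with h1 | h1
    · exact h1
    · linarith
  have h2 : (Units.torsion K : Set (𝓞 K)ˣ).Finite :=
    Set.finite_coe_iff.mp (inferInstanceAs (Finite (Units.torsion K)))
  rw [h] at h2
  exact Set.finite_univ_iff.mp h2

theorem real_of_dep (f : K →+* ℂ) (p q : K) (hs : ∀ a : K, ∃ s t : ℚ, a = s * p + t * q)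
    (r : ℝ) (h : f p = r * f q) : ComplexEmbedding.IsReal f := by
  have h2 : ∀ a : K, ∃ s : ℝ, f a = s * f q := by
    intro a
    obtain ⟨s, t, rfl⟩ := hs a
    refine ⟨s * r + t, ?_⟩
    rw [map_add, map_mul, map_mul, h, map_ratCast, map_ratCast]
    push_cast; ring
  obtain ⟨s, hs1⟩ := h2 1
  rw [map_one] at hs1
  have hs0 : (s : ℂ) ≠ 0 := by rintro h; simp [h] at hs1
  have hq : f q = ((s⁻¹ : ℝ) : ℂ) := by
    push_cast
    field_simp
    rw [mul_comm, ← hs1]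
  rw [ComplexEmbedding.isReal_iff]
  ext a
  obtain ⟨t, ht⟩ := h2 a
  rw [ComplexEmbedding.conjugate_coe_eq, ht, hq, ← Complex.ofReal_mul, Complex.conj_ofReal]

theorem embedding_linearIndependent (f : K →+* ℂ) (hf : ¬ ComplexEmbedding.IsReal f)
    (e : Module.Basis (Fin 2) ℚ K) : LinearIndependent ℝ (fun i => f (e i)) := by
  have hspan : ∀ a : K, ∃ s t : ℚ, a = s * e 0 + t * e 1 := by
    intro a
    refine ⟨e.repr a 0, e.repr a 1, ?_⟩
    conv_lhs => rw [← e.sum_repr a]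
    rw [Fin.sum_univ_two, Algebra.smul_def, Algebra.smul_def]
    rfl
  rw [Fintype.linearIndependent_iff]
  intro g hg
  rw [Fin.sum_univ_two] at hg
  simp only [Complex.real_smul] at hg
  have h0 : g 0 = 0 := by
    by_contra h
    apply hf
    apply real_of_dep f (e 0) (e 1) hspan (-(g 1 / g 0))
    have : (g 0 : ℂ) ≠ 0 := by exact_mod_cast h
    push_cast
    field_simp
    linear_combination hg
  have h1 : g 1 = 0 := by
    by_contra h
    apply hf
    apply real_of_dep f (e 1) (e 0) (fun a => by
      obtain ⟨s, t, h⟩ := hspan a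
      exact ⟨t, s, by rw [h]; ring⟩) (-(g 0 / g 1))
    have : (g 1 : ℂ) ≠ 0 := by exact_mod_cast h
    push_cast
    field_simp
    linear_combination hg
  intro i
  fin_cases i <;> assumption

theorem lattice_basis (hdeg : Module.finrank ℚ K = 2) (himag : ∀ v : InfinitePlace K, v.IsComplex)
    (v : InfinitePlace K) (J : (Ideal (𝓞 K))⁰) : ∃ b : Module.Basis (Fin 2) ℝ ℂ,
    ∀ z : ℂ, z ∈ (Submodule.span ℤ (Set.range b)).toAddSubgroup ↔
      ∃ a : 𝓞 K, a ∈ (J : Ideal (𝓞 K)) ∧ v.embedding (a : K) = z := by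
  classical
  let J' : (FractionalIdeal (𝓞 K)⁰ K)ˣ := FractionalIdeal.mk0 K J
  let e0 := basisOfFractionalIdeal K J'
  have hcard : Fintype.card (Module.Free.ChooseBasisIndex ℤ J') = 2 := by
    rw [← hdeg, Module.finrank_eq_card_basis e0]
  let e : Module.Basis (Fin 2) ℚ K := e0.reindex (Fintype.equivFinOfCardEq hcard)
  have hli := embedding_linearIndependent v.embedding (InfinitePlace.isComplex_iff.mp (himag v)) e
  let b := basisOfLinearIndependentOfCardEqFinrank hli (by simp [Complex.finrank_real_complex])
  refine ⟨b, fun z => ?_⟩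
  have hb : Set.range b = v.embedding.toIntAlgHom.toLinearMap '' (Set.range e0) := by
    rw [coe_basisOfLinearIndependentOfCardEqFinrank]
    have : Set.range e0 = Set.range e := by rw [Module.Basis.range_reindex]
    rw [this, ← Set.range_comp]
    rfl
  rw [hb, ← Submodule.map_span]
  simp only [Submodule.mem_toAddSubgroup, Submodule.mem_map]
  constructor
  · rintro ⟨y, hy, rfl⟩
    rw [mem_span_basisOfFractionalIdeal] at hy
    obtain ⟨a, ha, rfl⟩ := (FractionalIdeal.mem_coeIdeal (𝓞 K)⁰).mp (by simpa [J'] using hy)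
    exact ⟨a, ha, rfl⟩
  · rintro ⟨a, ha, rfl⟩
    refine ⟨(a : K), ?_, rfl⟩
    rw [mem_span_basisOfFractionalIdeal]
    have := (FractionalIdeal.mem_coeIdeal (P := K) (𝓞 K)⁰).mpr ⟨a, ha, rfl⟩
    simpa [J'] using this


set_option maxHeartbeats 400000 in
theorem class_sum (hdeg : Module.finrank ℚ K = 2) (himag : ∀ v : InfinitePlace K, v.IsComplex)
    (C : ClassGroup (𝓞 K)) : ∃ c D : ℝ, ∀ x : ℝ, 1 ≤ x →
    |∑' I : {I : (Ideal (𝓞 K))⁰ // ClassGroup.mk0 I = C},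
      max 0 (x - (Ideal.absNorm (I.1 : Ideal (𝓞 K)) : ℝ)) - c * x ^ 2| ≤ D * x := by
  classical
  have hv : Nonempty (InfinitePlace K) := inferInstance
  obtain ⟨v⟩ := hv
  obtain ⟨J, hJ⟩ := ClassGroup.mk0_surjective C⁻¹
  obtain ⟨b, hb⟩ := lattice_basis hdeg himag v J
  obtain ⟨c, D, hcD⟩ := lattice_sum b
  have hfin := finite_units hdeg himag
  have : Fintype (𝓞 K)ˣ := Fintype.ofFinite _
  set L := (Submodule.span ℤ (Set.range b)).toAddSubgroup with hL
  set N : ℝ := (Ideal.absNorm (J : Ideal (𝓞 K)) : ℝ) with hN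
  have hN1 : 1 ≤ N := by
    rw [hN]
    exact_mod_cast Nat.one_le_iff_ne_zero.mpr (by
      rw [ne_eq, Ideal.absNorm_eq_zero_iff]; exact nonZeroDivisors.ne_zero J.2)
  set w : ℝ := (Fintype.card (𝓞 K)ˣ : ℝ) with hw
  have hw1 : 0 < w := by rw [hw]; exact_mod_cast Fintype.card_pos
  -- generators
  have hgen : ∀ I : {I : (Ideal (𝓞 K))⁰ // ClassGroup.mk0 I = C},
      ∃ g : 𝓞 K, (I.1 : Ideal (𝓞 K)) * J = Ideal.span {g} := by
    intro I
    have h1 : ClassGroup.mk0 (I.1 * J) = 1 := by rw [map_mul, I.2, hJ, mul_inv_cancel]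
    have h2 := (ClassGroup.mk0_eq_one_iff (I.1 * J).2).mp h1
    obtain ⟨g, hg⟩ := h2.principal
    exact ⟨g, hg⟩
  choose g hg using hgen
  have hspan : ∀ (I : {I : (Ideal (𝓞 K))⁰ // ClassGroup.mk0 I = C}) (u : (𝓞 K)ˣ),
      Ideal.span {g I * u} = (I.1 : Ideal (𝓞 K)) * J := by
    intro I u
    rw [hg, Ideal.span_singleton_mul_right_unit u.isUnit]
  have hmem : ∀ p : {I : (Ideal (𝓞 K))⁰ // ClassGroup.mk0 I = C} × (𝓞 K)ˣ,
      v.embedding ((g p.1 * (p.2 : 𝓞 K) : 𝓞 K) : K) ∈ L := by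
    intro p
    rw [hb]
    refine ⟨g p.1 * (p.2 : 𝓞 K), ?_, rfl⟩
    have h1 : g p.1 * (p.2 : 𝓞 K) ∈ Ideal.span {g p.1 * (p.2 : 𝓞 K)} :=
      Ideal.mem_span_singleton_self _
    rw [hspan] at h1
    exact Ideal.mul_le_right h1
  let φ : {I : (Ideal (𝓞 K))⁰ // ClassGroup.mk0 I = C} × (𝓞 K)ˣ → L := fun p => ⟨_, hmem p⟩
  have hg0 : ∀ I, g I ≠ 0 := by
    intro I h
    have := hg I
    rw [h, Ideal.span_singleton_eq_bot.mpr rfl, ← Ideal.zero_eq_bot, mul_eq_zero] at this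
    rcases this with h | h
    · exact nonZeroDivisors.ne_zero I.1.2 h
    · exact nonZeroDivisors.ne_zero J.2 h
  have hemb : ∀ a b : 𝓞 K, v.embedding (a : K) = v.embedding (b : K) → a = b := by
    intro a b h
    exact RingOfIntegers.coe_injective (v.embedding.injective h)
  have hφinj : Function.Injective φ := by
    rintro ⟨I, u⟩ ⟨I', u'⟩ h
    have h1 := hemb _ _ (congrArg Subtype.val h)
    simp only at h1
    have h2 := hspan I u
    rw [h1, hspan] at h2
    have h3 : I = I' := by
      apply Subtype.ext
      apply Subtype.ext
      exact (mul_right_cancel₀ (nonZeroDivisors.ne_zero J.2) h2).symm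
    subst h3
    have h4 := mul_left_cancel₀ (hg0 I) h1
    rw [Units.ext h4]
  have hnsq := norm_sq_embedding hdeg himag v
  have hφnorm : ∀ p, ‖(φ p : ℂ)‖ ^ 2 = (Ideal.absNorm (p.1.1 : Ideal (𝓞 K)) : ℝ) * N := by
    intro p
    rw [hnsq, hspan, map_mul]
    push_cast
    rfl
  have hφsurj : ∀ l : L, l ≠ 0 → l ∈ Set.range φ := by
    intro l hl
    obtain ⟨a, ha, hal⟩ := (hb _).mp l.2
    have ha0 : a ≠ 0 := by
      rintro rfl
      apply hl
      apply Subtype.ext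
      rw [← hal]; simp
    obtain ⟨I, hI⟩ := Ideal.dvd_iff_le.mpr ((Ideal.span_singleton_le_iff_mem _).mpr ha)
    have hI0 : I ≠ 0 := by
      rintro rfl
      rw [mul_zero, Ideal.zero_eq_bot, Ideal.span_singleton_eq_bot] at hI
      exact ha0 hI
    let I' : (Ideal (𝓞 K))⁰ := ⟨I, mem_nonZeroDivisors_of_ne_zero hI0⟩
    have hIC : ClassGroup.mk0 I' = C := by
      have h1 : ClassGroup.mk0 (J * I') = 1 := by
        rw [ClassGroup.mk0_eq_one_iff (J * I').2]
        exact ⟨a, hI.symm⟩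
      rw [map_mul, hJ] at h1
      exact (inv_mul_eq_one.mp h1).symm
    have hass : Associated (g ⟨I', hIC⟩) a := by
      rw [← Ideal.span_singleton_eq_span_singleton, ← hg, hI, mul_comm]
    obtain ⟨u, hu⟩ := hass
    refine ⟨(⟨I', hIC⟩, u), ?_⟩
    apply Subtype.ext
    change v.embedding ((g ⟨I', hIC⟩ * u : 𝓞 K) : K) = _
    rw [hu, hal]
  refine ⟨c * N / w, (D * N + N) / (w * N), fun x hx => ?_⟩
  have hx0 : 0 ≤ x := by linarith
  have hy : 1 ≤ x * N := by nlinarith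
  have key := hcD (x * N) hy
  have hsfin : (Function.support fun l : L => par (x * N) l).Finite := by
    have := ZSpan.setFinite_inter b (Metric.isBounded_closedBall (x := (0 : ℂ)) (r := √(x * N)))
    refine (this.preimage (f := fun l : L => (l : ℂ)) Subtype.val_injective.injOn).subset ?_
    intro l hl
    refine ⟨?_, l.2⟩
    by_contra hh
    simp only [Metric.mem_closedBall, dist_zero_right, not_le] at hh
    exact hl (par_zero (by linarith) hh.le)
  have hsum : Summable fun l : L => par (x * N) l := summable_of_hasFiniteSupport hsfin
  rw [hsum.tsum_eq_add_tsum_ite 0] at key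
  have hpar : ∀ p, par (x * N) (φ p) = N * max 0 (x - (Ideal.absNorm (p.1.1 : Ideal (𝓞 K)) : ℝ)) := by
    intro p
    unfold par
    rw [hφnorm, mul_max_of_nonneg _ _ (by linarith)]
    ring_nf
  have hφ0 : ∀ p, φ p ≠ 0 := by
    intro p h
    have h1 : v.embedding ((g p.1 * (p.2 : 𝓞 K) : 𝓞 K) : K) = 0 := congrArg Subtype.val h
    have h2 := hemb (g p.1 * (p.2 : 𝓞 K)) 0 (h1.trans (by simp))
    rcases mul_eq_zero.mp h2 with h3 | h3
    · exact hg0 _ h3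
    · exact p.2.ne_zero h3
  have e1 : ∑' l : L, (if l = 0 then 0 else par (x * N) l) =
      ∑' p, N * max 0 (x - (Ideal.absNorm ((p : {I : (Ideal (𝓞 K))⁰ // ClassGroup.mk0 I = C} × (𝓞 K)ˣ).1.1
        : Ideal (𝓞 K)) : ℝ)) := by
    rw [← hφinj.tsum_eq]
    · refine tsum_congr fun p => ?_
      rw [if_neg (hφ0 p), hpar]
    · intro l hl
      apply hφsurj
      rintro rfl
      simp at hl
  have hsp : Summable fun p : {I : (Ideal (𝓞 K))⁰ // ClassGroup.mk0 I = C} × (𝓞 K)ˣ =>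
      N * max 0 (x - (Ideal.absNorm (p.1.1 : Ideal (𝓞 K)) : ℝ)) := by
    have := hsum.comp_injective hφinj
    refine this.congr fun p => ?_
    exact hpar p
  rw [e1, hsp.tsum_prod' (fun I => (hasSum_fintype _).summable)] at key
  simp only [tsum_fintype, Finset.sum_const, Finset.card_univ, nsmul_eq_mul] at key
  rw [tsum_mul_left, tsum_mul_left] at key
  rw [← hw] at key
  set S := ∑' I : {I : (Ideal (𝓞 K))⁰ // ClassGroup.mk0 I = C},
      max 0 (x - (Ideal.absNorm (I.1 : Ideal (𝓞 K)) : ℝ)) with hS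
  have hp0 : par (x * N) ((0 : L) : ℂ) = x * N := by
    unfold par; simp; nlinarith
  rw [hp0] at key
  have hN0 : 0 < N := by linarith
  have h9 : S - c * N / w * x ^ 2 = ((x * N + w * (N * S) - c * (x * N) ^ 2) - x * N) / (w * N) := by
    field_simp; ring
  rw [h9, abs_div, abs_of_pos (by positivity : 0 < w * N), div_mul_eq_mul_div]
  gcongr
  calc |x * N + w * (N * S) - c * (x * N) ^ 2 - x * N|
      ≤ |x * N + w * (N * S) - c * (x * N) ^ 2| + |x * N| := abs_sub _ _
    _ ≤ D * (x * N) + x * N := by rw [abs_of_nonneg (by positivity : 0 ≤ x * N)]; linarith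
    _ = _ := by ring

end PIT

namespace PIT
open MeasureTheory Set Filter Topology

/-- kernel -/
noncomputable def ker (n : ℕ) (s : ℂ) (x : ℝ) : ℂ := ((max 0 (x - n) : ℝ) : ℂ) * (x : ℂ) ^ (-s - 2)

theorem ker_eq (n : ℕ) (hn : 1 ≤ n) {s : ℂ} (hs : 0 < s.re) :
    IntegrableOn (ker n s) (Ioi 1) ∧
    ∫ x in Ioi (1 : ℝ), ker n s x = (n : ℂ) ^ (-s) / (s * (s + 1)) := by
  have hn0 : (0 : ℝ) < n := by exact_mod_cast hn
  have hnC : (n : ℂ) ≠ 0 := by exact_mod_cast hn0.ne'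
  have r1 : (-s - 1).re < -1 := by simp; linarith
  have r2 : (-s - 2).re < -1 := by simp; linarith
  have i1 := integrableOn_Ioi_cpow_of_lt r1 hn0
  have i2 := integrableOn_Ioi_cpow_of_lt r2 hn0
  have v1 := integral_Ioi_cpow_of_lt r1 hn0
  have v2 := integral_Ioi_cpow_of_lt r2 hn0
  have hsub : Ioi (n : ℝ) ⊆ Ioi 1 := Ioi_subset_Ioi (by exact_mod_cast hn)
  have hz : ∀ x ∈ Ioi (1 : ℝ), x ∉ Ioi (n : ℝ) → ker n s x = 0 := by
    intro x _ hx
    simp only [mem_Ioi, not_lt] at hx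
    simp [ker, max_eq_left (sub_nonpos.mpr hx)]
  have he : EqOn (fun x : ℝ => (x : ℂ) ^ (-s - 1) - n * (x : ℂ) ^ (-s - 2)) (ker n s) (Ioi (n : ℝ)) := by
    intro x hx
    have hx0 : (x : ℂ) ≠ 0 := by
      have := hn0.trans hx
      exact_mod_cast this.ne'
    have hx' : (0 : ℝ) ≤ x - n := sub_nonneg.mpr (le_of_lt hx)
    simp only [ker, max_eq_right hx']
    have : (x : ℂ) ^ (-s - 1) = x * (x : ℂ) ^ (-s - 2) := by
      rw [show -s - 1 = (-s - 2) + 1 by ring, Complex.cpow_add _ _ hx0, Complex.cpow_one, mul_comm]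
    rw [this]; push_cast; ring
  have hI : IntegrableOn (fun x : ℝ => (x : ℂ) ^ (-s - 1) - n * (x : ℂ) ^ (-s - 2)) (Ioi (n : ℝ)) :=
    i1.sub (i2.const_mul _)
  constructor
  · exact (hI.congr_fun he measurableSet_Ioi).of_forall_sdiff_eq_zero measurableSet_Ioi
      (fun x hx => hz x hx.1 hx.2)
  · rw [setIntegral_eq_of_subset_of_forall_sdiff_eq_zero measurableSet_Ioi hsub
      (fun x hx => hz x hx.1 hx.2), ← setIntegral_congr_fun measurableSet_Ioi he,
      integral_sub i1 (i2.const_mul _), integral_const_mul, v1, v2]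
    have hs0 : s ≠ 0 := by rintro rfl; simp at hs
    have hs1 : s + 1 ≠ 0 := by
      intro h
      have := congrArg Complex.re h
      simp at this; linarith
    have e1 : -s - 1 + 1 = -s := by ring
    have e2 : -s - 2 + 1 = -(s + 1) := by ring
    rw [e1, e2]
    push_cast
    have : (n : ℂ) ^ (-s) = n * (n : ℂ) ^ (-(s + 1)) := by
      rw [show -s = -(s + 1) + 1 by ring, Complex.cpow_add _ _ hnC, Complex.cpow_one, mul_comm]
    rw [this]
    field_simp
    ring

theorem ker_norm (n : ℕ) (s : ℂ) {x : ℝ} (hx : 1 < x) :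
    ‖ker n s x‖ = (ker n (s.re : ℂ) x).re := by
  have hx0 : 0 < x := by linarith
  have e : ker n (s.re : ℂ) x = ((max 0 (x - n) * x ^ (-s.re - 2) : ℝ) : ℂ) := by
    unfold ker
    rw [Complex.ofReal_mul, Complex.ofReal_cpow hx0.le]
    push_cast; rfl
  rw [e, Complex.ofReal_re]
  unfold ker
  rw [norm_mul, Complex.norm_real, Real.norm_of_nonneg (le_max_left _ _),
    Complex.norm_cpow_eq_rpow_re_of_pos hx0]
  simp

theorem smooth_integral (a : ℕ → ℝ) (ha : ∀ n, 0 ≤ a n) (ha0 : a 0 = 0) {s : ℂ} (hs1 : 1 < s.re)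
    (hs : LSeriesSummable (fun n => (a n : ℂ)) s) (hs' : LSeriesSummable (fun n => (a n : ℂ)) s.re) :
    LSeries (fun n => (a n : ℂ)) s = s * (s + 1) *
      ∫ x in Ioi (1 : ℝ), ((∑' n, a n * max 0 (x - n) : ℝ) : ℂ) * (x : ℂ) ^ (-s - 2) := by
  have hs0 : 0 < s.re := by linarith
  have hsn : s * (s + 1) ≠ 0 := by
    apply mul_ne_zero
    · rintro rfl; simp at hs0
    · intro h
      have := congrArg Complex.re h
      simp at this; linarith
  have hterm : ∀ (s : ℂ), 0 < s.re → ∀ n : ℕ, ∫ x in Ioi (1 : ℝ), (a n : ℂ) * ker n s x =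
      LSeries.term (fun n => (a n : ℂ)) s n / (s * (s + 1)) := by
    intro s hs n
    rcases Nat.eq_zero_or_pos n with rfl | hn
    · simp [ha0]
    · rw [integral_const_mul, (ker_eq n hn hs).2, LSeries.term_of_ne_zero hn.ne', Complex.cpow_neg]
      ring
  have hIntg : ∀ n : ℕ, IntegrableOn (fun x => (a n : ℂ) * ker n s x) (Ioi 1) := by
    intro n
    rcases Nat.eq_zero_or_pos n with rfl | hn
    · simp [ha0]
    · exact (ker_eq n hn hs0).1.const_mul _
  have hnorm : ∀ n : ℕ, ∫ x in Ioi (1 : ℝ), ‖(a n : ℂ) * ker n s x‖ =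
      (LSeries.term (fun n => (a n : ℂ)) s.re n / (s.re * (s.re + 1))).re := by
    intro n
    rw [← hterm s.re (by simpa using hs0) n]
    have hIntg' : IntegrableOn (fun x => (a n : ℂ) * ker n s.re x) (Ioi 1) := by
      rcases Nat.eq_zero_or_pos n with rfl | hn
      · simp [ha0]
      · exact (ker_eq n hn (by simpa using hs0)).1.const_mul _
    rw [show (∫ x in Ioi (1 : ℝ), (a n : ℂ) * ker n s.re x).re = _ from (integral_re hIntg').symm]
    refine setIntegral_congr_fun measurableSet_Ioi fun x hx => ?_
    simp only [norm_mul, ker_norm n s hx, Complex.norm_real, Real.norm_of_nonneg (ha n)]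
    simp
  have hsumm : Summable fun n : ℕ => ∫ x in Ioi (1 : ℝ), ‖(a n : ℂ) * ker n s x‖ := by
    simp_rw [hnorm]
    have := (Summable.div_const hs' ((s.re : ℂ) * (s.re + 1)))
    exact Complex.reCLM.summable this
  have h := hasSum_integral_of_summable_integral_norm hIntg hsumm
  simp_rw [hterm s hs0] at h
  have h2 := (hs.hasSum.div_const (s * (s + 1))).unique h
  have h3 : ∀ x ∈ Ioi (1 : ℝ), ∑' n : ℕ, (a n : ℂ) * ker n s x =
      ((∑' n, a n * max 0 (x - n) : ℝ) : ℂ) * (x : ℂ) ^ (-s - 2) := by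
    intro x _
    rw [Complex.ofReal_tsum, ← tsum_mul_right]
    refine tsum_congr fun n => ?_
    unfold ker; push_cast; ring
  rw [setIntegral_congr_fun measurableSet_Ioi h3] at h2
  rw [← h2, mul_div_cancel₀ _ hsn]
  rfl

theorem continuation (a : ℕ → ℝ) (ha : ∀ n, 0 ≤ a n) (ha0 : a 0 = 0)
    (hs : ∀ s : ℂ, 1 < s.re → LSeriesSummable (fun n => (a n : ℂ)) s) (c D : ℝ)
    (h : ∀ x : ℝ, 1 ≤ x → |∑' n : ℕ, a n * max 0 (x - n) - c * x ^ 2| ≤ D * x) :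
    ∃ H : ℂ → ℂ, DifferentiableOn ℂ H {s | 0 < s.re} ∧
      ∀ s : ℂ, 1 < s.re → LSeries (fun n => (a n : ℂ)) s = H s + 2 * c / (s - 1) := by
  set E : ℝ → ℂ := (Ioi (1 : ℝ)).indicator
    (fun x => ((∑' n : ℕ, a n * max 0 (x - n) - c * x ^ 2 : ℝ) : ℂ)) with hE
  have hmono : Monotone fun x : ℝ => ∑' n : ℕ, a n * max 0 (x - n) := by
    have hsum : ∀ x : ℝ, Summable fun n : ℕ => a n * max 0 (x - n) := by
      intro x
      apply summable_of_hasFiniteSupport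
      refine (Set.finite_le_nat ⌈x⌉₊).subset ?_
      intro n hn
      by_contra hh
      simp only [mem_setOf_eq, not_le] at hh
      apply hn
      have : x ≤ n := (Nat.le_ceil x).trans (by exact_mod_cast hh.le)
      simp [max_eq_left (sub_nonpos.mpr this)]
    intro x y hxy
    refine (hsum x).tsum_le_tsum (fun n => ?_) (hsum y)
    have := ha n
    gcongr
  have hmeas : Measurable E := by
    refine Measurable.indicator ?_ measurableSet_Ioi
    exact Complex.measurable_ofReal.comp (hmono.measurable.sub (by fun_prop))
  have hEb : ∀ x : ℝ, 0 ≤ x → ‖E x‖ ≤ |D| * x := by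
    intro x hx0
    by_cases hx : x ∈ Ioi (1 : ℝ)
    · rw [hE, indicator_of_mem hx, Complex.norm_real, Real.norm_eq_abs]
      refine (h x (le_of_lt hx)).trans ?_
      gcongr
      exact le_abs_self D
    · rw [hE, indicator_of_notMem hx, norm_zero]
      positivity
  have hloc : LocallyIntegrableOn E (Ioi 0) := by
    rw [locallyIntegrableOn_iff isOpen_Ioi.isLocallyClosed]
    intro k hk hkc
    have hc : IntegrableOn (fun x : ℝ => |D| * x) k := (by fun_prop : Continuous fun x : ℝ => |D| * x).continuousOn.integrableOn_compact hkc
    refine Integrable.mono' hc hmeas.aestronglyMeasurable ?_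
    filter_upwards [ae_restrict_mem hkc.measurableSet] with x hx
    exact hEb x (le_of_lt (hk hx))
  have htop : E =O[atTop] fun x : ℝ => x ^ (-(-1 : ℝ)) := by
    refine Asymptotics.IsBigO.of_bound |D| ?_
    filter_upwards [eventually_ge_atTop 0] with x hx
    rw [neg_neg, Real.rpow_one, Real.norm_of_nonneg hx]
    exact hEb x hx
  have hbot : ∀ b : ℝ, E =O[𝓝[>] 0] fun x : ℝ => x ^ (-b) := by
    intro b
    refine Asymptotics.IsBigO.of_bound 1 ?_
    filter_upwards [Ioo_mem_nhdsGT (show (0 : ℝ) < 1 by norm_num)] with x hx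
    rw [hE, indicator_of_notMem (by simpa using hx.2.le), norm_zero]
    positivity
  refine ⟨fun s => c * (s + 2) + s * (s + 1) * mellin E (-s - 1), ?_, ?_⟩
  · intro s hs0
    apply DifferentiableAt.differentiableWithinAt
    have hs0' : 0 < s.re := hs0
    have hm : DifferentiableAt ℂ (mellin E) (-s - 1) :=
      mellin_differentiableAt_of_isBigO_rpow (b := (-s - 1).re - 1) hloc htop (by simp; linarith)
        (hbot _) (by linarith)
    have hm2 : DifferentiableAt ℂ (fun s => mellin E (-s - 1)) s :=
      DifferentiableAt.comp (g := mellin E) s hm (by fun_prop)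
    fun_prop
  · intro s hs1
    have hs0 : 0 < s.re := by linarith
    rw [smooth_integral a ha ha0 hs1 (hs s hs1) (hs _ (by simpa using hs1))]
    have hmc : MellinConvergent E (-s - 1) :=
      mellinConvergent_of_isBigO_rpow (b := (-s - 1).re - 1) hloc htop (by simp; linarith)
        (hbot _) (by linarith)
    have r1 : (-s).re < -1 := by simpa using hs1
    have i1 := integrableOn_Ioi_cpow_of_lt r1 one_pos
    have v1 := integral_Ioi_cpow_of_lt r1 one_pos
    have hi2 : IntegrableOn (fun x : ℝ => (x : ℂ) ^ (-s - 1 - 1) • E x) (Ioi 1) :=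
      IntegrableOn.mono_set hmc (Ioi_subset_Ioi zero_le_one)
    have hme : mellin E (-s - 1) = ∫ x in Ioi (1 : ℝ), (x : ℂ) ^ (-s - 1 - 1) • E x := by
      unfold mellin
      refine (setIntegral_eq_of_subset_of_forall_sdiff_eq_zero measurableSet_Ioi
        (Ioi_subset_Ioi zero_le_one) fun x hx => ?_)
      rw [hE, indicator_of_notMem hx.2, smul_zero]
    have hx : EqOn (fun x : ℝ => ((∑' n : ℕ, a n * max 0 (x - n) : ℝ) : ℂ) * (x : ℂ) ^ (-s - 2))
        (fun x : ℝ => c * (x : ℂ) ^ (-s) + (x : ℂ) ^ (-s - 1 - 1) • E x) (Ioi 1) := by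
      intro x hx
      have hx0 : (x : ℂ) ≠ 0 := by
        have : (0 : ℝ) < x := one_pos.trans hx
        exact_mod_cast this.ne'
      simp only [hE, indicator_of_mem hx]
      have e1 : (x : ℂ) ^ (-s) = (x : ℂ) ^ 2 * (x : ℂ) ^ (-s - 2) := by
        rw [show -s = (-s - 2) + 2 by ring, Complex.cpow_add _ _ hx0, mul_comm]
        congr 1
        · norm_cast
        · ring_nf
      rw [e1, show -s - 1 - 1 = -s - 2 by ring]
      push_cast
      rw [smul_eq_mul]
      ring
    rw [setIntegral_congr_fun measurableSet_Ioi hx, integral_add (i1.const_mul _) hi2,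
      integral_const_mul, v1, ← hme]
    have hne : s - 1 ≠ 0 := by
      intro h
      have := congrArg Complex.re h
      simp at this; linarith
    have hne2 : -s + 1 ≠ 0 := by
      intro h; apply hne; linear_combination -h
    simp only [Complex.ofReal_one, Complex.one_cpow]
    have : -(1 : ℂ) / (-s + 1) = 1 / (s - 1) := by
      rw [div_eq_div_iff hne2 hne]; ring
    rw [this]
    field_simp
    ring

end PIT

namespace PIT
open MeasureTheory Set Filter Topology NumberField
open scoped nonZeroDivisors

variable {K : Type*} [Field K] [NumberField K]

/-- nonzero ideals of norm n -/
noncomputable def fib (K : Type*) [Field K] [NumberField K] (n : ℕ) : Finset (Ideal (𝓞 K)) :=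
  ((Ideal.finite_setOfPred_absNorm_le (S := 𝓞 K) n).subset
    (t := {I : Ideal (𝓞 K) | I ≠ 0 ∧ Ideal.absNorm I = n}) (fun _ h => h.2.le)).toFinset

theorem mem_fib {n : ℕ} {I : Ideal (𝓞 K)} : I ∈ fib K n ↔ I ≠ 0 ∧ Ideal.absNorm I = n := by
  simp [fib]

theorem fib_zero : fib K 0 = ∅ := by
  ext I
  rw [mem_fib, Ideal.absNorm_eq_zero_iff]
  simp only [Finset.notMem_empty, iff_false]
  exact fun h => h.1 h.2

theorem fib_one : fib K 1 = {1} := by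
  ext I
  rw [mem_fib, Ideal.absNorm_eq_one_iff, Finset.mem_singleton, Ideal.one_eq_top]
  refine ⟨fun h => h.2, fun h => ⟨?_, h⟩⟩
  rw [h, ← Ideal.one_eq_top]
  exact one_ne_zero

/-- class of an ideal -/
noncomputable def cls (I : Ideal (𝓞 K)) : ClassGroup (𝓞 K) :=
  open Classical in
  if h : I ∈ (Ideal (𝓞 K))⁰ then ClassGroup.mk0 ⟨I, h⟩ else 1

theorem cls_eq {I : Ideal (𝓞 K)} (h : I ∈ (Ideal (𝓞 K))⁰) : cls I = ClassGroup.mk0 ⟨I, h⟩ := by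
  simp [cls, h]

theorem cls_mul {I J : Ideal (𝓞 K)} (hI : I ≠ 0) (hJ : J ≠ 0) : cls (I * J) = cls I * cls J := by
  rw [cls_eq (mem_nonZeroDivisors_of_ne_zero hI), cls_eq (mem_nonZeroDivisors_of_ne_zero hJ),
    cls_eq (mem_nonZeroDivisors_of_ne_zero (mul_ne_zero hI hJ)), ← map_mul]
  rfl

theorem cls_one : cls (1 : Ideal (𝓞 K)) = 1 := by
  have h := cls_mul (K := K) (I := 1) (J := 1) one_ne_zero one_ne_zero
  rw [mul_one] at h
  simpa using h

/-- ideal von Mangoldt function -/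
noncomputable def vM (D : Ideal (𝓞 K)) : ℝ :=
  open Classical in
  if h : IsPrimePow D then Real.log (Ideal.absNorm h.choose) else 0

theorem vM_pow {P : Ideal (𝓞 K)} (hP : Prime P) {k : ℕ} (hk : 0 < k) :
    vM (P ^ k) = Real.log (Ideal.absNorm P) := by
  have h : IsPrimePow (P ^ k) := ⟨P, k, hP, hk, rfl⟩
  have h2 := h.choose_spec
  obtain ⟨j, hQ, hj, he⟩ := h2
  rw [vM, dif_pos h]
  have h3 : P ∣ h.choose := hP.dvd_of_dvd_pow (he ▸ dvd_pow_self P hk.ne')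
  have h4 : P = h.choose := associated_iff_eq.mp (hP.associated_of_dvd hQ h3)
  rw [← h4]

theorem vM_eq_zero {D : Ideal (𝓞 K)} (h : ¬ IsPrimePow D) : vM D = 0 := by
  rw [vM, dif_neg h]

theorem vM_nonneg (D : Ideal (𝓞 K)) : 0 ≤ vM D := by
  rw [vM]
  split_ifs with h
  · exact Real.log_natCast_nonneg _
  · rfl

/-- divisors of a nonzero ideal -/
noncomputable def dvs (T : Ideal (𝓞 K)) : Finset (Ideal (𝓞 K)) :=
  ((Ideal.finite_setOfPred_absNorm_le (S := 𝓞 K) (Ideal.absNorm T)).subset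
    (t := {D : Ideal (𝓞 K) | D ∣ T ∧ T ≠ 0}) (fun D h => by
      obtain ⟨⟨E, rfl⟩, h2⟩ := h
      simp only [Set.mem_ofPred_eq, map_mul]
      apply Nat.le_mul_of_pos_right
      apply Nat.pos_of_ne_zero
      rw [ne_eq, Ideal.absNorm_eq_zero_iff]
      exact right_ne_zero_of_mul h2)).toFinset

theorem mem_dvs {D T : Ideal (𝓞 K)} : D ∈ dvs T ↔ D ∣ T ∧ T ≠ 0 := by simp [dvs]

theorem sum_vM (T : Ideal (𝓞 K)) (hT : T ≠ 0) :
    ∑ D ∈ dvs T, vM D = Real.log (Ideal.absNorm T) := by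
  classical
  induction T using UniqueFactorizationMonoid.induction_on_prime with
  | h₁ => exact absurd rfl hT
  | h₂ T h =>
    have : T = 1 := by rw [Ideal.isUnit_iff] at h; rw [h, Ideal.one_eq_top]
    subst this
    rw [map_one, Nat.cast_one, Real.log_one]
    apply Finset.sum_eq_zero
    intro D hD
    apply vM_eq_zero
    rintro ⟨P, k, hP, hk, rfl⟩
    have := (mem_dvs.mp hD).1
    exact hP.not_isUnit (isUnit_of_dvd_one ((dvd_pow_self P hk.ne').trans this))
  | h₃ T P hT0 hP ih =>
    have hsub : dvs T ⊆ dvs (P * T) := by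
      intro D hD
      rw [mem_dvs] at hD ⊢
      exact ⟨hD.1.mul_left P, hT⟩
    rw [← Finset.sum_sdiff hsub, ih hT0, map_mul]
    obtain ⟨c, hc, hPc⟩ := (FiniteMultiplicity.of_prime_left hP hT0).exists_eq_pow_mul_and_not_dvd
    set v := multiplicity P T with hv
    rw [Finset.sum_eq_single (P ^ (v + 1))]
    · rw [vM_pow hP (Nat.succ_pos _)]
      push_cast
      rw [Real.log_mul]
      · rw [ne_eq, Nat.cast_eq_zero, Ideal.absNorm_eq_zero_iff]; exact hP.ne_zero
      · rw [ne_eq, Nat.cast_eq_zero, Ideal.absNorm_eq_zero_iff]; exact hT0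
    · intro D hD hne
      apply vM_eq_zero
      rintro ⟨Q, k, hQ, hk, rfl⟩
      rw [Finset.mem_sdiff, mem_dvs, mem_dvs] at hD
      obtain ⟨⟨h1, -⟩, h2⟩ := hD
      have h2' : ¬ Q ^ k ∣ T := fun h => h2 ⟨h, hT0⟩
      have hQP : Q = P := by
        by_contra hqp
        apply h2'
        apply hQ.pow_dvd_of_dvd_mul_left k _ h1
        intro hd
        exact hqp (associated_iff_eq.mp (hQ.associated_of_dvd hP hd))
      subst hQP
      apply hne
      congr 1
      apply le_antisymm
      · rw [hc, ← mul_assoc, ← pow_succ'] at h1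
        exact (pow_dvd_pow_iff hQ.ne_zero hQ.not_isUnit).mp (hQ.pow_dvd_of_dvd_mul_right k hPc h1)
      · by_contra hlt
        apply h2'
        rw [hc]
        exact (pow_dvd_pow Q (by omega)).mul_right c
    · intro h
      exfalso
      apply h
      rw [Finset.mem_sdiff, mem_dvs, mem_dvs]
      refine ⟨⟨?_, hT⟩, ?_⟩
      · rw [hc, pow_succ']
        exact mul_dvd_mul_left P (dvd_mul_right _ _)
      · rintro ⟨h, -⟩
        rw [hc, pow_succ] at h
        exact hPc ((mul_dvd_mul_iff_left (pow_ne_zero _ hP.ne_zero)).mp h)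

/-- Coefficients of the class L-function attached to a function on the class group -/
noncomputable def cA (g : ClassGroup (𝓞 K) → ℂ) (n : ℕ) : ℂ := ∑ I ∈ fib K n, g (cls I)

/-- von Mangoldt coefficients -/
noncomputable def cM (g : ClassGroup (𝓞 K) → ℂ) (n : ℕ) : ℂ := ∑ I ∈ fib K n, g (cls I) * vM I

theorem cA_conv (g : ClassGroup (𝓞 K) → ℂ) (hg : ∀ a b, g (a * b) = g a * g b) :
    LSeries.convolution (cA g) (cM g) = LSeries.logMul (cA g) := by
  classical
  rw [LSeries.convolution_def]
  ext n
  unfold LSeries.logMul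
  rcases Nat.eq_zero_or_pos n with rfl | hn
  · simp [cA, fib_zero]
  have hR : Complex.log n * cA g n = ∑ T ∈ fib K n, ∑ D ∈ dvs T, g (cls T) * vM D := by
    unfold cA
    rw [Finset.mul_sum]
    refine Finset.sum_congr rfl fun T hT => ?_
    obtain ⟨h0, h1⟩ := mem_fib.mp hT
    rw [← Finset.mul_sum, ← Complex.ofReal_sum, sum_vM T h0, h1, mul_comm, Complex.natCast_log]
  have hL : ∀ p : ℕ × ℕ, cA g p.1 * cM g p.2 =
      ∑ q ∈ fib K p.1 ×ˢ fib K p.2, g (cls q.1) * (g (cls q.2) * vM q.2) := by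
    intro p
    unfold cA cM
    rw [Finset.sum_mul_sum, Finset.sum_product]
  simp_rw [hL]
  refine Eq.trans ?_ hR.symm
  rw [Finset.sum_sigma', Finset.sum_sigma']
  refine Finset.sum_nbij (fun x => ⟨x.2.1 * x.2.2, x.2.2⟩) ?_ ?_ ?_ ?_
  · rintro ⟨p, I, D⟩ h
    simp only [Finset.mem_sigma, Nat.mem_divisorsAntidiagonal, Finset.mem_product, mem_fib,
      mem_dvs] at h ⊢
    obtain ⟨⟨h1, h2⟩, ⟨h3, h4⟩, h5, h6⟩ := h
    refine ⟨⟨mul_ne_zero h3 h5, ?_⟩, dvd_mul_left _ _, mul_ne_zero h3 h5⟩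
    rw [map_mul, h4, h6, h1]
  · rintro ⟨⟨p1, p2⟩, I, D⟩ h ⟨⟨q1, q2⟩, I', D'⟩ h' he
    simp only [Finset.mem_sigma, Nat.mem_divisorsAntidiagonal, Finset.mem_product, mem_fib,
      Finset.coe_sigma, Set.mem_sigma_iff, Finset.mem_coe] at h h'
    obtain ⟨⟨h1, h2⟩, ⟨h3, h4⟩, h5, h6⟩ := h
    obtain ⟨⟨h1', h2'⟩, ⟨h3', h4'⟩, h5', h6'⟩ := h'
    simp only [Sigma.mk.injEq, heq_eq_eq] at he
    obtain ⟨e1, rfl⟩ := he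
    have e2 := mul_right_cancel₀ h5 e1
    subst e2 h4 h6 h4' h6'
    rfl
  · rintro ⟨T, D⟩ h
    simp only [Finset.mem_sigma, Finset.coe_sigma, Set.mem_sigma_iff, Finset.mem_coe, mem_fib, mem_dvs] at h
    obtain ⟨⟨h0, h1⟩, ⟨I, hI⟩, -⟩ := h
    have hI0 : I ≠ 0 := by rintro rfl; exact h0 (by rw [hI, mul_zero])
    have hD0 : D ≠ 0 := by rintro rfl; exact h0 (by rw [hI, zero_mul])
    refine ⟨⟨(Ideal.absNorm I, Ideal.absNorm D), I, D⟩, ?_, ?_⟩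
    · simp only [Finset.mem_sigma, Nat.mem_divisorsAntidiagonal, Finset.mem_product, mem_fib,
        Finset.coe_sigma, Set.mem_sigma_iff, Finset.mem_coe]
      refine ⟨⟨?_, hn.ne'⟩, ⟨hI0, trivial⟩, hD0, trivial⟩
      rw [← h1, hI, map_mul, mul_comm]
    · simp only [Sigma.mk.injEq, heq_eq_eq, and_true]
      rw [hI, mul_comm]
  · rintro ⟨p, I, D⟩ h
    simp only [Finset.mem_sigma, Nat.mem_divisorsAntidiagonal, Finset.mem_product, mem_fib] at h ⊢
    rw [cls_mul h.2.1.1 h.2.2.1, hg]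
    ring

end PIT

namespace PIT
open MeasureTheory Set Filter Topology NumberField
open scoped nonZeroDivisors

variable {K : Type*} [Field K] [NumberField K]

open Classical in
/-- number of ideals of norm n in class C -/
noncomputable def aC (C : ClassGroup (𝓞 K)) (n : ℕ) : ℝ := ((fib K n).filter (fun I => cls I = C)).card

theorem aC_nonneg (C : ClassGroup (𝓞 K)) (n : ℕ) : 0 ≤ aC C n := Nat.cast_nonneg _

theorem aC_zero (C : ClassGroup (𝓞 K)) : aC C 0 = 0 := by simp [aC, fib_zero]

theorem cA_eq (g : ClassGroup (𝓞 K) → ℂ) (n : ℕ) : cA g n = ∑ C, g C * aC C n := by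
  classical
  unfold cA aC
  rw [← Finset.sum_fiberwise_of_maps_to (s := fib K n) (t := Finset.univ) (g := cls) (fun _ _ => Finset.mem_univ _)]
  refine Finset.sum_congr rfl fun C _ => ?_
  rw [Finset.sum_congr rfl (g := fun _ => g C)]
  · rw [Finset.sum_const, nsmul_eq_mul, mul_comm]
    congr
  · intro I hI
    rw [(Finset.mem_filter.mp hI).2]

theorem sum_aC (C : ClassGroup (𝓞 K)) (N : ℕ) : ∑ k ∈ Finset.Icc 1 N, aC C k =
    Nat.card {I : (Ideal (𝓞 K))⁰ // (Ideal.absNorm (I : Ideal (𝓞 K)) : ℝ) ≤ (N : ℝ) ∧ ClassGroup.mk0 I = C} := by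
  classical
  unfold aC
  rw [← Nat.cast_sum, ← Finset.card_sigma]
  congr 1
  rw [← Nat.card_eq_finsetCard]
  symm
  refine Nat.card_eq_of_bijective (fun I => ⟨⟨Ideal.absNorm (I.1 : Ideal (𝓞 K)), (I.1 : Ideal (𝓞 K))⟩, ?_⟩) ⟨?_, ?_⟩
  · obtain ⟨I, h1, h2⟩ := I
    simp only [Finset.mem_sigma, Finset.mem_Icc, Finset.mem_filter, mem_fib]
    have h0 := nonZeroDivisors.ne_zero I.2
    refine ⟨⟨?_, by exact_mod_cast h1⟩, ⟨h0, trivial⟩, ?_⟩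
    · rw [Nat.one_le_iff_ne_zero, ne_eq, Ideal.absNorm_eq_zero_iff]; exact h0
    · rw [cls_eq I.2]; exact h2
  · rintro ⟨I, hI⟩ ⟨J, hJ⟩ h
    simp only [Subtype.mk.injEq, Sigma.mk.injEq, heq_eq_eq] at h
    exact Subtype.ext (Subtype.ext h.2)
  · rintro ⟨⟨n, I⟩, h⟩
    simp only [Finset.mem_sigma, Finset.mem_Icc, Finset.mem_filter, mem_fib] at h
    obtain ⟨⟨h1, h2⟩, ⟨h3, rfl⟩, h5⟩ := h
    refine ⟨⟨⟨I, mem_nonZeroDivisors_of_ne_zero h3⟩, by exact_mod_cast h2, ?_⟩, rfl⟩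
    rw [← cls_eq]; exact h5

theorem class_sum_nat (C : ClassGroup (𝓞 K)) (x : ℝ) :
    ∑' I : {I : (Ideal (𝓞 K))⁰ // ClassGroup.mk0 I = C}, max 0 (x - (Ideal.absNorm (I.1 : Ideal (𝓞 K)) : ℝ))
      = ∑' n : ℕ, aC C n * max 0 (x - n) := by
  classical
  set f : {I : (Ideal (𝓞 K))⁰ // ClassGroup.mk0 I = C} → ℝ := fun I => max 0 (x - (Ideal.absNorm (I.1 : Ideal (𝓞 K)) : ℝ))
  have hf : Summable f := by
    apply summable_of_hasFiniteSupport
    refine Set.Finite.subset (((Ideal.finite_setOfPred_absNorm_le (S := 𝓞 K) ⌊x⌋₊).preimage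
      (f := fun I : {I : (Ideal (𝓞 K))⁰ // ClassGroup.mk0 I = C} => (I.1 : Ideal (𝓞 K))) ?_)) ?_
    · intro I _ J _ h; exact Subtype.ext (Subtype.ext h)
    · intro I hI
      simp only [Set.mem_preimage, Set.mem_ofPred_eq]
      apply Nat.le_floor
      by_contra hlt
      apply hI
      apply max_eq_left
      linarith
  have h := hf.hasSum.tsum_fiberwise (fun I => Ideal.absNorm (I.1 : Ideal (𝓞 K)))
  rw [← h.tsum_eq]
  congr 1
  ext n
  rw [tsum_congr (g := fun _ => max 0 (x - n))]
  · rw [tsum_const, nsmul_eq_mul]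
    congr 1
    unfold aC
    congr 1
    rw [← Nat.card_eq_finsetCard]
    refine Nat.card_eq_of_bijective (fun I => ⟨(I.1.1 : Ideal (𝓞 K)), ?_⟩) ⟨?_, ?_⟩
    · obtain ⟨⟨I, h1⟩, h2⟩ := I
      simp only [Finset.mem_filter, mem_fib]
      refine ⟨⟨nonZeroDivisors.ne_zero I.2, h2⟩, ?_⟩
      rw [cls_eq I.2]; exact h1
    · rintro ⟨⟨I, hI⟩, hI'⟩ ⟨⟨J, hJ⟩, hJ'⟩ h
      simp only [Subtype.mk.injEq] at h
      exact Subtype.ext (Subtype.ext (Subtype.ext h))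
    · rintro ⟨I, h⟩
      simp only [Finset.mem_filter, mem_fib] at h
      obtain ⟨⟨h3, h4⟩, h5⟩ := h
      refine ⟨⟨⟨⟨I, mem_nonZeroDivisors_of_ne_zero h3⟩, ?_⟩, h4⟩, rfl⟩
      rw [← cls_eq]; exact h5
  · rintro ⟨I, hI⟩
    have : Ideal.absNorm (I.1 : Ideal (𝓞 K)) = n := hI
    simp only [f, this]

/-- The residue of each partial zeta function -/
noncomputable def kap (K : Type*) [Field K] [NumberField K] : ℝ :=
  (2 ^ InfinitePlace.nrRealPlaces K * (2 * Real.pi) ^ InfinitePlace.nrComplexPlaces K * Units.regulator K) /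
            (Units.torsionOrder K * Real.sqrt |discr K|)

theorem kap_pos : 0 < kap K := by
  refine div_pos ?_ ?_
  · exact mul_pos (by positivity) (Units.regulator_pos K)
  · exact mul_pos (Nat.cast_pos.mpr (Units.torsionOrder_pos K)) <|
      Real.sqrt_pos_of_pos <| abs_pos.mpr (Int.cast_ne_zero.mpr (discr_ne_zero K))

theorem aC_avg (C : ClassGroup (𝓞 K)) :
    Tendsto (fun n : ℕ => (∑ k ∈ Finset.Icc 1 n, aC C k) / (n : ℝ)) atTop (𝓝 (kap K)) := by
  simp_rw [sum_aC]
  exact (NumberField.Ideal.tendsto_norm_le_and_mk_eq_div_atTop K C).comp tendsto_natCast_atTop_atTop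

theorem aC_bigO (C : ClassGroup (𝓞 K)) :
    (fun n : ℕ => ∑ k ∈ Finset.Icc 1 n, aC C k) =O[atTop] fun n => (n : ℝ) ^ (1 : ℝ) := by
  simp_rw [Real.rpow_one]
  exact Asymptotics.isBigO_of_div_tendsto_nhds (by
    filter_upwards [eventually_gt_atTop 0] with n hn h
    exact absurd h (by positivity)) _ (aC_avg C)

theorem aC_summable (C : ClassGroup (𝓞 K)) {s : ℂ} (hs : 1 < s.re) :
    LSeriesSummable (fun n => (aC C n : ℂ)) s :=
  LSeriesSummable_of_sum_norm_bigO_and_nonneg (aC_bigO C) (aC_nonneg C) zero_le_one hs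

theorem aC_cont (hdeg : Module.finrank ℚ K = 2) (himag : ∀ v : InfinitePlace K, v.IsComplex)
    (C : ClassGroup (𝓞 K)) : ∃ H : ℂ → ℂ, DifferentiableOn ℂ H {s | 0 < s.re} ∧
      ∀ s : ℂ, 1 < s.re → LSeries (fun n => (aC C n : ℂ)) s = H s + kap K / (s - 1) := by
  obtain ⟨c, D, h⟩ := class_sum hdeg himag C
  simp_rw [class_sum_nat] at h
  obtain ⟨H, hH, hHe⟩ := continuation (aC C) (aC_nonneg C) (aC_zero C) (fun s hs => aC_summable C hs) c D h
  refine ⟨H, hH, fun s hs => ?_⟩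
  rw [hHe s hs]
  have h1 := LSeries_tendsto_sub_mul_nhds_one_of_tendsto_sum_div_and_nonneg (aC C) (aC_avg C) (aC_nonneg C)
  have hlim : Tendsto (fun s : ℝ => (s : ℂ)) (𝓝[>] 1) (𝓝 1) :=
    (Complex.continuous_ofReal.tendsto' 1 1 (by simp)).mono_left nhdsWithin_le_nhds
  have h2 : Tendsto (fun s : ℝ => ((s : ℂ) - 1) * LSeries (fun n => (aC C n : ℂ)) s) (𝓝[>] 1) (𝓝 (2 * c)) := by
    have hc : ContinuousAt H 1 := (hH.differentiableAt
      ((isOpen_lt continuous_const Complex.continuous_re).mem_nhds (by simp))).continuousAt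
    have h3 : Tendsto (fun s : ℝ => ((s : ℂ) - 1) * H s + 2 * c) (𝓝[>] 1) (𝓝 ((1 - 1) * H 1 + 2 * c)) :=
      ((hlim.sub_const 1).mul (hc.tendsto.comp hlim)).add_const _
    simp only [sub_self, zero_mul, zero_add] at h3
    refine h3.congr' ?_
    filter_upwards [self_mem_nhdsWithin] with s hs
    have hs' : (1 : ℝ) < s := hs
    rw [hHe s (by simpa using hs')]
    have : (s : ℂ) - 1 ≠ 0 := by
      rw [sub_ne_zero]; exact_mod_cast hs'.ne'
    field_simp
  rw [tendsto_nhds_unique h2 h1]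

end PIT

namespace PIT
open MeasureTheory Set Filter Topology NumberField
open scoped nonZeroDivisors ArithmeticFunction.vonMangoldt

variable {K : Type*} [Field K] [NumberField K]

theorem norm_span (hdeg : Module.finrank ℚ K = 2) (p : ℕ) :
    Ideal.absNorm (Ideal.span {(p : 𝓞 K)}) = p ^ 2 := by
  rw [Ideal.absNorm_span_natCast, RingOfIntegers.rank, hdeg]

theorem one_lt_norm {P : Ideal (𝓞 K)} (hP : Prime P) : 1 < Ideal.absNorm P := by
  have h0 : Ideal.absNorm P ≠ 0 := by rw [ne_eq, Ideal.absNorm_eq_zero_iff]; exact hP.ne_zero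
  have h1 : Ideal.absNorm P ≠ 1 := by
    rw [ne_eq, Ideal.absNorm_eq_one_iff, ← Ideal.one_eq_top]; exact hP.ne_one
  omega

theorem dvd_span_of_pow {P : Ideal (𝓞 K)} (hP : Prime P) {p m : ℕ} (h : Ideal.absNorm P ∣ p ^ m) :
    P ∣ Ideal.span {(p : 𝓞 K)} := by
  have hPp := Ideal.isPrime_of_prime hP
  rw [Ideal.dvd_span_singleton]
  have h1 : ((p : 𝓞 K)) ^ m ∈ P := by
    obtain ⟨c, hc⟩ := h
    rw [← Nat.cast_pow, hc, Nat.cast_mul]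
    exact P.mul_mem_right _ (Ideal.absNorm_mem P)
  exact hPp.mem_of_pow_mem m h1

theorem exists_below (hdeg : Module.finrank ℚ K = 2) {P : Ideal (𝓞 K)} (hP : Prime P) :
    ∃ p j : ℕ, p.Prime ∧ 0 < j ∧ Ideal.absNorm P = p ^ j := by
  have hPp := Ideal.isPrime_of_prime hP
  have h1 := one_lt_norm hP
  have hp : ∃ p : ℕ, p.Prime ∧ (p : 𝓞 K) ∈ P := by
    have h2 := Ideal.absNorm_mem P
    rw [← Nat.prod_primeFactorsList (n := Ideal.absNorm P) (by omega), Nat.cast_list_prod,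
      ← Multiset.prod_coe, hPp.multiset_prod_mem_iff_exists_mem] at h2
    obtain ⟨q, hq, hq'⟩ := h2
    simp only [Multiset.mem_coe, List.mem_map] at hq
    obtain ⟨p, hp, rfl⟩ := hq
    exact ⟨p, Nat.prime_of_mem_primeFactorsList hp, hq'⟩
  obtain ⟨p, hp, hpP⟩ := hp
  have h3 : P ∣ Ideal.span {(p : 𝓞 K)} := by rwa [Ideal.dvd_span_singleton]
  have h4 := map_dvd Ideal.absNorm h3
  rw [norm_span hdeg] at h4
  obtain ⟨j, hj, he⟩ := (Nat.dvd_prime_pow hp).mp h4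
  refine ⟨p, j, hp, ?_, he⟩
  rcases Nat.eq_zero_or_pos j with rfl | h
  · rw [pow_zero] at he; omega
  · exact h

theorem sum_vM_le (hdeg : Module.finrank ℚ K = 2) (n : ℕ) : ∑ I ∈ fib K n, vM I ≤ 2 * Λ n := by
  classical
  by_cases hne : ∃ I ∈ fib K n, IsPrimePow I
  swap
  · push Not at hne
    rw [Finset.sum_eq_zero (fun I hI => vM_eq_zero (hne I hI))]
    exact mul_nonneg zero_le_two ArithmeticFunction.vonMangoldt_nonneg
  obtain ⟨p, m, hp, hm, hn⟩ : ∃ p m : ℕ, p.Prime ∧ 0 < m ∧ n = p ^ m := by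
    obtain ⟨I, hI, P, k, hP, hk, rfl⟩ := hne
    obtain ⟨p, j, hp, hj, he⟩ := exists_below hdeg hP
    refine ⟨p, j * k, hp, by positivity, ?_⟩
    rw [← (mem_fib.mp hI).2, map_pow, he, pow_mul]
  have hL : Λ n = Real.log p := by
    rw [hn, ArithmeticFunction.vonMangoldt_apply_pow hm.ne', ArithmeticFunction.vonMangoldt_apply_prime hp]
  set S := (fib K n).filter (fun I => IsPrimePow I) with hS
  have e1 : ∑ I ∈ fib K n, vM I = ∑ I ∈ S, vM I := by
    rw [hS, Finset.sum_filter]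
    refine Finset.sum_congr rfl fun I hI => ?_
    split_ifs with h
    · rfl
    · exact vM_eq_zero h
  have hr : ∀ I : Ideal (𝓞 K), ∃ P : Ideal (𝓞 K), I ∈ S → Prime P ∧ ∃ k, 0 < k ∧ P ^ k = I := by
    intro I
    by_cases h : I ∈ S
    · obtain ⟨P, k, hP, hk, e⟩ := (Finset.mem_filter.mp h).2
      exact ⟨P, fun _ => ⟨hP, k, hk, e⟩⟩
    · exact ⟨1, fun h' => absurd h' h⟩
  choose r hr using hr
  have hN : ∀ I ∈ S, Ideal.absNorm I = n := fun I hI => (mem_fib.mp (Finset.mem_filter.mp hI).1).2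
  have e2 : ∑ I ∈ S, vM I = ∑ P ∈ S.image r, Real.log (Ideal.absNorm P) := by
    rw [Finset.sum_image]
    · refine Finset.sum_congr rfl fun I hI => ?_
      obtain ⟨hP, k, hk, e⟩ := hr I hI
      conv_lhs => rw [← e]
      exact vM_pow hP hk
    · intro I hI J hJ hIJ
      obtain ⟨hP, k, hk, e⟩ := hr I hI
      obtain ⟨hQ, l, hl, e'⟩ := hr J hJ
      rw [← hIJ] at e'
      have h1 := hN I hI
      have h2 := hN J hJ
      rw [← e, map_pow] at h1
      rw [← e', map_pow, ← h1] at h2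
      have := Nat.pow_right_injective (one_lt_norm hP) h2
      rw [← e, ← e', this]
  have hprime : ∀ P ∈ S.image r, Prime P := by
    intro P hP
    obtain ⟨I, hI, rfl⟩ := Finset.mem_image.mp hP
    exact (hr I hI).1
  have hdvd : ∏ P ∈ S.image r, P ∣ Ideal.span {(p : 𝓞 K)} := by
    apply Finset.prod_primes_dvd _ hprime
    intro P hP
    obtain ⟨I, hI, rfl⟩ := Finset.mem_image.mp hP
    obtain ⟨hP, k, hk, e⟩ := hr I hI
    apply dvd_span_of_pow hP (m := m)
    have hh : Ideal.absNorm I = Ideal.absNorm (r I) ^ k := by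
      conv_lhs => rw [← e]
      rw [map_pow]
    rw [← hn, ← hN I hI, hh]
    exact dvd_pow_self _ hk.ne'
  rw [e1, e2, hL, ← Real.log_prod]
  · rw [← Nat.cast_prod, ← map_prod]
    have h1 := map_dvd Ideal.absNorm hdvd
    rw [norm_span hdeg] at h1
    have h2 := Nat.le_of_dvd (pow_pos hp.pos 2) h1
    have h3 : (2 : ℝ) * Real.log p = Real.log ((p ^ 2 : ℕ) : ℝ) := by
      push_cast; rw [Real.log_pow]; norm_num
    rw [h3]
    apply Real.log_le_log
    · rw [Nat.cast_pos]
      apply Nat.pos_of_ne_zero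
      intro h0; rw [h0] at h1
      have := zero_dvd_iff.mp h1
      exact (pow_pos hp.pos 2).ne' this
    · exact_mod_cast h2
  · intro P hP
    have := one_lt_norm (hprime P hP)
    positivity

end PIT

namespace PIT
open MeasureTheory Set Filter Topology NumberField
open scoped nonZeroDivisors ArithmeticFunction.vonMangoldt

variable {K : Type*} [Field K] [NumberField K]

theorem cM_norm_le (hdeg : Module.finrank ℚ K = 2) (g : ClassGroup (𝓞 K) → ℂ) (hg : ∀ C, ‖g C‖ ≤ 1)
    (n : ℕ) : ‖cM g n‖ ≤ 2 * Λ n := by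
  refine le_trans ?_ (sum_vM_le hdeg n)
  unfold cM
  refine (norm_sum_le _ _).trans (Finset.sum_le_sum fun I _ => ?_)
  rw [norm_mul, Complex.norm_real, Real.norm_of_nonneg (vM_nonneg I)]
  exact mul_le_of_le_one_left (vM_nonneg I) (hg _)

theorem cM_summable (hdeg : Module.finrank ℚ K = 2) (g : ClassGroup (𝓞 K) → ℂ) (hg : ∀ C, ‖g C‖ ≤ 1)
    {s : ℂ} (hs : 1 < s.re) : LSeriesSummable (cM g) s := by
  have h := (ArithmeticFunction.LSeriesSummable_vonMangoldt hs).smul (2 : ℂ)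
  refine Summable.of_norm_bounded h.norm fun n => ?_
  apply LSeries.norm_term_le
  have := cM_norm_le hdeg g hg n
  simpa [abs_of_nonneg (ArithmeticFunction.vonMangoldt_nonneg (n := n))] using this

theorem cA_fun (g : ClassGroup (𝓞 K) → ℂ) : cA g = ∑ C, g C • (fun n => (aC C n : ℂ)) := by
  ext n
  rw [cA_eq, Finset.sum_apply]
  rfl

theorem cA_summable (g : ClassGroup (𝓞 K) → ℂ) {s : ℂ} (hs : 1 < s.re) : LSeriesSummable (cA g) s := by
  rw [cA_fun]
  exact LSeriesSummable.sum fun C _ => (aC_summable C hs).smul _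

theorem LS_cA (g : ClassGroup (𝓞 K) → ℂ) {s : ℂ} (hs : 1 < s.re) :
    LSeries (cA g) s = ∑ C, g C * LSeries (fun n => (aC C n : ℂ)) s := by
  rw [cA_fun, LSeries_sum fun C _ => (aC_summable C hs).smul _]
  refine Finset.sum_congr rfl fun C _ => ?_
  rw [LSeries_smul]

theorem absc_le {f : ℕ → ℂ} (h : ∀ s : ℂ, 1 < s.re → LSeriesSummable f s) :
    LSeries.abscissaOfAbsConv f ≤ 1 := by
  have := LSeries.abscissaOfAbsConv_le_of_forall_lt_LSeriesSummable (f := f) (x := 1)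
    fun y hy => h y (by simpa using hy)
  exact_mod_cast this

theorem absc_lt {f : ℕ → ℂ} (h : ∀ s : ℂ, 1 < s.re → LSeriesSummable f s) {s : ℂ} (hs : 1 < s.re) :
    LSeries.abscissaOfAbsConv f < s.re :=
  (absc_le h).trans_lt (by exact_mod_cast hs)

theorem cA_one (g : ClassGroup (𝓞 K) → ℂ) (hg1 : g 1 = 1) : cA g 1 = 1 := by
  rw [cA, fib_one, Finset.sum_singleton, cls_one, hg1]

theorem cA_deriv (hdeg : Module.finrank ℚ K = 2) (g : ClassGroup (𝓞 K) → ℂ) (hg : ∀ C, ‖g C‖ ≤ 1)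
    (hgm : ∀ a b, g (a * b) = g a * g b) {s : ℂ} (hs : 1 < s.re) :
    deriv (LSeries (cA g)) s = -(LSeries (cM g) s * LSeries (cA g) s) := by
  rw [LSeries_deriv (absc_lt (fun s hs => cA_summable g hs) hs), ← cA_conv g hgm,
    LSeries_convolution' (cA_summable g hs) (cM_summable hdeg g hg hs), mul_comm]

theorem cA_cont (hdeg : Module.finrank ℚ K = 2) (himag : ∀ v : InfinitePlace K, v.IsComplex)
    (g : ClassGroup (𝓞 K) → ℂ) : ∃ H : ℂ → ℂ, DifferentiableOn ℂ H {s | 0 < s.re} ∧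
      ∀ s : ℂ, 1 < s.re → LSeries (cA g) s = H s + (∑ C, g C) * kap K / (s - 1) := by
  choose H hH hHe using aC_cont (K := K) hdeg himag
  refine ⟨fun s => ∑ C, g C * H C s, ?_, fun s hs => ?_⟩
  · exact DifferentiableOn.fun_sum fun C _ => (hH C).const_mul _
  · rw [LS_cA g hs, Finset.sum_mul, Finset.sum_div, ← Finset.sum_add_distrib]
    refine Finset.sum_congr rfl fun C _ => ?_
    rw [hHe C s hs]
    ring

/-- order lemma -/
theorem order_lim {f : ℂ → ℂ} {s : ℂ} (hf : AnalyticAt ℂ f s) (hn : ¬ ∀ᶠ z in 𝓝 s, f z = 0) :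
    ∃ m : ℕ, (m = 0 ↔ f s ≠ 0) ∧ (∀ᶠ z in 𝓝[≠] s, f z ≠ 0) ∧
      Tendsto (fun z => (z - s) * (deriv f z / f z)) (𝓝[≠] s) (𝓝 m) := by
  have h2 := (hf.exists_eventuallyEq_pow_smul_nonzero_iff).mpr hn
  obtain ⟨m, g, hg, hg0, he⟩ := h2
  have hgne : ∀ᶠ z in 𝓝 s, g z ≠ 0 := hg.continuousAt.eventually_ne hg0
  refine ⟨m, ?_, ?_, ?_⟩
  · have := he.self_of_nhds
    rw [this]
    simp only [sub_self, smul_eq_mul]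
    rcases Nat.eq_zero_or_pos m with rfl | hm
    · simpa using hg0
    · simp [hm.ne']
  · filter_upwards [he.filter_mono nhdsWithin_le_nhds, hgne.filter_mono nhdsWithin_le_nhds,
      self_mem_nhdsWithin] with z h1 h2 h3
    rw [h1]
    exact smul_ne_zero (pow_ne_zero _ (sub_ne_zero.mpr h3)) h2
  · have hd : ∀ᶠ z in 𝓝[≠] s, (z - s) * (deriv f z / f z) = m + (z - s) * (deriv g z / g z) := by
      filter_upwards [he.eventually_nhds.filter_mono nhdsWithin_le_nhds,
        hg.eventually_analyticAt.filter_mono nhdsWithin_le_nhds,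
        hgne.filter_mono nhdsWithin_le_nhds, self_mem_nhdsWithin] with z h1 h2 h3 h4
      have h4' : z - s ≠ 0 := sub_ne_zero.mpr h4
      have hd : HasDerivAt (fun z => (z - s) ^ m • g z)
          ((m * (z - s) ^ (m - 1) * 1) * g z + (z - s) ^ m * deriv g z) z :=
        (((hasDerivAt_id z).sub_const s).pow m).mul h2.differentiableAt.hasDerivAt
      rw [Filter.EventuallyEq.deriv_eq h1, hd.deriv, h1.self_of_nhds, smul_eq_mul]
      rcases Nat.eq_zero_or_pos m with rfl | hm
      · simp
      · obtain ⟨k, rfl⟩ := Nat.exists_eq_succ_of_ne_zero hm.ne'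
        simp only [Nat.succ_eq_add_one, Nat.add_sub_cancel]
        field_simp
        ring
    refine Tendsto.congr' (EventuallyEq.symm hd) ?_
    have hc : ContinuousAt (fun z => (m : ℂ) + (z - s) * (deriv g z / g z)) s := by
      have := hg.deriv.continuousAt
      have := hg.continuousAt
      fun_prop (disch := assumption)
    have := hc.tendsto
    simp only [sub_self, zero_mul, add_zero] at this
    exact this.mono_left nhdsWithin_le_nhds

end PIT

namespace PIT
open MeasureTheory Set Filter Topology NumberField
open scoped nonZeroDivisors ArithmeticFunction.vonMangoldt

variable {K : Type*} [Field K] [NumberField K]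

theorem open_re (a : ℝ) : IsOpen {s : ℂ | a < s.re} := isOpen_lt continuous_const Complex.continuous_re

theorem convex_re (a : ℝ) : Convex ℝ {s : ℂ | a < s.re} := convex_halfSpace_re_gt a

theorem LS_ne_loc (g : ClassGroup (𝓞 K) → ℂ) (hg1 : g 1 = 1) {s : ℂ} (hs : 1 < s.re) :
    ¬ ∀ᶠ z in 𝓝 s, LSeries (cA g) z = 0 := by
  intro h
  have hd : DifferentiableOn ℂ (LSeries (cA g)) {s | 1 < s.re} := fun z hz =>
    (LSeries_hasDerivAt (absc_lt (fun s hs => cA_summable g hs) hz)).differentiableAt.differentiableWithinAt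
  have han := hd.analyticOnNhd (open_re 1)
  have h0 := han.eqOn_zero_of_preconnected_of_eventuallyEq_zero (convex_re 1).isPreconnected hs h
  have h1 := LSeries.tendsto_atTop (f := cA g)
    ((absc_le (fun s hs => cA_summable g hs)).trans_lt (by exact_mod_cast EReal.coe_lt_top 1))
  rw [cA_one g hg1] at h1
  have h2 : Tendsto (fun x : ℝ => LSeries (cA g) x) atTop (𝓝 0) := by
    refine tendsto_const_nhds.congr' ?_
    filter_upwards [eventually_gt_atTop 1] with x hx
    exact (h0 (by simpa using hx)).symm
  exact one_ne_zero (tendsto_nhds_unique h1 h2)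

theorem LS_analytic (g : ClassGroup (𝓞 K) → ℂ) {s : ℂ} (hs : 1 < s.re) : AnalyticAt ℂ (LSeries (cA g)) s := by
  have hd : DifferentiableOn ℂ (LSeries (cA g)) {s | 1 < s.re} := fun z hz =>
    (LSeries_hasDerivAt (absc_lt (fun s hs => cA_summable g hs) hz)).differentiableAt.differentiableWithinAt
  exact hd.analyticAt ((open_re 1).mem_nhds hs)

theorem LS_ne (hdeg : Module.finrank ℚ K = 2) (g : ClassGroup (𝓞 K) → ℂ) (hg : ∀ C, ‖g C‖ ≤ 1)
    (hgm : ∀ a b, g (a * b) = g a * g b) (hg1 : g 1 = 1) {s : ℂ} (hs : 1 < s.re) :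
    LSeries (cA g) s ≠ 0 := by
  obtain ⟨m, hm, hne, hlim⟩ := order_lim (LS_analytic g hs) (LS_ne_loc g hg1 hs)
  rw [← hm]
  have hM : ContinuousAt (LSeries (cM g)) s :=
    (LSeries_hasDerivAt (absc_lt (fun s hs => cM_summable hdeg g hg hs) hs)).continuousAt
  have h2 : Tendsto (fun z => (z - s) * (-LSeries (cM g) z)) (𝓝[≠] s) (𝓝 ((s - s) * (-LSeries (cM g) s))) := by
    have : ContinuousAt (fun z => (z - s) * (-LSeries (cM g) z)) s := by fun_prop
    exact this.tendsto.mono_left nhdsWithin_le_nhds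
  have h3 : Tendsto (fun z => (z - s) * (-LSeries (cM g) z)) (𝓝[≠] s) (𝓝 m) := by
    refine hlim.congr' ?_
    filter_upwards [hne, nhdsWithin_le_nhds ((open_re 1).mem_nhds hs)] with z h1 h2
    rw [cA_deriv hdeg g hg hgm h2]
    field_simp
  have := tendsto_nhds_unique h2 h3
  simp only [sub_self, zero_mul] at this
  exact_mod_cast this.symm

theorem ZL_deriv (hdeg : Module.finrank ℚ K = 2) (g : ClassGroup (𝓞 K) → ℂ) (hg : ∀ C, ‖g C‖ ≤ 1)
    (hgm : ∀ a b, g (a * b) = g a * g b) (hg1 : g 1 = 1) (e : ℕ) (Z : ℂ → ℂ)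
    (hZ : ∀ s : ℂ, 1 < s.re → Z s = (s - 1) ^ e * LSeries (cA g) s) {s : ℂ} (hs : 1 < s.re) :
    Z s ≠ 0 ∧ deriv Z s / Z s = e / (s - 1) - LSeries (cM g) s := by
  have hL := LS_ne hdeg g hg hgm hg1 hs
  have h1 : s - 1 ≠ 0 := by
    rw [sub_ne_zero]; rintro rfl; simp at hs
  refine ⟨by rw [hZ s hs]; exact mul_ne_zero (pow_ne_zero _ h1) hL, ?_⟩
  have he : Z =ᶠ[𝓝 s] fun s => (s - 1) ^ e * LSeries (cA g) s := by
    filter_upwards [(open_re 1).mem_nhds hs] with z hz using hZ z hz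
  have hd : HasDerivAt (fun z => (z - 1) ^ e * LSeries (cA g) z)
      ((e * (s - 1) ^ (e - 1) * 1) * LSeries (cA g) s + (s - 1) ^ e * deriv (LSeries (cA g)) s) s :=
    (((hasDerivAt_id s).sub_const 1).pow e).mul (LS_analytic g hs).differentiableAt.hasDerivAt
  rw [he.deriv_eq, hd.deriv, hZ s hs, cA_deriv hdeg g hg hgm hs]
  rcases Nat.eq_zero_or_pos e with rfl | hm
  · simp; field_simp
  · obtain ⟨k, rfl⟩ := Nat.exists_eq_succ_of_ne_zero hm.ne'
    simp only [Nat.succ_eq_add_one, Nat.add_sub_cancel]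
    field_simp
    ring

theorem Z_lim (hdeg : Module.finrank ℚ K = 2) (g : ClassGroup (𝓞 K) → ℂ) (hg : ∀ C, ‖g C‖ ≤ 1)
    (hgm : ∀ a b, g (a * b) = g a * g b) (hg1 : g 1 = 1) (e : ℕ) (Z : ℂ → ℂ)
    (hZd : DifferentiableOn ℂ Z {s | 0 < s.re})
    (hZ : ∀ s : ℂ, 1 < s.re → Z s = (s - 1) ^ e * LSeries (cA g) s) (t : ℝ) :
    ∃ m : ℕ, (m = 0 ↔ Z (1 + t * Complex.I) ≠ 0) ∧
      Tendsto (fun σ : ℝ => ((σ : ℂ) - 1) * LSeries (cM g) (σ + t * Complex.I)) (𝓝[>] 1)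
        (𝓝 ((if t = 0 then (e : ℂ) else 0) - m)) := by
  set s0 : ℂ := 1 + t * Complex.I with hs0
  have hre : 0 < s0.re := by simp [hs0]
  have han : AnalyticOnNhd ℂ Z {s | 0 < s.re} := hZd.analyticOnNhd (open_re 0)
  have hnl : ¬ ∀ᶠ z in 𝓝 s0, Z z = 0 := by
    intro h
    have h0 := han.eqOn_zero_of_preconnected_of_eventuallyEq_zero (convex_re 0).isPreconnected hre h
    have h1 := (ZL_deriv hdeg g hg hgm hg1 e Z hZ (s := 2) (by norm_num)).1
    exact h1 (h0 (by simp))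
  obtain ⟨m, hm, -, hlim⟩ := order_lim (han s0 hre) hnl
  refine ⟨m, hm, ?_⟩
  have hpath : Tendsto (fun σ : ℝ => (σ : ℂ) + t * Complex.I) (𝓝[>] 1) (𝓝[≠] s0) := by
    apply tendsto_nhdsWithin_of_tendsto_nhds_of_eventually_within
    · have : Continuous (fun σ : ℝ => (σ : ℂ) + t * Complex.I) := by fun_prop
      exact (this.tendsto' 1 s0 (by simp [hs0])).mono_left nhdsWithin_le_nhds
    · filter_upwards [self_mem_nhdsWithin] with σ hσ
      have hσ' : (1 : ℝ) < σ := hσ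
      intro h
      have := congrArg Complex.re h
      simp [hs0] at this
      exact hσ'.ne' this
  have h1 := hlim.comp hpath
  have h2 : Tendsto (fun σ : ℝ => ((σ : ℂ) - 1) * ((e : ℂ) / (σ + t * Complex.I - 1))) (𝓝[>] 1)
      (𝓝 (if t = 0 then (e : ℂ) else 0)) := by
    split_ifs with ht
    · refine tendsto_const_nhds.congr' ?_
      filter_upwards [self_mem_nhdsWithin] with σ hσ
      have hσ' : (1 : ℝ) < σ := hσ
      have : (σ : ℂ) - 1 ≠ 0 := by rw [sub_ne_zero]; exact_mod_cast hσ'.ne'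
      simp only [ht, Complex.ofReal_zero, zero_mul, add_zero]
      field_simp
    · have hc : ContinuousAt (fun σ : ℝ => ((σ : ℂ) - 1) * ((e : ℂ) / (σ + t * Complex.I - 1))) 1 := by
        have hne : ((1 : ℝ) : ℂ) + t * Complex.I - 1 ≠ 0 := by simp [ht]
        fun_prop (disch := assumption)
      have := hc.tendsto
      simp only [Complex.ofReal_one, sub_self, zero_mul] at this
      exact this.mono_left nhdsWithin_le_nhds
  refine (h2.sub h1).congr' ?_
  filter_upwards [self_mem_nhdsWithin] with σ hσ
  have hσ' : (1 : ℝ) < σ := hσ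
  have hr : 1 < ((σ : ℂ) + t * Complex.I).re := by simpa using hσ'
  simp only [Function.comp_apply]
  rw [(ZL_deriv hdeg g hg hgm hg1 e Z hZ hr).2, hs0]
  ring

/-- 3-4-1 inequality -/
theorem ineq341 (hdeg : Module.finrank ℚ K = 2) (g : ClassGroup (𝓞 K) → ℂ) (hg : ∀ C, ‖g C‖ = 1)
    (t σ : ℝ) (hσ : 1 < σ) :
    0 ≤ (3 * LSeries (cM (fun _ : ClassGroup (𝓞 K) => (1 : ℂ))) σ + 4 * LSeries (cM g) (σ + t * Complex.I)
      + LSeries (cM (fun C => g C ^ 2)) (σ + (2 * t : ℝ) * Complex.I)).re := by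
  have s1 := cM_summable hdeg (fun _ : ClassGroup (𝓞 K) => (1 : ℂ)) (by simp) (s := σ) (by simpa using hσ)
  have s2 := cM_summable hdeg g (fun C => (hg C).le) (s := σ + t * Complex.I) (by simpa using hσ)
  have s3 := cM_summable hdeg (fun C => g C ^ 2) (fun C => by rw [norm_pow, hg, one_pow])
    (s := σ + (2 * t : ℝ) * Complex.I) (by simpa using hσ)
  have hs := ((s1.hasSum.mul_left 3).add (s2.hasSum.mul_left 4)).add s3.hasSum
  have hs' := Complex.hasSum_re hs
  refine hs'.nonneg fun n => ?_
  rcases Nat.eq_zero_or_pos n with rfl | hn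
  · simp
  simp only [LSeries.term_of_ne_zero hn.ne']
  have hn0 : (n : ℂ) ≠ 0 := by exact_mod_cast hn.ne'
  set w : ℂ := (n : ℂ) ^ (-(t * Complex.I)) with hw
  have hwn : ‖w‖ = 1 := by
    rw [hw, Complex.norm_natCast_cpow_of_pos hn]
    simp
  have e1 : ((n : ℂ) ^ ((σ : ℂ) + t * Complex.I))⁻¹ = ((n : ℂ) ^ (σ : ℂ))⁻¹ * w := by
    rw [Complex.cpow_add _ _ hn0, mul_inv, hw, Complex.cpow_neg (x := (n : ℂ)) (y := t * Complex.I)]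
  have e2 : ((n : ℂ) ^ ((σ : ℂ) + (2 * t : ℝ) * Complex.I))⁻¹ = ((n : ℂ) ^ (σ : ℂ))⁻¹ * w ^ 2 := by
    have : (σ : ℂ) + (2 * t : ℝ) * Complex.I = σ + t * Complex.I + t * Complex.I := by push_cast; ring
    rw [this, Complex.cpow_add _ _ hn0, Complex.cpow_add _ _ hn0, mul_inv, mul_inv, hw,
      Complex.cpow_neg (x := (n : ℂ)) (y := t * Complex.I)]
    ring
  have e0 : ((n : ℂ) ^ (σ : ℂ))⁻¹ = (((n : ℝ) ^ σ)⁻¹ : ℝ) := by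
    push_cast
    rw [Complex.ofReal_cpow (by positivity)]
    simp
  simp only [div_eq_mul_inv, e1, e2, e0]
  unfold cM
  have hfin : 3 * ((∑ I ∈ fib K n, (1 : ℂ) * vM I) * (((n : ℝ) ^ σ)⁻¹ : ℝ)) +
      4 * ((∑ I ∈ fib K n, g (cls I) * vM I) * ((((n : ℝ) ^ σ)⁻¹ : ℝ) * w)) +
      (∑ I ∈ fib K n, g (cls I) ^ 2 * vM I) * ((((n : ℝ) ^ σ)⁻¹ : ℝ) * w ^ 2) =
      ((((n : ℝ) ^ σ)⁻¹ : ℝ) : ℂ) * ∑ I ∈ fib K n, (vM I : ℂ) * (3 + 4 * (g (cls I) * w) + (g (cls I) * w) ^ 2) := by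
    simp only [Finset.mul_sum, Finset.sum_mul, ← Finset.sum_add_distrib]
    refine Finset.sum_congr rfl fun I _ => ?_
    ring
  rw [hfin, Complex.re_ofReal_mul, Complex.re_sum]
  refine mul_nonneg (by positivity) (Finset.sum_nonneg fun I _ => ?_)
  rw [Complex.re_ofReal_mul]
  refine mul_nonneg (vM_nonneg I) ?_
  set v := g (cls I) * w
  have hv : ‖v‖ = 1 := by rw [norm_mul, hg, hwn, one_mul]
  have hv2 : v.re ^ 2 + v.im ^ 2 = 1 := by
    have := Complex.sq_norm v
    rw [hv, Complex.normSq_apply] at this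
    linarith
  have : (3 + 4 * v + v ^ 2).re = 3 + 4 * v.re + (v.re ^ 2 - v.im ^ 2) := by
    simp [pow_two]
  rw [this]
  nlinarith [sq_nonneg (v.re + 1)]

end PIT

namespace PIT
open MeasureTheory Set Filter Topology NumberField
open scoped nonZeroDivisors ArithmeticFunction.vonMangoldt ComplexOrder

variable {K : Type*} [Field K] [NumberField K]

theorem cpow_half_sq (n : ℕ) : ((n ^ 2 : ℕ) : ℂ) ^ (-(1 / 2) : ℂ) = ((1 / (n : ℝ) : ℝ) : ℂ) := by
  have h1 : ((n ^ 2 : ℕ) : ℂ) = (((n : ℝ) ^ 2 : ℝ) : ℂ) := by push_cast; rfl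
  have h2 : (-(1 / 2) : ℂ) = ((-(1 / 2) : ℝ) : ℂ) := by push_cast; rfl
  rw [h1, h2, ← Complex.ofReal_cpow (by positivity), Real.rpow_neg (by positivity),
    ← Real.sqrt_eq_rpow, Real.sqrt_sq (by positivity), one_div]

theorem landau (c : ℕ → ℂ) (h0 : 0 ≤ c) (hs : ∀ s : ℂ, 1 < s.re → LSeriesSummable c s)
    (h1 : ∀ p : ℕ, p.Prime → 1 ≤ c (p ^ 2)) (Φ : ℂ → ℂ) (hΦ : DifferentiableOn ℂ Φ {s | 0 < s.re})
    (heq : ∀ s : ℂ, 1 < s.re → LSeries c s = Φ s) : False := by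
  classical
  apply Nat.Primes.not_summable_one_div
  refine summable_of_sum_le (c := (Φ (1/2)).re) (fun p => by positivity) fun S => ?_
  have hp0 : ∀ p : Nat.Primes, ((p : ℕ) : ℂ) ≠ 0 := fun p => by exact_mod_cast p.2.ne_zero
  set S' : Finset ℕ := S.image (fun p : Nat.Primes => (p : ℕ) ^ 2) with hS'
  have hS0 : ∀ n ∈ S', n ≠ 0 := by
    intro n hn
    obtain ⟨p, -, rfl⟩ := Finset.mem_image.mp hn
    exact pow_ne_zero _ p.2.ne_zero
  set d : ℕ → ℂ := fun n => if n ∈ S' then 1 else 0 with hd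
  have hterm : ∀ s : ℂ, ∀ n ∉ S', LSeries.term d s n = 0 := by
    intro s n hn
    rw [LSeries.term_def]
    simp [hd, hn]
  have hdS : ∀ s : ℂ, LSeriesSummable d s := fun s => summable_of_ne_finset_zero (s := S') (hterm s)
  have hdL : ∀ s : ℂ, LSeries d s = ∑ n ∈ S', (n : ℂ) ^ (-s) := by
    intro s
    rw [LSeries, tsum_eq_sum (s := S') (hterm s)]
    refine Finset.sum_congr rfl fun n hn => ?_
    rw [LSeries.term_of_ne_zero (hS0 n hn), Complex.cpow_neg]
    simp [hd, hn]
  set b : ℕ → ℂ := c - d with hb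
  have hb0 : 0 ≤ b := by
    intro n
    simp only [hb, Pi.zero_apply, Pi.sub_apply, sub_nonneg, hd]
    split_ifs with h
    · obtain ⟨p, -, rfl⟩ := Finset.mem_image.mp h
      exact h1 p p.2
    · exact h0 n
  have hbs : ∀ s : ℂ, 1 < s.re → LSeriesSummable b s := fun s h => (hs s h).sub (hdS s)
  set D : ℂ → ℂ := fun s => ∑ n ∈ S', (n : ℂ) ^ (-s) with hD
  have hDd : Differentiable ℂ D := by
    apply Differentiable.fun_sum
    intro n hn s
    have : (n : ℂ) ≠ 0 := by exact_mod_cast hS0 n hn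
    exact (differentiableAt_id.neg).const_cpow (Or.inl this)
  set f : ℂ → ℂ := fun z => Φ (-z) - D (-z) with hf
  have hfd : DifferentiableOn ℂ f (Metric.ball (-2) 2) := by
    intro z hz
    have hz' : 0 < (-z).re := by
      have h2 := Complex.abs_re_le_norm (z - (-2))
      rw [Metric.mem_ball, dist_eq_norm] at hz
      have := (abs_lt.mp (h2.trans_lt hz)).2
      simp at this ⊢
      linarith
    have hΦz : DifferentiableAt ℂ Φ (-z) := hΦ.differentiableAt ((open_re 0).mem_nhds hz')
    have := hDd (-z)
    apply DifferentiableAt.differentiableWithinAt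
    have hneg : DifferentiableAt ℂ (fun z : ℂ => -z) z := differentiableAt_id.neg
    exact (DifferentiableAt.comp (g := Φ) (f := fun z : ℂ => -z) z hΦz hneg).sub
      (DifferentiableAt.comp (g := D) (f := fun z : ℂ => -z) z this hneg)
  have hit : ∀ n, 0 ≤ iteratedDeriv n f (-2) := by
    intro n
    have h3 := LSeries.iteratedDeriv_alternating hb0 (x := 2)
      ((absc_le hbs).trans_lt (by exact_mod_cast (by norm_num : (1 : ℝ) < 2))) n
    have h4 : iteratedDeriv n f (-2) = (-1 : ℂ) ^ n • iteratedDeriv n (fun s => Φ s - D s) (-(-2)) :=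
      iteratedDeriv_comp_neg n (fun s => Φ s - D s) (-2)
    have h5 : (fun s => Φ s - D s) =ᶠ[𝓝 2] LSeries b := by
      have : (2 : ℂ) ∈ {s : ℂ | 1 < s.re} := by simp
      filter_upwards [(open_re 1).mem_nhds this] with s h
      rw [hb, LSeries_sub (hs s h) (hdS s), heq s h, hdL]
    rw [h4, neg_neg, h5.iteratedDeriv_eq, smul_eq_mul]
    simpa using h3
  have h6 := hfd.nonneg_of_iteratedDeriv_nonneg hit (z := -(1/2))
    (by rw [Complex.le_def]; norm_num) (by
      rw [Metric.mem_ball, dist_eq_norm]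
      have : (-(1/2) - -2 : ℂ) = ((3/2 : ℝ) : ℂ) := by push_cast; ring
      rw [this, Complex.norm_real]
      norm_num [abs_of_pos])
  have h7 : D (1/2) = ((∑ p ∈ S, (1 / (p : ℕ) : ℝ) : ℝ) : ℂ) := by
    simp only [hD, hS']
    rw [Finset.sum_image, Complex.ofReal_sum]
    · refine Finset.sum_congr rfl fun p _ => ?_
      exact cpow_half_sq p
    · intro p _ q _ h
      have : (p : ℕ) ^ 2 = (q : ℕ) ^ 2 := h
      exact Subtype.ext (Nat.pow_left_injective (by norm_num) this)
  simp only [hf, neg_neg, h7] at h6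
  have := (Complex.le_def.mp h6).1
  simp only [Complex.zero_re, Complex.sub_re, Complex.ofReal_re] at this
  linarith

theorem conv_log (A B M N : ℕ → ℂ) (hA : LSeries.convolution A M = LSeries.logMul A) (hB : LSeries.convolution B N = LSeries.logMul B) :
    LSeries.convolution (LSeries.convolution A B) (M + N) = LSeries.logMul (LSeries.convolution A B) := by
  have e0 : ∀ f : ArithmeticFunction ℂ, toArithmeticFunction (⇑f) = f :=
    ArithmeticFunction.toArithmeticFunction_eq_self
  have h1 : toArithmeticFunction (M + N) = toArithmeticFunction M + toArithmeticFunction N := by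
    ext n
    rw [ArithmeticFunction.add_apply]
    change (if n = 0 then 0 else (M + N) n) = (if n = 0 then 0 else M n) + (if n = 0 then 0 else N n)
    split_ifs <;> simp
  have h2 : LSeries.convolution (LSeries.convolution A B) (M + N) = LSeries.convolution (LSeries.convolution A M) B + LSeries.convolution A (LSeries.convolution B N) := by
    simp only [LSeries.convolution, e0, h1]
    ext n
    rw [Pi.add_apply, ← ArithmeticFunction.add_apply]
    congr 1
    ring
  rw [h2, hA, hB]
  ext n
  simp only [LSeries.convolution_def, Pi.add_apply, LSeries.logMul]
  rw [← Finset.sum_add_distrib, Finset.mul_sum]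
  refine Finset.sum_congr rfl fun p hp => ?_
  have h := Nat.mem_divisorsAntidiagonal.mp hp
  have hp1 : p.1 ≠ 0 := by rintro h0; rw [h0, zero_mul] at h; exact h.2 h.1.symm
  have hp2 : p.2 ≠ 0 := by rintro h0; rw [h0, mul_zero] at h; exact h.2 h.1.symm
  rw [← h.1, ← Complex.natCast_log, ← Complex.natCast_log, ← Complex.natCast_log]
  push_cast
  rw [Real.log_mul (by exact_mod_cast hp1) (by exact_mod_cast hp2)]
  push_cast
  ring

theorem conv_nonneg (c N : ℕ → ℂ) (hc0 : c 0 = 0) (hc1 : c 1 = 1) (hN : 0 ≤ N) (hN1 : N 1 = 0)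
    (h : LSeries.convolution c N = LSeries.logMul c) : 0 ≤ c := by
  intro n
  induction n using Nat.strong_induction_on with
  | _ n ih =>
    rcases Nat.lt_trichotomy n 1 with hn | rfl | hn
    · have : n = 0 := by omega
      subst this
      simp [hc0]
    · simp [hc1]
    · have h1 := congrFun h n
      rw [LSeries.convolution_def] at h1
      simp only [LSeries.logMul] at h1
      have h2 : 0 ≤ Complex.log n * c n := by
        rw [← h1]
        refine Finset.sum_nonneg fun p hp => ?_
        have hh := Nat.mem_divisorsAntidiagonal.mp hp
        by_cases h2 : p.2 = 1
        · rw [h2, hN1, mul_zero]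
        · refine mul_nonneg (ih p.1 ?_) (hN _)
          rcases Nat.eq_zero_or_pos p.1 with h3 | h3
          · omega
          have h4 : p.2 ≠ 0 := by rintro h0; rw [h0, mul_zero] at hh; exact hh.2 hh.1.symm
          rw [← hh.1]
          exact lt_mul_of_one_lt_right h3 (by omega)
      rw [← Complex.natCast_log] at h2
      have hl : 0 < Real.log n := Real.log_pos (by exact_mod_cast hn)
      have h3 : c n = ((Real.log n)⁻¹ : ℝ) * ((Real.log n : ℝ) * c n) := by
        rw [← mul_assoc, ← Complex.ofReal_mul, inv_mul_cancel₀ hl.ne', Complex.ofReal_one, one_mul]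
      rw [Pi.zero_apply, h3]
      exact mul_nonneg (Complex.zero_le_real.mpr (inv_pos.mpr hl).le) h2

theorem vM_one : vM (1 : Ideal (𝓞 K)) = 0 := by
  apply vM_eq_zero
  exact not_isPrimePow_one

theorem cM_one (g : ClassGroup (𝓞 K) → ℂ) : cM g 1 = 0 := by
  rw [cM, fib_one, Finset.sum_singleton, vM_one]
  simp

theorem exists_sq (hdeg : Module.finrank ℚ K = 2) (g : ClassGroup (𝓞 K) → ℂ)
    (hg2 : ∀ C, g C ^ 2 = 1) (hgm : ∀ a b, g (a * b) = g a * g b) (hg1 : g 1 = 1) {p : ℕ} (hp : p.Prime) :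
    ∃ J ∈ fib K (p ^ 2), g (cls J) = 1 ∧ Real.log p ≤ vM J := by
  have hp0 : (p : 𝓞 K) ≠ 0 := by exact_mod_cast hp.ne_zero
  have hs0 : Ideal.span {(p : 𝓞 K)} ≠ 0 := by
    simpa [Ideal.span_singleton_eq_bot] using hp0
  have hsu : ¬ IsUnit (Ideal.span {(p : 𝓞 K)}) := by
    intro h
    have h2 := norm_span hdeg p
    rw [Ideal.isUnit_iff.mp h, Ideal.absNorm_top] at h2
    have := Nat.pow_lt_pow_left hp.one_lt two_ne_zero
    omega
  obtain ⟨P, hPi, hPd⟩ := WfDvdMonoid.exists_irreducible_factor hsu hs0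
  have hP : Prime P := hPi.prime
  have h4 := map_dvd Ideal.absNorm hPd
  rw [norm_span hdeg] at h4
  obtain ⟨j, hj, he⟩ := (Nat.dvd_prime_pow hp).mp h4
  have h1 := one_lt_norm hP
  have hj0 : j ≠ 0 := by rintro rfl; rw [pow_zero] at he; omega
  have hl : 0 < Real.log p := Real.log_pos (by exact_mod_cast hp.one_lt)
  obtain rfl | rfl : j = 1 ∨ j = 2 := by omega
  · rw [pow_one] at he
    refine ⟨P ^ 2, mem_fib.mpr ⟨pow_ne_zero _ hP.ne_zero, by rw [map_pow, he]⟩, ?_, ?_⟩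
    · rw [pow_two, cls_mul hP.ne_zero hP.ne_zero, hgm, ← pow_two, hg2]
    · rw [vM_pow hP two_pos, he]
  · obtain ⟨E, hE⟩ := hPd
    have h5 : Ideal.absNorm E = 1 := by
      have := congrArg Ideal.absNorm hE
      rw [norm_span hdeg, map_mul, he] at this
      have h6 : 0 < p ^ 2 := pow_pos hp.pos 2
      nlinarith
    rw [Ideal.absNorm_eq_one_iff, ← Ideal.one_eq_top] at h5
    rw [h5, mul_one] at hE
    refine ⟨P, mem_fib.mpr ⟨hP.ne_zero, he⟩, ?_, ?_⟩
    · rw [cls_eq (mem_nonZeroDivisors_of_ne_zero hP.ne_zero), (ClassGroup.mk0_eq_one_iff _).mpr, hg1]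
      rw [← hE]
      exact ⟨⟨_, rfl⟩⟩
    · rw [← pow_one P, vM_pow hP one_pos, he]
      push_cast
      rw [Real.log_pow]
      push_cast
      linarith

theorem quad_ne (hdeg : Module.finrank ℚ K = 2) (g : ClassGroup (𝓞 K) → ℂ)
    (hg2 : ∀ C, g C ^ 2 = 1)
    (hgm : ∀ a b, g (a * b) = g a * g b) (Z0 Z : ℂ → ℂ)
    (hZ0d : DifferentiableOn ℂ Z0 {s | 0 < s.re})
    (hZ0 : ∀ s : ℂ, 1 < s.re → Z0 s = (s - 1) * LSeries (cA (fun _ : ClassGroup (𝓞 K) => (1 : ℂ))) s)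
    (hZd : DifferentiableOn ℂ Z {s | 0 < s.re})
    (hZ : ∀ s : ℂ, 1 < s.re → Z s = LSeries (cA g) s) : Z 1 ≠ 0 := by
  intro hz1
  have hg1 : g 1 = 1 := by
    have h := hgm 1 1
    have h2 := hg2 1
    rw [mul_one] at h
    rw [h, ← pow_two, h2]
  set u : ClassGroup (𝓞 K) → ℂ := fun _ => 1 with hu
  have hpm : ∀ C, g C = 1 ∨ g C = -1 := fun C => by simpa using hg2 C
  have hconv := conv_log _ _ _ _ (cA_conv u (by simp [hu])) (cA_conv g hgm)
  set c := LSeries.convolution (cA u) (cA g) with hc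
  set N := cM u + cM g with hN
  have hNn : ∀ n, N n = ∑ I ∈ fib K n, (1 + g (cls I)) * vM I := by
    intro n
    simp only [hN, Pi.add_apply, cM, hu]
    rw [← Finset.sum_add_distrib]
    refine Finset.sum_congr rfl fun I _ => ?_
    ring
  have hterm : ∀ I : Ideal (𝓞 K), 0 ≤ (1 + g (cls I)) * (vM I : ℂ) := by
    intro I
    refine mul_nonneg ?_ (Complex.zero_le_real.mpr (vM_nonneg I))
    rcases hpm (cls I) with h | h <;> rw [h]
    · norm_num
    · norm_num
  have hN0 : 0 ≤ N := by
    intro n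
    rw [hNn]
    exact Finset.sum_nonneg fun I _ => hterm I
  have hN1 : N 1 = 0 := by simp [hN, cM_one]
  have hc0 : c 0 = 0 := by simp [hc]
  have hc1 : c 1 = 1 := by
    rw [hc, LSeries.convolution_def]
    simp [cA_one g hg1, cA_one u rfl]
  have hcn := conv_nonneg c N hc0 hc1 hN0 hN1 hconv
  have hcs : ∀ s : ℂ, 1 < s.re → LSeriesSummable c s := fun s hs =>
    (cA_summable u hs).convolution (cA_summable g hs)
  have hcp : ∀ p : ℕ, p.Prime → 1 ≤ c (p ^ 2) := by
    intro p hp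
    obtain ⟨J, hJ, hgJ, hvJ⟩ := exists_sq hdeg g hg2 hgm hg1 hp
    have h1 : N (p ^ 2) ≤ Complex.log ((p ^ 2 : ℕ) : ℂ) * c (p ^ 2) := by
      have := congrFun hconv (p ^ 2)
      simp only [LSeries.logMul] at this
      rw [← this, LSeries.convolution_def]
      have h2 := Finset.single_le_sum (f := fun q : ℕ × ℕ => c q.1 * N q.2)
        (s := (p ^ 2).divisorsAntidiagonal) (fun q _ => mul_nonneg (hcn _) (hN0 _))
        (a := (1, p ^ 2)) (by simp [hp.ne_zero])
      simpa [hc1] using h2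
    have h2 : 2 * (Real.log p : ℂ) ≤ N (p ^ 2) := by
      rw [hNn]
      have h3 := Finset.single_le_sum (f := fun I => (1 + g (cls I)) * (vM I : ℂ)) (s := fib K (p ^ 2))
        (fun q _ => hterm q) hJ
      refine le_trans ?_ h3
      simp only [hgJ]
      have : ((2 * Real.log p : ℝ) : ℂ) ≤ ((2 * vM J : ℝ) : ℂ) := by
        rw [Complex.real_le_real]; linarith
      push_cast at this
      convert this using 2
      all_goals norm_num
    have h3 := h2.trans h1
    rw [← Complex.natCast_log] at h3
    have hl : 0 < Real.log p := Real.log_pos (by exact_mod_cast hp.one_lt)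
    have h4 : Real.log ((p ^ 2 : ℕ) : ℝ) = 2 * Real.log p := by
      push_cast; rw [Real.log_pow]; norm_num
    rw [h4] at h3
    generalize Real.log p = l at h3 hl
    have h5 : (0 : ℂ) ≤ ((2 * l)⁻¹ : ℝ) := Complex.zero_le_real.mpr (by positivity)
    have h6 := mul_le_mul_of_nonneg_left h3 h5
    have h7 : (2 * l : ℂ) ≠ 0 := by
      have : (l : ℂ) ≠ 0 := by exact_mod_cast hl.ne'
      exact mul_ne_zero two_ne_zero this
    rw [← mul_assoc (((2 * l)⁻¹ : ℝ) : ℂ) ((2 * l : ℝ) : ℂ)] at h6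
    push_cast at h6
    rw [inv_mul_cancel₀ h7, one_mul] at h6
    exact h6
  refine landau c hcn hcs hcp (fun s => Z0 s * dslope Z 1 s) ?_ ?_
  · apply hZ0d.mul
    exact (Complex.differentiableOn_dslope ((open_re 0).mem_nhds (by simp))).mpr hZd
  · intro s hs
    have hs1 : s ≠ 1 := by rintro rfl; simp at hs
    have hs2 : s - 1 ≠ 0 := sub_ne_zero.mpr hs1
    rw [hc, LSeries_convolution' (cA_summable u hs) (cA_summable g hs)]
    simp only [dslope_of_ne _ hs1, slope_def_field, hz1, hZ0 s hs, hZ s hs]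
    field_simp
    ring

end PIT

namespace PIT
open MeasureTheory Set Filter Topology NumberField
open scoped nonZeroDivisors ArithmeticFunction.vonMangoldt

set_option linter.unusedSectionVars false
variable {K : Type*} [Field K] [NumberField K]

noncomputable def ch (ψ : AddChar (Additive (ClassGroup (𝓞 K))) ℂ) (C : ClassGroup (𝓞 K)) : ℂ :=
  ψ (Additive.ofMul C)

theorem ch_mul (ψ : AddChar (Additive (ClassGroup (𝓞 K))) ℂ) (a b : ClassGroup (𝓞 K)) :
    ch ψ (a * b) = ch ψ a * ch ψ b := by
  simp [ch, AddChar.map_add_eq_mul]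

theorem ch_one (ψ : AddChar (Additive (ClassGroup (𝓞 K))) ℂ) : ch ψ 1 = 1 := by
  simp [ch]

theorem ch_norm (ψ : AddChar (Additive (ClassGroup (𝓞 K))) ℂ) (C : ClassGroup (𝓞 K)) :
    ‖ch ψ C‖ = 1 := AddChar.norm_apply ψ _

theorem ch_zero : ch (0 : AddChar (Additive (ClassGroup (𝓞 K))) ℂ) = fun _ => 1 := by
  ext C; simp [ch]

theorem ch_two (ψ : AddChar (Additive (ClassGroup (𝓞 K))) ℂ) :
    ch (ψ + ψ) = fun C => ch ψ C ^ 2 := by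
  ext C; simp [ch, pow_two]

open Classical in
theorem ch_sum (ψ : AddChar (Additive (ClassGroup (𝓞 K))) ℂ) :
    ∑ C, ch ψ C = if ψ = 0 then (Fintype.card (ClassGroup (𝓞 K)) : ℂ) else 0 := by
  have h := AddChar.sum_eq_ite ψ
  rw [← Fintype.card_congr (Additive.ofMul (α := ClassGroup (𝓞 K)))] at h
  rw [← h]
  exact Fintype.sum_equiv Additive.ofMul _ _ fun C => rfl

open Classical in
noncomputable def ee (ψ : AddChar (Additive (ClassGroup (𝓞 K))) ℂ) : ℕ := if ψ = 0 then 1 else 0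

theorem Z_exists (hdeg : Module.finrank ℚ K = 2) (himag : ∀ v : InfinitePlace K, v.IsComplex)
    (ψ : AddChar (Additive (ClassGroup (𝓞 K))) ℂ) : ∃ Z : ℂ → ℂ,
      DifferentiableOn ℂ Z {s | 0 < s.re} ∧
      (∀ s : ℂ, 1 < s.re → Z s = (s - 1) ^ ee ψ * LSeries (cA (ch ψ)) s) ∧
      (ψ = 0 → Z 1 ≠ 0) := by
  obtain ⟨H, hH, hHe⟩ := cA_cont hdeg himag (ch ψ)
  by_cases h : ψ = 0
  · refine ⟨fun s => (s - 1) * H s + Fintype.card (ClassGroup (𝓞 K)) * kap K, ?_, ?_, ?_⟩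
    · exact (((differentiable_id.sub_const 1).differentiableOn).mul hH).add_const _
    · intro s hs
      have hs1 : s - 1 ≠ 0 := by rw [sub_ne_zero]; rintro rfl; simp at hs
      rw [hHe s hs, ch_sum, if_pos h, ee, if_pos h, pow_one]
      field_simp
    · intro _
      have h1 : (Fintype.card (ClassGroup (𝓞 K)) : ℂ) ≠ 0 := by
        exact_mod_cast Fintype.card_ne_zero
      have h2 : (kap K : ℂ) ≠ 0 := by exact_mod_cast (kap_pos (K := K)).ne'
      simp [h1, h2]
  · refine ⟨H, hH, fun s hs => ?_, fun h' => absurd h' h⟩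
    rw [hHe s hs, ch_sum, if_neg h, ee, if_neg h]
    simp

theorem Z_ne (hdeg : Module.finrank ℚ K = 2) (himag : ∀ v : InfinitePlace K, v.IsComplex)
    (ψ : AddChar (Additive (ClassGroup (𝓞 K))) ℂ) (Z : ℂ → ℂ)
    (hZd : DifferentiableOn ℂ Z {s | 0 < s.re})
    (hZ : ∀ s : ℂ, 1 < s.re → Z s = (s - 1) ^ ee ψ * LSeries (cA (ch ψ)) s)
    (hZ1 : ψ = 0 → Z 1 ≠ 0) (t : ℝ) : Z (1 + t * Complex.I) ≠ 0 := by
  obtain ⟨Z0, hZ0d, hZ0, hZ01⟩ := Z_exists hdeg himag (0 : AddChar (Additive (ClassGroup (𝓞 K))) ℂ)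
  obtain ⟨Z2, hZ2d, hZ2, -⟩ := Z_exists hdeg himag (ψ + ψ)
  obtain ⟨m, hm, hl⟩ := Z_lim hdeg _ (fun C => (ch_norm ψ C).le) (ch_mul ψ) (ch_one ψ) _ Z hZd hZ t
  obtain ⟨m0, hm0, hl0⟩ := Z_lim hdeg _ (fun C => (ch_norm 0 C).le) (ch_mul 0) (ch_one 0) _ Z0 hZ0d hZ0 0
  obtain ⟨m2, hm2, hl2⟩ := Z_lim hdeg _ (fun C => (ch_norm (ψ + ψ) C).le) (ch_mul (ψ + ψ))
    (ch_one (ψ + ψ)) _ Z2 hZ2d hZ2 (2 * t)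
  rw [← hm]
  by_contra hmne
  have hlim := ((hl0.const_mul 3).add (hl.const_mul 4)).add hl2
  have hre := (Complex.continuous_re.tendsto _).comp hlim
  have hge := ge_of_tendsto hre (b := 0) (by
    filter_upwards [self_mem_nhdsWithin] with σ hσ
    have h := ineq341 hdeg (ch ψ) (ch_norm ψ) t σ hσ
    have hσ' : 0 ≤ σ - 1 := by have : (1 : ℝ) < σ := hσ; linarith
    have h2 := mul_nonneg hσ' h
    rw [ch_zero, ch_two]
    simp only [Function.comp_apply]
    have e1 : ∀ w : ℂ, (σ - 1) * w.re = (((σ : ℂ) - 1) * w).re := by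
      intro w
      have : ((σ : ℂ) - 1) = ((σ - 1 : ℝ) : ℂ) := by push_cast; rfl
      rw [this, Complex.re_ofReal_mul]
    rw [e1] at h2
    convert h2 using 2
    simp only [Complex.ofReal_zero, zero_mul, add_zero]
    ring)
  have hee0 : ee (0 : AddChar (Additive (ClassGroup (𝓞 K))) ℂ) = 1 := by simp [ee]
  have key : (0 : ℝ) ≤ 3 * (1 - m0) + 4 * ((if t = 0 then (ee ψ : ℝ) else 0) - m)
      + ((if t = 0 then (ee (ψ + ψ) : ℝ) else 0) - m2) := by
    refine le_of_le_of_eq hge ?_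
    rw [hee0]
    by_cases ht : t = 0 <;> simp [ht]
  have c0 : (0 : ℝ) ≤ m0 := by positivity
  have c2 : (0 : ℝ) ≤ m2 := by positivity
  have c1 : (1 : ℝ) ≤ m := by exact_mod_cast Nat.one_le_iff_ne_zero.mpr hmne
  have hz : Z (1 + t * Complex.I) = 0 := by
    by_contra h; exact hmne (hm.mpr h)
  by_cases ht : t = 0
  · subst ht
    have hz1 : Z 1 = 0 := by simpa using hz
    have hψ : ψ ≠ 0 := fun h => hZ1 h hz1
    rw [if_pos rfl, if_pos rfl] at key
    have e1 : ee ψ = 0 := by simp [ee, hψ]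
    by_cases h2 : ψ + ψ = 0
    · refine quad_ne hdeg (ch ψ) ?_ (ch_mul ψ) Z0 Z hZ0d ?_ hZd ?_ hz1
      · intro C
        have := congrFun (ch_two ψ) C
        rw [← this, h2, ch_zero]
      · intro s hs
        rw [hZ0 s hs, hee0, pow_one, ch_zero]
      · intro s hs
        rw [hZ s hs, e1, pow_zero, one_mul]
    · have e2 : ee (ψ + ψ) = 0 := by simp [ee, h2]
      rw [e1, e2] at key
      push_cast at key
      linarith
  · rw [if_neg ht, if_neg ht] at key
    linarith

theorem M_cont (hdeg : Module.finrank ℚ K = 2) (himag : ∀ v : InfinitePlace K, v.IsComplex)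
    (ψ : AddChar (Additive (ClassGroup (𝓞 K))) ℂ) : ∃ R : ℂ → ℂ, ContinuousOn R {s | 1 ≤ s.re} ∧
      ∀ s : ℂ, 1 < s.re → LSeries (cM (ch ψ)) s = ee ψ / (s - 1) - R s := by
  obtain ⟨Z, hZd, hZ, hZ1⟩ := Z_exists hdeg himag ψ
  have hsub : {s : ℂ | 1 ≤ s.re} ⊆ {s : ℂ | 0 < s.re} := fun s hs =>
    show (0 : ℝ) < s.re from lt_of_lt_of_le one_pos (show (1 : ℝ) ≤ s.re from hs)
  refine ⟨fun s => deriv Z s / Z s, ?_, ?_⟩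
  · refine ContinuousOn.div ((hZd.deriv (open_re 0)).continuousOn.mono hsub) (hZd.continuousOn.mono hsub) ?_
    intro s hs
    rcases (show (1 : ℝ) ≤ s.re from hs).eq_or_lt with h | h
    · have : s = 1 + s.im * Complex.I := by
        apply Complex.ext <;> simp [← h]
      rw [this]
      exact Z_ne hdeg himag ψ Z hZd hZ hZ1 _
    · exact (ZL_deriv hdeg _ (fun C => (ch_norm ψ C).le) (ch_mul ψ) (ch_one ψ) _ Z hZ h).1
  · intro s hs
    beta_reduce
    rw [(ZL_deriv hdeg _ (fun C => (ch_norm ψ C).le) (ch_mul ψ) (ch_one ψ) _ Z hZ hs).2]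
    ring

/-- The von Mangoldt function of a class. -/
noncomputable def lamC (C : ClassGroup (𝓞 K)) (n : ℕ) : ℝ := by
  classical exact ∑ I ∈ (fib K n).filter (fun I => cls I = C), vM I

theorem lamC_nonneg (C : ClassGroup (𝓞 K)) (n : ℕ) : 0 ≤ lamC C n :=
  Finset.sum_nonneg fun I _ => vM_nonneg I

theorem lamC_le (hdeg : Module.finrank ℚ K = 2) (C : ClassGroup (𝓞 K)) (n : ℕ) :
    lamC C n ≤ 2 * Λ n := by
  classical
  refine le_trans ?_ (sum_vM_le hdeg n)
  exact Finset.sum_le_sum_of_subset_of_nonneg (Finset.filter_subset _ _) fun I _ _ => vM_nonneg I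

theorem lamC_eq (C : ClassGroup (𝓞 K)) : (fun n => (lamC C n : ℂ)) =
    ∑ ψ : AddChar (Additive (ClassGroup (𝓞 K))) ℂ,
      ((Fintype.card (ClassGroup (𝓞 K)) : ℂ)⁻¹ * ch ψ C⁻¹) • cM (ch ψ) := by
  classical
  ext n
  have h1 : (Fintype.card (ClassGroup (𝓞 K)) : ℂ) ≠ 0 := by
    exact_mod_cast Fintype.card_ne_zero
  simp only [Finset.sum_apply, Pi.smul_apply, smul_eq_mul, cM, Finset.mul_sum]
  rw [Finset.sum_comm, lamC, Finset.sum_filter]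
  push_cast
  refine Finset.sum_congr rfl fun I _ => ?_
  have h2 := AddChar.sum_apply_eq_ite (Additive.ofMul (C⁻¹ * cls I))
  rw [← Fintype.card_congr (Additive.ofMul (α := ClassGroup (𝓞 K)))] at h2
  have h3 : ∀ ψ : AddChar (Additive (ClassGroup (𝓞 K))) ℂ,
      (Fintype.card (ClassGroup (𝓞 K)) : ℂ)⁻¹ * ch ψ C⁻¹ * (ch ψ (cls I) * vM I)
      = (Fintype.card (ClassGroup (𝓞 K)) : ℂ)⁻¹ * vM I * ψ (Additive.ofMul (C⁻¹ * cls I)) := by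
    intro ψ
    change _ = _ * ch ψ (C⁻¹ * cls I)
    rw [ch_mul]; ring
  rw [Finset.sum_congr rfl fun ψ _ => h3 ψ, ← Finset.mul_sum, h2]
  have h4 : Additive.ofMul (C⁻¹ * cls I) = 0 ↔ cls I = C := by
    rw [ofMul_eq_zero, inv_mul_eq_one, eq_comm]
  by_cases h5 : cls I = C
  · rw [if_pos h5, if_pos (h4.mpr h5)]
    field_simp
  · rw [if_neg h5, if_neg (fun h => h5 (h4.mp h))]
    simp

theorem lamC_cont (hdeg : Module.finrank ℚ K = 2) (himag : ∀ v : InfinitePlace K, v.IsComplex)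
    (C : ClassGroup (𝓞 K)) : ∃ R : ℂ → ℂ, ContinuousOn R {s | 1 ≤ s.re} ∧
      ∀ s : ℂ, 1 < s.re → LSeries (fun n => (lamC C n : ℂ)) s =
        (Fintype.card (ClassGroup (𝓞 K)) : ℂ)⁻¹ / (s - 1) + R s := by
  classical
  choose R hR hRe using M_cont (K := K) hdeg himag
  refine ⟨fun s => -∑ ψ, ((Fintype.card (ClassGroup (𝓞 K)) : ℂ)⁻¹ * ch ψ C⁻¹) * R ψ s, ?_, ?_⟩
  · exact (continuousOn_finsetSum _ fun ψ _ => (hR ψ).const_smul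
      ((Fintype.card (ClassGroup (𝓞 K)) : ℂ)⁻¹ * ch ψ C⁻¹)).neg
  · intro s hs
    rw [lamC_eq, LSeries_sum]
    · simp only [LSeries_smul, smul_eq_mul, hRe _ s hs, mul_sub, Finset.sum_sub_distrib]
      rw [sub_eq_add_neg]
      congr 1
      rw [Finset.sum_eq_single 0]
      · simp [ee, ch_zero, div_eq_mul_inv]
      · intro ψ _ h
        simp [ee, h]
      · simp
    · intro ψ _
      exact (cM_summable hdeg _ (fun C => (ch_norm ψ C).le) hs).smul _

end PIT

namespace PIT
open MeasureTheory Set Filter Topology NumberField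
open scoped nonZeroDivisors ArithmeticFunction.vonMangoldt

/-- Tauberian theorem for Dirichlet series. -/
theorem dirichlet_tauberian (f : ℕ → ℝ) (A M : ℝ) (hf : ∀ n, 0 ≤ f n)
    (hM : ∀ x : ℝ, 0 ≤ x → ∑ k ∈ Finset.Icc 1 ⌊x⌋₊, f k ≤ M * x)
    (R : ℂ → ℂ) (hR : ContinuousOn R {s | 1 ≤ s.re})
    (hL : ∀ s : ℂ, 1 < s.re → LSeries (fun n => (f n : ℂ)) s = A / (s - 1) + R s) :
    Tendsto (fun x : ℝ => (∑ k ∈ Finset.Icc 1 ⌊x⌋₊, f k) / x) atTop (𝓝 A) := by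
  set S : ℝ → ℝ := fun x => ∑ k ∈ Finset.Icc 1 ⌊x⌋₊, f k with hS
  have hSmono : Monotone S := by
    intro x y hxy
    exact Finset.sum_le_sum_of_subset_of_nonneg
      (Finset.Icc_subset_Icc_right (Nat.floor_mono hxy)) fun i _ _ => hf i
  have hS0 : ∀ x, 0 ≤ S x := fun x => Finset.sum_nonneg fun i _ => hf i
  have hSlt : ∀ x < 1, S x = 0 := by
    intro x hx
    have : ⌊x⌋₊ = 0 := Nat.floor_eq_zero.mpr hx
    simp [hS, this]
  set B : ℝ → ℝ := fun u => S (Real.exp u) * Real.exp (-u) with hB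
  have hBe : ∀ u, B u * Real.exp u = S (Real.exp u) := by
    intro u
    rw [hB]
    simp only
    rw [mul_assoc, ← Real.exp_add, neg_add_cancel, Real.exp_zero, mul_one]
  have hB0 : ∀ u, 0 ≤ B u := fun u => mul_nonneg (hS0 _) (Real.exp_pos _).le
  have hBM : ∀ u, B u ≤ M := by
    intro u
    have h1 := hM (Real.exp u) (Real.exp_pos u).le
    have h2 := mul_le_mul_of_nonneg_right h1 (Real.exp_pos (-u)).le
    rwa [mul_assoc, ← Real.exp_add, add_neg_cancel, Real.exp_zero, mul_one] at h2
  have hBneg : ∀ u < 0, B u = 0 := by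
    intro u hu
    simp only [hB]
    rw [hSlt _ (Real.exp_lt_one_iff.mpr hu), zero_mul]
  have hBmono : Monotone fun u => B u * Real.exp u := by
    simp only [hBe]
    exact hSmono.comp Real.exp_monotone
  have hBmeas : Measurable B :=
    ((hSmono.comp Real.exp_monotone).measurable).mul (Real.measurable_exp.comp measurable_neg)
  have hMg : 0 ≤ M := (hB0 0).trans (hBM 0)
  have hlim := tauberian B A M hB0 hBM hBneg hBmono (fun z => (R (1 + z) - A) / (1 + z)) ?_ ?_
  · have h2 := hlim.comp Real.tendsto_log_atTop
    refine h2.congr' ?_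
    filter_upwards [eventually_gt_atTop 0] with x hx
    simp only [Function.comp_apply, hB, Real.exp_neg, Real.exp_log hx, div_eq_mul_inv]
    rfl
  · have hne : ∀ z ∈ {z : ℂ | 0 ≤ z.re}, 1 + z ≠ 0 := by
      intro z hz h
      have := congrArg Complex.re h
      have hz' : 0 ≤ z.re := hz
      simp at this
      linarith
    refine ContinuousOn.div ((ContinuousOn.comp hR (by fun_prop) ?_).sub continuousOn_const)
      (by fun_prop) hne
    intro z hz
    have hz' : 0 ≤ z.re := hz
    change 1 ≤ (1 + z).re
    simpa using hz'
  · intro z hz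
    have hz0 : z ≠ 0 := by rintro rfl; simp at hz
    have hz1 : 1 + z ≠ 0 := by
      intro h
      have := congrArg Complex.re h
      simp at this
      linarith
    have hsre : 1 < (1 + z).re := by simpa using hz
    have hexp : IntegrableOn (fun u : ℝ => Complex.exp (-z * u)) (Ioi 0) :=
      integrableOn_exp_mul_complex_Ioi (by simpa using hz) 0
    have hBi : IntegrableOn (fun u : ℝ => (B u : ℂ) * Complex.exp (-z * u)) (Ioi 0) := by
      refine Integrable.bdd_mul (c := M) hexp
        (Complex.measurable_ofReal.comp hBmeas).aestronglyMeasurable ?_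
      refine Eventually.of_forall fun u => ?_
      rw [Complex.norm_real, Real.norm_of_nonneg (hB0 u)]
      exact hBM u
    have hI1 : ∫ u in Ioi (0:ℝ), (B u : ℂ) * Complex.exp (-z * u)
        = (A / z + R (1 + z)) / (1 + z) := by
      have h1 := LSeries_eq_mul_integral_of_nonneg f zero_le_one hsre (by
        refine Asymptotics.IsBigO.of_bound M (Eventually.of_forall fun n => ?_)
        have h2 := hM n (by positivity)
        rw [Nat.floor_natCast] at h2
        rw [Real.rpow_one, Real.norm_of_nonneg (Finset.sum_nonneg fun i _ => hf i),
          Real.norm_of_nonneg (by positivity)]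
        exact h2) hf
      rw [hL _ hsre] at h1
      have himg : Ioi (1 : ℝ) = Real.exp '' Ioi 0 := by
        ext x
        constructor
        · intro hx
          have hx' : (1 : ℝ) < x := hx
          exact ⟨Real.log x, Real.log_pos hx', Real.exp_log (by linarith)⟩
        · rintro ⟨u, hu, rfl⟩
          exact Real.one_lt_exp_iff.mpr hu
      rw [himg, integral_image_eq_integral_abs_deriv_smul measurableSet_Ioi
        (fun x _ => (Real.hasDerivAt_exp x).hasDerivWithinAt) Real.exp_injective.injOn] at h1
      rw [eq_div_iff hz1, mul_comm]
      rw [add_sub_cancel_left] at h1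
      rw [h1]
      congr 1
      refine setIntegral_congr_fun measurableSet_Ioi fun u _ => ?_
      have h3 : (Real.exp u : ℂ) ^ (-(1 + z + 1)) = Complex.exp (-(1 + z + 1) * u) := by
        rw [Complex.cpow_def_of_ne_zero (by exact_mod_cast (Real.exp_pos u).ne'),
          ← Complex.ofReal_log (Real.exp_pos u).le, Real.log_exp, mul_comm]
      rw [abs_of_pos (Real.exp_pos u), h3, Complex.real_smul]
      have h4 : (∑ k ∈ Finset.Icc 1 ⌊Real.exp u⌋₊, (f k : ℂ)) = (S (Real.exp u) : ℂ) := by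
        simp [hS]
      rw [h4]
      simp only [hB]
      rw [Complex.ofReal_mul, Complex.ofReal_exp, Complex.ofReal_exp, mul_assoc, ← Complex.exp_add,
        mul_left_comm, ← Complex.exp_add]
      congr 2
      push_cast
      ring
    have hI2 : ∫ u in Ioi (0:ℝ), (A : ℂ) * Complex.exp (-z * u) = A / z := by
      rw [integral_const_mul, integral_exp_mul_complex_Ioi (by simpa using hz)]
      simp [div_eq_mul_inv]
    have : (fun u : ℝ => ((B u - A : ℝ) : ℂ) * Complex.exp (-z * u)) =
        fun u : ℝ => (B u : ℂ) * Complex.exp (-z * u) - (A : ℂ) * Complex.exp (-z * u) := by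
      ext u; push_cast; ring
    rw [this, integral_sub hBi (hexp.const_mul _), hI1, hI2]
    field_simp
    ring

set_option linter.unusedSectionVars false
variable {K : Type*} [Field K] [NumberField K]

theorem psiC_lim (hdeg : Module.finrank ℚ K = 2) (himag : ∀ v : InfinitePlace K, v.IsComplex)
    (C : ClassGroup (𝓞 K)) :
    Tendsto (fun x : ℝ => (∑ k ∈ Finset.Icc 1 ⌊x⌋₊, lamC C k) / x) atTop
      (𝓝 (1 / (Fintype.card (ClassGroup (𝓞 K)) : ℝ))) := by
  obtain ⟨R, hR, hRe⟩ := lamC_cont hdeg himag C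
  refine dirichlet_tauberian _ _ (2 * (Real.log 4 + 4)) (lamC_nonneg C) ?_ R hR ?_
  · intro x hx
    have h1 := Chebyshev.psi_le_const_mul_self hx
    have h2 : ∑ k ∈ Finset.Icc 1 ⌊x⌋₊, lamC C k ≤ 2 * Chebyshev.psi x := by
      rw [Chebyshev.psi, Finset.mul_sum]
      exact Finset.sum_le_sum fun k _ => lamC_le hdeg C k
    linarith
  · intro s hs
    rw [hRe s hs]
    push_cast
    rw [one_div]

end PIT

namespace PIT
open MeasureTheory Set Filter Topology NumberField

theorem ratio_lim : Tendsto (fun L : ℝ => L / (L - 2 * Real.log L)) atTop (𝓝 1) := by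
  have h1 : Tendsto (fun L : ℝ => Real.log L / L) atTop (𝓝 0) :=
    Real.isLittleO_log_id_atTop.tendsto_div_nhds_zero
  have h2 : Tendsto (fun L : ℝ => (1 - 2 * (Real.log L / L))⁻¹) atTop (𝓝 ((1 - 2 * 0)⁻¹)) :=
    (tendsto_const_nhds.sub (h1.const_mul 2)).inv₀ (by norm_num)
  rw [show ((1 - 2 * 0 : ℝ)⁻¹) = 1 by norm_num] at h2
  refine h2.congr' ?_
  filter_upwards [eventually_gt_atTop 0] with L hL
  rw [show L - 2 * Real.log L = L * (1 - 2 * (Real.log L / L)) by field_simp]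
  rw [div_mul_eq_div_div, div_self hL.ne', one_div]

theorem theta_to_pi (c : ℕ → ℝ) (A : ℝ) (hc0 : ∀ n, 0 ≤ c n) (hc2 : ∀ n, c n ≤ 2)
    (h : Tendsto (fun x : ℝ => (∑ n ∈ Finset.Icc 1 ⌊x⌋₊, c n * Real.log n) / x) atTop (𝓝 A)) :
    Tendsto (fun x : ℝ => (∑ n ∈ Finset.Icc 1 ⌊x⌋₊, c n) / (x / Real.log x)) atTop (𝓝 A) := by
  have hlog := Real.tendsto_log_atTop
  have hup : Tendsto (fun x : ℝ => 2 / Real.log x + (∑ n ∈ Finset.Icc 1 ⌊x⌋₊, c n * Real.log n) / x *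
      (Real.log x / (Real.log x - 2 * Real.log (Real.log x)))) atTop (𝓝 (0 + A * 1)) :=
    (hlog.const_div_atTop 2).add (h.mul (ratio_lim.comp hlog))
  rw [zero_add, mul_one] at hup
  have hpos : ∀ᶠ L : ℝ in atTop, 0 < L - 2 * Real.log L := by
    have h1 : Tendsto (fun L : ℝ => Real.log L / L) atTop (𝓝 0) :=
      Real.isLittleO_log_id_atTop.tendsto_div_nhds_zero
    filter_upwards [h1.eventually (gt_mem_nhds (show (0 : ℝ) < 1 / 2 by norm_num)),
      eventually_gt_atTop 0] with L h2 h3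
    rw [div_lt_iff₀ h3] at h2
    linarith
  refine tendsto_of_tendsto_of_tendsto_of_le_of_le' h hup ?_ ?_
  · filter_upwards [eventually_gt_atTop 1] with x hx
    have hl := Real.log_pos hx
    rw [div_div_eq_mul_div]
    refine div_le_div_of_nonneg_right ?_ (by linarith)
    rw [Finset.sum_mul]
    refine Finset.sum_le_sum fun n hn => mul_le_mul_of_nonneg_left ?_ (hc0 n)
    have hn := Finset.mem_Icc.mp hn
    exact Real.log_le_log (by exact_mod_cast hn.1) ((Nat.le_floor_iff (by linarith)).mp hn.2)
  · filter_upwards [eventually_gt_atTop 1, hlog.eventually hpos] with x hx hy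
    have hl := Real.log_pos hx
    set y : ℝ := x / Real.log x ^ 2 with hydef
    have hy0 : 0 < y := by positivity
    have hlogy : Real.log y = Real.log x - 2 * Real.log (Real.log x) := by
      rw [hydef, Real.log_div (by linarith) (by positivity), Real.log_pow]
      norm_num
    rw [← hlogy] at hy ⊢
    have key : ∑ n ∈ Finset.Icc 1 ⌊x⌋₊, c n ≤
        2 * y + (∑ n ∈ Finset.Icc 1 ⌊x⌋₊, c n * Real.log n) / Real.log y := by
      have h1 : ∀ n ∈ Finset.Icc 1 ⌊x⌋₊, c n ≤ (if n ∈ Finset.Icc 1 ⌊y⌋₊ then 2 else 0)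
          + c n * Real.log n / Real.log y := by
        intro n hn
        have hn' := Finset.mem_Icc.mp hn
        have hln : 0 ≤ Real.log n := Real.log_nonneg (by exact_mod_cast hn'.1)
        split_ifs with h2
        · have : 0 ≤ c n * Real.log n / Real.log y := div_nonneg (mul_nonneg (hc0 n) hln) hy.le
          linarith [hc2 n]
        · have h3 : ⌊y⌋₊ < n := by
            by_contra h4
            exact h2 (Finset.mem_Icc.mpr ⟨hn'.1, not_lt.mp h4⟩)
          have h4 : y < n := (Nat.floor_lt hy0.le).mp h3
          have h5 := Real.log_le_log hy0 h4.le
          rw [zero_add, le_div_iff₀ hy]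
          exact mul_le_mul_of_nonneg_left h5 (hc0 n)
      refine (Finset.sum_le_sum h1).trans ?_
      rw [Finset.sum_add_distrib, Finset.sum_div]
      refine add_le_add_left ?_ _
      rw [← Finset.sum_filter, Finset.sum_const, nsmul_eq_mul, mul_comm]
      refine mul_le_mul_of_nonneg_left ?_ (by norm_num)
      have h6 : ((Finset.Icc 1 ⌊x⌋₊).filter (fun n => n ∈ Finset.Icc 1 ⌊y⌋₊)).card ≤ ⌊y⌋₊ := by
        refine (Finset.card_le_card (t := Finset.Icc 1 ⌊y⌋₊) ?_).trans (by simp)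
        intro n hn
        exact (Finset.mem_filter.mp hn).2
      exact le_trans (by exact_mod_cast h6) (Nat.floor_le hy0.le)
    rw [div_div_eq_mul_div]
    have hx0 : 0 < x := by linarith
    rw [div_le_iff₀ hx0]
    refine (mul_le_mul_of_nonneg_right key hl.le).trans (le_of_eq ?_)
    rw [hydef]
    field_simp

end PIT

namespace PIT
open MeasureTheory Set Filter Topology NumberField
open scoped nonZeroDivisors ArithmeticFunction.vonMangoldt

set_option linter.unusedSectionVars false
variable {K : Type*} [Field K] [NumberField K]

theorem dvd_different (P : Ideal (𝓞 K)) (p : ℕ) (hp : p.Prime)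
    (h : P ^ 2 ∣ Ideal.span {(p : 𝓞 K)}) : P ∣ differentIdeal ℤ (𝓞 K) := by
  have hb : (Ideal.span {(p : ℤ)}) ≠ ⊥ := by simp [hp.ne_zero]
  have : (Ideal.span {(p : ℤ)}).IsMaximal := by
    have : Prime (p : ℤ) := Nat.prime_iff_prime_int.mp hp
    exact ((Ideal.span_singleton_prime this.ne_zero).mpr this).isMaximal hb
  have := pow_sub_one_dvd_differentIdeal ℤ (p := Ideal.span {(p : ℤ)}) P 2 hb (by
    rw [Ideal.map_span]; simpa using h)
  simpa using this

def good (I : Ideal (𝓞 K)) : Prop :=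
  I.IsPrime ∧ (Ideal.absNorm I).Prime ∧
    ∃ Q : Ideal (𝓞 K), Q.IsPrime ∧ Q ≠ I ∧ I * Q = Ideal.span {((Ideal.absNorm I : ℕ) : 𝓞 K)}

theorem good_of_large (hdeg : Module.finrank ℚ K = 2) {I : Ideal (𝓞 K)}
    (hp : (Ideal.absNorm I).Prime) (hlarge : Ideal.absNorm (differentIdeal ℤ (𝓞 K)) < Ideal.absNorm I) :
    good I := by
  have hI : I.IsPrime := Ideal.isPrime_of_irreducible_absNorm hp
  refine ⟨hI, hp, ?_⟩
  have hmem := Ideal.absNorm_mem I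
  obtain ⟨Q, hQ⟩ : I ∣ Ideal.span {((Ideal.absNorm I : ℕ) : 𝓞 K)} := by
    rw [Ideal.dvd_span_singleton]; exact hmem
  have hn := congrArg Ideal.absNorm hQ
  rw [norm_span hdeg, map_mul, pow_two] at hn
  have hQn : Ideal.absNorm Q = Ideal.absNorm I := (Nat.eq_of_mul_eq_mul_left hp.pos hn).symm
  refine ⟨Q, Ideal.isPrime_of_irreducible_absNorm (by rw [hQn]; exact hp), ?_, hQ.symm⟩
  rintro rfl
  have h1 := dvd_different Q _ hp (by rw [hQ, pow_two])
  have h2 := map_dvd Ideal.absNorm h1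
  have h3 : Ideal.absNorm (differentIdeal ℤ (𝓞 K)) ≠ 0 := by
    rw [Ne, Ideal.absNorm_eq_zero_iff]; exact differentIdeal_ne_bot
  have := Nat.le_of_dvd (Nat.pos_of_ne_zero h3) h2
  omega

open Classical in
noncomputable def gset (C : ClassGroup (𝓞 K)) (n : ℕ) : Finset (Ideal (𝓞 K)) :=
  (fib K n).filter (fun I => cls I = C ∧ good I)

theorem mem_gset {C : ClassGroup (𝓞 K)} {n : ℕ} {I : Ideal (𝓞 K)} :
    I ∈ gset C n ↔ (I ≠ 0 ∧ Ideal.absNorm I = n) ∧ cls I = C ∧ good I := by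
  classical
  rw [gset, Finset.mem_filter, mem_fib]

theorem gset_empty (C : ClassGroup (𝓞 K)) {n : ℕ} (hn : ¬ n.Prime) : gset C n = ∅ := by
  rw [Finset.eq_empty_iff_forall_notMem]
  intro I hI
  rw [mem_gset] at hI
  exact hn (hI.1.2 ▸ hI.2.2.2.1)

theorem vM_of_prime_norm {I : Ideal (𝓞 K)} (hI : I ≠ 0) (hp : (Ideal.absNorm I).Prime) :
    vM I = Real.log (Ideal.absNorm I) := by
  have h1 : I.IsPrime := Ideal.isPrime_of_irreducible_absNorm hp
  have h2 : Prime I := Ideal.prime_of_isPrime hI h1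
  have h3 := vM_pow h2 one_pos
  rwa [pow_one] at h3

theorem gset_log (C : ClassGroup (𝓞 K)) (n : ℕ) :
    ((gset C n).card : ℝ) * Real.log n = ∑ I ∈ gset C n, vM I := by
  rw [← nsmul_eq_mul, ← Finset.sum_const]
  refine Finset.sum_congr rfl fun I hI => ?_
  rw [mem_gset] at hI
  rw [vM_of_prime_norm hI.1.1 hI.2.2.2.1, hI.1.2]

theorem gset_le (C : ClassGroup (𝓞 K)) (n : ℕ) :
    ((gset C n).card : ℝ) * Real.log n ≤ lamC C n := by
  classical
  rw [gset_log, lamC]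
  refine Finset.sum_le_sum_of_subset_of_nonneg ?_ fun I _ _ => vM_nonneg I
  intro I hI
  rw [mem_gset] at hI
  rw [Finset.mem_filter, mem_fib]
  exact ⟨hI.1, hI.2.1⟩

theorem gset_card_le (hdeg : Module.finrank ℚ K = 2) (C : ClassGroup (𝓞 K)) (n : ℕ) :
    ((gset C n).card : ℝ) ≤ 2 := by
  by_cases hn : n.Prime
  · have h1 := (gset_le C n).trans (lamC_le hdeg C n)
    rw [ArithmeticFunction.vonMangoldt_apply_prime hn] at h1
    exact le_of_mul_le_mul_right h1 (Real.log_pos (by exact_mod_cast hn.one_lt))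
  · rw [gset_empty C hn]; norm_num

theorem lamC_sub_le (hdeg : Module.finrank ℚ K = 2) (C : ClassGroup (𝓞 K)) (n : ℕ) :
    lamC C n - ((gset C n).card : ℝ) * Real.log n ≤
      (if ¬ n.Prime then 2 * Λ n else 0) +
      (if n ∈ Finset.range (Ideal.absNorm (differentIdeal ℤ (𝓞 K)) + 1) then 2 * Λ n else 0) := by
  classical
  have hL : (0 : ℝ) ≤ Λ n := ArithmeticFunction.vonMangoldt_nonneg
  have h1 := lamC_le hdeg C n
  have h0 : 0 ≤ ((gset C n).card : ℝ) * Real.log n := by positivity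
  by_cases hn : n.Prime
  · by_cases hs : n ∈ Finset.range (Ideal.absNorm (differentIdeal ℤ (𝓞 K)) + 1)
    · rw [if_pos hs, if_neg (not_not.mpr hn)]
      linarith
    · rw [if_neg hs, if_neg (not_not.mpr hn), gset_log, lamC]
      rw [Finset.mem_range] at hs
      have : (fib K n).filter (fun I => cls I = C) = gset C n := by
        ext I
        rw [Finset.mem_filter, mem_fib, mem_gset]
        refine ⟨fun h => ⟨h.1, h.2, ?_⟩, fun h => ⟨h.1, h.2.1⟩⟩
        apply good_of_large hdeg
        · rw [h.1.2]; exact hn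
        · rw [h.1.2]; omega
      rw [this]
      simp
  · rw [if_pos hn]
    split_ifs <;> linarith

theorem thetaC_lim (hdeg : Module.finrank ℚ K = 2) (himag : ∀ v : InfinitePlace K, v.IsComplex)
    (C : ClassGroup (𝓞 K)) :
    Tendsto (fun x : ℝ => (∑ k ∈ Finset.Icc 1 ⌊x⌋₊, ((gset C k).card : ℝ) * Real.log k) / x) atTop
      (𝓝 (1 / (Fintype.card (ClassGroup (𝓞 K)) : ℝ))) := by
  have hψ := psiC_lim hdeg himag C
  set E : ℝ := ∑ n ∈ Finset.range (Ideal.absNorm (differentIdeal ℤ (𝓞 K)) + 1), 2 * Λ n with hE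
  have hd : Tendsto (fun x : ℝ => (∑ k ∈ Finset.Icc 1 ⌊x⌋₊, lamC C k
      - ∑ k ∈ Finset.Icc 1 ⌊x⌋₊, ((gset C k).card : ℝ) * Real.log k) / x) atTop (𝓝 0) := by
    have h1 : Tendsto (fun x : ℝ => 2 * ((Chebyshev.psi - Chebyshev.theta) x / x) + E / x) atTop
        (𝓝 (2 * 0 + 0)) := by
      refine Tendsto.add (Tendsto.const_mul 2 ?_) (tendsto_id.const_div_atTop E)
      refine (Chebyshev.isBigO_psi_sub_theta_sqrt.trans_isLittleO ?_).tendsto_div_nhds_zero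
      refine Asymptotics.isLittleO_of_tendsto' ?_ ?_
      · filter_upwards [eventually_gt_atTop 0] with x hx h
        exact absurd h hx.ne'
      · refine (Real.tendsto_sqrt_atTop.const_div_atTop 1).congr' ?_
        filter_upwards [eventually_gt_atTop 0] with x hx
        rw [Real.sqrt_div_self', one_div]
    rw [mul_zero, add_zero] at h1
    refine tendsto_of_tendsto_of_tendsto_of_le_of_le' tendsto_const_nhds h1 ?_ ?_
    · filter_upwards [eventually_gt_atTop 0] with x hx
      refine div_nonneg ?_ hx.le
      rw [sub_nonneg]
      exact Finset.sum_le_sum fun k _ => gset_le C k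
    · filter_upwards [eventually_gt_atTop 0] with x hx
      rw [← mul_div_assoc, ← add_div]
      refine div_le_div_of_nonneg_right ?_ hx.le
      rw [Pi.sub_apply, Chebyshev.psi_sub_theta_eq_sum_not_prime, ← Finset.sum_sub_distrib]
      refine (Finset.sum_le_sum fun k _ => lamC_sub_le hdeg C k).trans ?_
      rw [Finset.sum_add_distrib, ← Finset.sum_filter, ← Finset.sum_filter, ← Finset.mul_sum]
      refine add_le_add (le_of_eq rfl) ?_
      refine Finset.sum_le_sum_of_subset_of_nonneg ?_ fun i _ _ =>
        mul_nonneg zero_le_two ArithmeticFunction.vonMangoldt_nonneg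
      intro n hn
      exact (Finset.mem_filter.mp hn).2
  have := hψ.sub hd
  rw [sub_zero] at this
  refine this.congr fun x => ?_
  rw [← sub_div, sub_sub_cancel]

theorem card_eq (C : ClassGroup (𝓞 K)) (x : ℝ) (hx : 0 ≤ x) :
    (Nat.card {P : Ideal (𝓞 K) //
            P.IsPrime ∧
            (∃ hP : P ∈ nonZeroDivisors (Ideal (𝓞 K)), ClassGroup.mk0 ⟨P, hP⟩ = C) ∧
            (Ideal.absNorm P : ℝ) ≤ x ∧ (Ideal.absNorm P).Prime ∧
            (∃ Q : Ideal (𝓞 K), Q.IsPrime ∧ Q ≠ P ∧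
              P * Q = Ideal.span {((Ideal.absNorm P : ℕ) : 𝓞 K)})} : ℝ)
      = ∑ k ∈ Finset.Icc 1 ⌊x⌋₊, ((gset C k).card : ℝ) := by
  classical
  rw [← Nat.cast_sum, ← Finset.card_biUnion]
  · rw [Nat.subtype_card ((Finset.Icc 1 ⌊x⌋₊).biUnion (gset C))]
    intro I
    rw [Finset.mem_biUnion]
    constructor
    · rintro ⟨k, hk, hI⟩
      rw [mem_gset] at hI
      obtain ⟨⟨h0, rfl⟩, h1, h2, h3, h4⟩ := hI
      have hm : I ∈ (Ideal (𝓞 K))⁰ := mem_nonZeroDivisors_of_ne_zero h0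
      exact ⟨h2, ⟨hm, by rw [← cls_eq hm, h1]⟩,
        (Nat.le_floor_iff hx).mp (Finset.mem_Icc.mp hk).2, h3, h4⟩
    · rintro ⟨h2, ⟨hm, h1⟩, hle, h3, h4⟩
      refine ⟨Ideal.absNorm I, Finset.mem_Icc.mpr ⟨h3.pos, (Nat.le_floor_iff hx).mpr hle⟩, ?_⟩
      rw [mem_gset]
      exact ⟨⟨nonZeroDivisors.ne_zero hm, rfl⟩, by rw [cls_eq hm, h1], h2, h3, h4⟩
  · intro a _ b _ hab
    rw [Function.onFun, Finset.disjoint_left]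
    intro I h1 h2
    rw [mem_gset] at h1 h2
    exact hab (h1.1.2.symm.trans h2.1.2)

end PIT


open NumberField Filter

theorem prime_ideal_equidistribution_in_classes
    (K : Type*) [Field K] [NumberField K]
    (hdeg : Module.finrank ℚ K = 2)
    (himag : ∀ v : InfinitePlace K, v.IsComplex)
    (C : ClassGroup (𝓞 K)) :
    Filter.Tendsto (fun x : ℝ =>
        (Nat.card {P : Ideal (𝓞 K) //
            P.IsPrime ∧
            (∃ hP : P ∈ nonZeroDivisors (Ideal (𝓞 K)), ClassGroup.mk0 ⟨P, hP⟩ = C) ∧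
            (Ideal.absNorm P : ℝ) ≤ x ∧
            (Ideal.absNorm P).Prime ∧
            (∃ Q : Ideal (𝓞 K), Q.IsPrime ∧ Q ≠ P ∧
              P * Q = Ideal.span {((Ideal.absNorm P : ℕ) : 𝓞 K)})} : ℝ)
          / (x / Real.log x))
      Filter.atTop
      (nhds (1 / (Fintype.card (ClassGroup (𝓞 K)) : ℝ))) := by
  have h := PIT.theta_to_pi (fun k => ((PIT.gset C k).card : ℝ)) _ (fun n => by positivity)
    (PIT.gset_card_le hdeg C) (PIT.thetaC_lim hdeg himag C)
  refine h.congr' ?_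
  filter_upwards [eventually_ge_atTop 0] with x hx
  rw [PIT.card_eq C x hx]
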